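/- arXiv:0801.2291 — 2 statements merged into one kernel-verified Lean document; each statement's English description precedes it below -/
import Mathlib

section
/- Let u be a bounded solution of Pu = f on ℝ^N × ℝ, where f is uniformly continuous on ℝ^{N+1} and almost periodic in the m-th variable (m ∈ {1,…,N+1}), and where either (a) P is periodic in the m-th variable and c ≤ 0, or (b) P = ∂_t − L with L periodic and λ_p(−L) ≥ 0. Then u is almost periodic in the m-th variable. -/
open Filter Topology

noncomputable section

/-- First-order spatial partial derivative in the direction `i`. -/
def pd {N : ℕ} (i : Fin N) (φ : (Fin N → ℝ) → ℝ) (x : Fin N → ℝ) : ℝ :=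
  fderiv ℝ φ x (Pi.single i 1)

/-- Second-order spatial partial derivative `∂ᵢⱼ`. -/
def pd2 {N : ℕ} (i j : Fin N) (φ : (Fin N → ℝ) → ℝ) (x : Fin N → ℝ) : ℝ :=
  pd i (fun y => pd j φ y) x

/-- The parabolic operator `P u = ∂ₜ u − aᵢⱼ ∂ᵢⱼ u − bᵢ ∂ᵢ u − c u`. -/
def parOp {N : ℕ} (a : Fin N → Fin N → (Fin N → ℝ) → ℝ → ℝ)
    (b : Fin N → (Fin N → ℝ) → ℝ → ℝ) (c : (Fin N → ℝ) → ℝ → ℝ)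
    (u : (Fin N → ℝ) → ℝ → ℝ) (x : Fin N → ℝ) (t : ℝ) : ℝ :=
  deriv (fun s => u x s) t
    - (∑ i, ∑ j, a i j x t * pd2 i j (fun y => u y t) x)
    - (∑ i, b i x t * pd i (fun y => u y t) x)
    - c x t * u x t

/-- A bounded function on `ℝ^N × ℝ`. -/
def Bdd2 {N : ℕ} (φ : (Fin N → ℝ) → ℝ → ℝ) : Prop :=
  ∃ M : ℝ, ∀ x t, |φ x t| ≤ M

/-- A uniformly continuous function on `ℝ^N × ℝ`. -/
def UC2 {N : ℕ} (φ : (Fin N → ℝ) → ℝ → ℝ) : Prop :=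
  UniformContinuous fun p : (Fin N → ℝ) × ℝ => φ p.1 p.2

/-- Standing assumptions on the coefficients of `P`: `a`, `b` bounded and uniformly
continuous, `c` bounded and measurable, `(aᵢⱼ)` symmetric and uniformly elliptic. -/
def StdCoeffs {N : ℕ} (a : Fin N → Fin N → (Fin N → ℝ) → ℝ → ℝ)
    (b : Fin N → (Fin N → ℝ) → ℝ → ℝ) (c : (Fin N → ℝ) → ℝ → ℝ) : Prop :=
  (∀ i j, Bdd2 (a i j)) ∧ (∀ i j, UC2 (a i j)) ∧
  (∀ i, Bdd2 (b i)) ∧ (∀ i, UC2 (b i)) ∧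
  Bdd2 c ∧ Measurable (fun p : (Fin N → ℝ) × ℝ => c p.1 p.2) ∧
  (∀ i j x t, a i j x t = a j i x t) ∧
  (∃ a₀ a₁ : ℝ, 0 < a₀ ∧ a₀ ≤ a₁ ∧ ∀ (x : Fin N → ℝ) (t : ℝ) (ξ : Fin N → ℝ),
    a₀ * ∑ i, ξ i ^ 2 ≤ ∑ i, ∑ j, a i j x t * ξ i * ξ j ∧
    ∑ i, ∑ j, a i j x t * ξ i * ξ j ≤ a₁ * ∑ i, ξ i ^ 2)

/-- Regularity required of entire solutions (classical reading of the notion of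
solution used in the paper). -/
def RegSol {N : ℕ} (u : (Fin N → ℝ) → ℝ → ℝ) : Prop :=
  Continuous (fun p : (Fin N → ℝ) × ℝ => u p.1 p.2) ∧
  (∀ x, Differentiable ℝ fun s => u x s) ∧
  (∀ t, ContDiff ℝ 2 fun y => u y t)

/-- `u` is an entire solution of `P u = f` on `ℝ^N × ℝ`. -/
def IsSol {N : ℕ} (a : Fin N → Fin N → (Fin N → ℝ) → ℝ → ℝ)
    (b : Fin N → (Fin N → ℝ) → ℝ → ℝ) (c : (Fin N → ℝ) → ℝ → ℝ)
    (f u : (Fin N → ℝ) → ℝ → ℝ) : Prop :=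
  RegSol u ∧ ∀ x t, parOp a b c u x t = f x t

/-- Periodicity, with period `l`, in the `m`-th of the `N+1` space-time variables:
if `m ≤ N` this is periodicity in the space direction `x_m`, if `m = N+1` it is
periodicity in time. -/
def PerInVar {N : ℕ} (m : Fin (N + 1)) (l : ℝ) (φ : (Fin N → ℝ) → ℝ → ℝ) : Prop :=
  if h : (m : ℕ) < N then ∀ x t, φ (x + Pi.single (⟨(m : ℕ), h⟩ : Fin N) l) t = φ x t
  else ∀ x t, φ x (t + l) = φ x t
/-- Full space-time periodicity with space periods `l i` and time period `τ`. -/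
def PerAll {N : ℕ} (l : Fin N → ℝ) (τ : ℝ) (φ : (Fin N → ℝ) → ℝ → ℝ) : Prop :=
  (∀ (i : Fin N) (x : Fin N → ℝ) (t : ℝ), φ (x + Pi.single i (l i)) t = φ x t) ∧
  (∀ (x : Fin N → ℝ) (t : ℝ), φ x (t + τ) = φ x t)

/-- The elliptic operator `L φ = Aᵢⱼ ∂ᵢⱼ φ + Bᵢ ∂ᵢ φ + C φ` (time-independent
coefficients). -/
def ellOp {N : ℕ} (A : Fin N → Fin N → (Fin N → ℝ) → ℝ)
    (B : Fin N → (Fin N → ℝ) → ℝ) (C : (Fin N → ℝ) → ℝ)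
    (φ : (Fin N → ℝ) → ℝ) (x : Fin N → ℝ) : ℝ :=
  (∑ i, ∑ j, A i j x * pd2 i j φ x) + (∑ i, B i x * pd i φ x) + C x * φ x

/-- A function on `ℝ^N` periodic with period `(l 1, …, l N)`. -/
def PerSpaceFun {N : ℕ} (l : Fin N → ℝ) (ψ : (Fin N → ℝ) → ℝ) : Prop :=
  ∀ (i : Fin N) (x : Fin N → ℝ), ψ (x + Pi.single i (l i)) = ψ x

/-- `(lam, φ)` is the periodic principal eigenpair of `−L` in `ℝ^N`:
`φ` is positive, periodic (with the periods of `L`) and `−Lφ = lam • φ`. -/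
def IsPerPrincipal {N : ℕ} (A : Fin N → Fin N → (Fin N → ℝ) → ℝ)
    (B : Fin N → (Fin N → ℝ) → ℝ) (C : (Fin N → ℝ) → ℝ)
    (l : Fin N → ℝ) (lam : ℝ) (φ : (Fin N → ℝ) → ℝ) : Prop :=
  ContDiff ℝ 2 φ ∧ (∀ x, 0 < φ x) ∧ PerSpaceFun l φ ∧
  ∀ x, -(ellOp A B C φ x) = lam * φ x
/-- A continuous function `φ : ℝ → ℝ` is almost periodic (Bochner's
characterization). -/
def AlmostPeriodic1 (φ : ℝ → ℝ) : Prop :=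
  Continuous φ ∧ ∀ s : ℕ → ℝ, ∃ k : ℕ → ℕ, StrictMono k ∧
    ∃ ψ : ℝ → ℝ, TendstoUniformly (fun n x => φ (x + s (k n))) ψ atTop

/-- The one-variable function obtained from `φ : ℝ^N × ℝ → ℝ` by letting the `m`-th
space-time variable vary while the other `N` coordinates are frozen at the values
prescribed by `(x, t)`. -/
def sliceVar {N : ℕ} (m : Fin (N + 1)) (φ : (Fin N → ℝ) → ℝ → ℝ)
    (x : Fin N → ℝ) (t : ℝ) : ℝ → ℝ :=
  if h : (m : ℕ) < N then fun s => φ (Function.update x (⟨(m : ℕ), h⟩ : Fin N) s) t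
  else fun s => φ x s

/-- `φ` is almost periodic in the `m`-th variable: for every fixed choice of the
other `N` coordinates, the one-variable function in the `m`-th variable is almost
periodic. -/
def APinVar {N : ℕ} (m : Fin (N + 1)) (φ : (Fin N → ℝ) → ℝ → ℝ) : Prop :=
  ∀ (x : Fin N → ℝ) (t : ℝ), AlmostPeriodic1 (sliceVar m φ x t)

/-- Necessary second order condition at a local maximum, one variable. -/
lemma second_test {g g1 : ℝ → ℝ} {g2 : ℝ} (h1 : ∀ᶠ s in 𝓝 (0:ℝ), HasDerivAt g (g1 s) s)
    (h2 : HasDerivAt g1 g2 0) (hm : IsLocalMax g 0) : g1 0 = 0 ∧ g2 ≤ 0 := by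
  have h0 : HasDerivAt g (g1 0) 0 := h1.self_of_nhds
  have hz : g1 0 = 0 := hm.hasDerivAt_eq_zero h0
  refine ⟨hz, ?_⟩
  by_contra hpos
  push Not at hpos
  have hde : deriv g =ᶠ[𝓝 0] g1 := h1.mono fun s hs => hs.deriv
  have hdd : deriv (deriv g) 0 = g2 := by
    rw [hde.deriv_eq]; exact h2.deriv
  have hmin : IsLocalMin g 0 := by
    apply isLocalMin_of_deriv_deriv_pos
    · rw [hdd]; exact hpos
    · rw [h0.deriv, hz]
    · exact h0.continuousAt
  have hconst : ∀ᶠ s in 𝓝 (0:ℝ), g s = g 0 := by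
    filter_upwards [hm, hmin] with s hs hs'
    exact le_antisymm hs hs'
  have hconst2 : ∀ᶠ s in 𝓝 (0:ℝ), g1 s = 0 := by
    filter_upwards [hconst.eventually_nhds, h1] with s hs hs1
    have : g =ᶠ[𝓝 s] fun _ => g 0 := hs
    have h3 := this.deriv_eq
    rw [hs1.deriv] at h3
    simpa using h3
  have h4 : g1 =ᶠ[𝓝 0] fun _ => (0:ℝ) := hconst2
  have h5 := h4.deriv_eq
  rw [h2.deriv] at h5
  simp at h5
  linarith

lemma line_deriv1 {N : ℕ} {v : (Fin N → ℝ) → ℝ} (hv : Differentiable ℝ v) (x ξ : Fin N → ℝ) (s : ℝ) :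
    HasDerivAt (fun s : ℝ => v (x + s • ξ)) (∑ i, pd i v (x + s • ξ) * ξ i) s := by
  have h1 : HasDerivAt (fun s : ℝ => x + s • ξ) ξ s := by
    simpa using ((hasDerivAt_id s).smul_const ξ).const_add x
  have h2 := (hv (x + s • ξ)).hasFDerivAt.comp_hasDerivAt s h1
  refine h2.congr_deriv ?_
  have : ξ = ∑ i, ξ i • (Pi.single i (1:ℝ) : Fin N → ℝ) := by
    ext k
    simp [Finset.sum_apply, Pi.single_apply]
  conv_lhs => enter [2]; rw [this]
  rw [map_sum]
  apply Finset.sum_congr rfl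
  intro i _
  rw [map_smul]
  simp [pd, mul_comm]

lemma pd_diff {N : ℕ} {v : (Fin N → ℝ) → ℝ} (hv : ContDiff ℝ 2 v) (i : Fin N) :
    Differentiable ℝ (fun y => pd i v y) := by
  have h1 : ContDiff ℝ 1 (fderiv ℝ v) := hv.fderiv_right (by norm_num)
  have h2 : Differentiable ℝ (fderiv ℝ v) := h1.differentiable (by norm_num)
  unfold pd
  fun_prop

lemma line_deriv2 {N : ℕ} {v : (Fin N → ℝ) → ℝ} (hv : ContDiff ℝ 2 v) (x ξ : Fin N → ℝ) :
    HasDerivAt (fun s : ℝ => ∑ i, pd i v (x + s • ξ) * ξ i)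
      (∑ i, ∑ j, pd2 i j v x * ξ i * ξ j) 0 := by
  have h : ∀ j ∈ (Finset.univ : Finset (Fin N)),
      HasDerivAt (fun s : ℝ => pd j v (x + s • ξ) * ξ j)
        ((∑ i, pd2 i j v x * ξ i) * ξ j) 0 := by
    intro j _
    have := (line_deriv1 (pd_diff hv j) x ξ 0).mul_const (ξ j)
    simpa [pd2] using this
  have h2 := HasDerivAt.fun_sum h
  refine h2.congr_deriv ?_
  rw [Finset.sum_comm]
  symm
  apply Finset.sum_congr rfl
  intro j _
  rw [Finset.sum_mul]

/-- Trace inequality. -/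
lemma trace_le {N : ℕ} (A H G : Fin N → Fin N → ℝ) (hs : ∀ i j, A i j = A j i)
    (hA : ∀ ξ : Fin N → ℝ, 0 ≤ ∑ i, ∑ j, A i j * ξ i * ξ j)
    (hH : ∀ ξ : Fin N → ℝ, ∑ i, ∑ j, H i j * ξ i * ξ j ≤ ∑ i, ∑ j, G i j * ξ i * ξ j) :
    ∑ i, ∑ j, A i j * H i j ≤ ∑ i, ∑ j, A i j * G i j := by
  have hP : (Matrix.of A).PosSemidef := by
    refine Matrix.PosSemidef.of_dotProduct_mulVec_nonneg ?_ ?_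
    · ext i j; simp [Matrix.conjTranspose_apply, hs i j]
    · intro ξ
      have := hA ξ
      simp only [dotProduct, Matrix.mulVec, Matrix.of_apply, Pi.star_apply, star_trivial, Finset.mul_sum]
      refine this.trans (le_of_eq ?_)
      refine Finset.sum_congr rfl fun i _ => Finset.sum_congr rfl fun j _ => by ring
  obtain ⟨B, hB⟩ : ∃ B : Matrix (Fin N) (Fin N) ℝ, Matrix.of A = B.conjTranspose * B := by
    open scoped MatrixOrder in
    exact CStarAlgebra.nonneg_iff_eq_star_mul_self.mp hP.nonneg
  have hAB : ∀ i j, A i j = ∑ k, B k i * B k j := by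
    intro i j
    have := congrFun (congrFun hB i) j
    simpa [Matrix.mul_apply] using this
  have key : ∀ M : Fin N → Fin N → ℝ,
      ∑ i, ∑ j, A i j * M i j = ∑ k, ∑ i, ∑ j, M i j * B k i * B k j := by
    intro M
    simp only [hAB, Finset.sum_mul]
    have e1 : ∀ i, ∑ j, ∑ k, B k i * B k j * M i j = ∑ k, ∑ j, M i j * B k i * B k j := by
      intro i
      rw [Finset.sum_comm]
      refine Finset.sum_congr rfl fun k _ => Finset.sum_congr rfl fun j _ => by ring
    simp only [e1]
    rw [Finset.sum_comm]
  rw [key, key]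
  exact Finset.sum_le_sum fun k _ => hH (B k)

/-- Left maximum in time. -/
lemma left_max_deriv {g : ℝ → ℝ} {g' t : ℝ} (h : HasDerivAt g g' t)
    (hm : ∀ᶠ s in 𝓝[<] t, g s ≤ g t) : 0 ≤ g' := by
  have h1 : HasDerivWithinAt g g' (Set.Iio t) t := h.hasDerivWithinAt
  have h2 := (hasDerivWithinAt_iff_tendsto_slope' (by simp)).1 h1
  refine ge_of_tendsto h2 ?_
  filter_upwards [hm, self_mem_nhdsWithin] with s hs hst
  have hst' : s < t := hst
  rw [slope_def_field]
  apply div_nonneg_of_nonpos <;> linarith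

/-- Maximum test: comparison of derivatives of a classical function with those of a test function. -/
lemma max_test {N : ℕ} {w : (Fin N → ℝ) → ℝ → ℝ} (hw : RegSol w) {β : (Fin N → ℝ) → ℝ → ℝ}
    (x : Fin N → ℝ) (t : ℝ)
    (hx : ∀ᶠ y in 𝓝 x, w y t - β y t ≤ w x t - β x t)
    (ht : ∀ᶠ s in 𝓝[<] t, w x s - β x s ≤ w x t - β x t)
    {βt : ℝ} (hβt : HasDerivAt (fun s => β x s) βt t)
    (g : Fin N → ℝ) (B : Fin N → Fin N → ℝ)
    (hβ : ∀ ξ : Fin N → ℝ, ∃ β1 : ℝ → ℝ, (∀ s, HasDerivAt (fun s => β (x + s • ξ) t) (β1 s) s) ∧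
      β1 0 = ∑ i, g i * ξ i ∧ HasDerivAt β1 (∑ i, ∑ j, B i j * ξ i * ξ j) 0) :
    βt ≤ deriv (fun s => w x s) t ∧ (∀ i, pd i (fun y => w y t) x = g i) ∧
    ∀ A : Fin N → Fin N → ℝ, (∀ i j, A i j = A j i) →
      (∀ ξ : Fin N → ℝ, 0 ≤ ∑ i, ∑ j, A i j * ξ i * ξ j) →
      ∑ i, ∑ j, A i j * pd2 i j (fun y => w y t) x ≤ ∑ i, ∑ j, A i j * B i j := by
  obtain ⟨hc, hd, h2⟩ := hw
  have hline : ∀ ξ : Fin N → ℝ,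
      (∑ i, pd i (fun y => w y t) x * ξ i = ∑ i, g i * ξ i) ∧
      (∑ i, ∑ j, pd2 i j (fun y => w y t) x * ξ i * ξ j ≤ ∑ i, ∑ j, B i j * ξ i * ξ j) := by
    intro ξ
    obtain ⟨β1, hb1, hb0, hb2⟩ := hβ ξ
    have hdiff := (h2 t).differentiable (by norm_num)
    have := second_test (g := fun s : ℝ => w (x + s • ξ) t - β (x + s • ξ) t)
      (g1 := fun s => (∑ i, pd i (fun y => w y t) (x + s • ξ) * ξ i) - β1 s)
      (Eventually.of_forall fun s => (line_deriv1 hdiff x ξ s).sub (hb1 s))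
      ((line_deriv2 (h2 t) x ξ).sub hb2) ?_
    · obtain ⟨e1, e2⟩ := this
      constructor
      · simp at e1; rw [← hb0]; linarith
      · linarith
    · have hcont : Tendsto (fun s : ℝ => x + s • ξ) (𝓝 0) (𝓝 x) := by
        have : Continuous (fun s : ℝ => x + s • ξ) := by fun_prop
        simpa using this.tendsto 0
      have := hcont.eventually hx
      filter_upwards [this] with s hs
      simpa using hs
  refine ⟨?_, ?_, ?_⟩
  · have := left_max_deriv ((hd x t).hasDerivAt.sub hβt) (by simpa using ht)
    linarith
  · intro i
    have := (hline (Pi.single i 1)).1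
    simpa [Pi.single_apply] using this
  · intro A hs hA
    exact trace_le A _ _ hs hA fun ξ => (hline ξ).2

structure Co {N : ℕ} (a : Fin N → Fin N → (Fin N → ℝ) → ℝ → ℝ)
    (b : Fin N → (Fin N → ℝ) → ℝ → ℝ) (c : (Fin N → ℝ) → ℝ → ℝ) (a0 Λ : ℝ) : Prop where
  pos : 0 < a0
  one : 1 ≤ Λ
  sym : ∀ i j x t, a i j x t = a j i x t
  ell : ∀ x t (ξ : Fin N → ℝ), a0 * ∑ i, ξ i ^ 2 ≤ ∑ i, ∑ j, a i j x t * ξ i * ξ j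
  ab : ∀ i j x t, |a i j x t| ≤ Λ
  bb : ∀ i x t, |b i x t| ≤ Λ
  cb : ∀ x t, |c x t| ≤ Λ
  uc : ∀ ε > 0, ∃ δ > 0, ∀ i j x y t, (∀ k, |x k - y k| ≤ δ) → |a i j x t - a i j y t| ≤ ε

lemma Co.psd {N : ℕ} {a : Fin N → Fin N → (Fin N → ℝ) → ℝ → ℝ}
    {b : Fin N → (Fin N → ℝ) → ℝ → ℝ} {c : (Fin N → ℝ) → ℝ → ℝ} {a0 Λ : ℝ}
    (h : Co a b c a0 Λ) (x t) (ξ : Fin N → ℝ) : 0 ≤ ∑ i, ∑ j, a i j x t * ξ i * ξ j :=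
  le_trans (mul_nonneg h.pos.le (Finset.sum_nonneg fun _ _ => sq_nonneg _)) (h.ell x t ξ)

/-- Box. -/
def Bx {N : ℕ} (x0 : Fin N → ℝ) (t0 R : ℝ) (x : Fin N → ℝ) (t : ℝ) : Prop :=
  (∀ i, |x i - x0 i| ≤ R) ∧ |t - t0| ≤ R

lemma qline1 {N : ℕ} (x y ξ : Fin N → ℝ) (s : ℝ) :
    HasDerivAt (fun s : ℝ => ∑ i, ((x + s • ξ) i - y i) ^ 2)
      (∑ i, 2 * ((x + s • ξ) i - y i) * ξ i) s := by
  apply HasDerivAt.fun_sum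
  intro i _
  have h1 : HasDerivAt (fun s : ℝ => (x + s • ξ) i - y i) (ξ i) s := by
    simpa using (((hasDerivAt_id s).mul_const (ξ i)).const_add (x i)).sub_const (y i)
  refine (h1.pow 2).congr_deriv ?_
  push_cast; ring

lemma qline2 {N : ℕ} (x y ξ : Fin N → ℝ) (s : ℝ) :
    HasDerivAt (fun s : ℝ => ∑ i, 2 * ((x + s • ξ) i - y i) * ξ i)
      (∑ i, 2 * ξ i ^ 2) s := by
  apply HasDerivAt.fun_sum
  intro i _
  have h1 : HasDerivAt (fun s : ℝ => (x + s • ξ) i - y i) (ξ i) s := by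
    simpa using (((hasDerivAt_id s).mul_const (ξ i)).const_add (x i)).sub_const (y i)
  refine ((h1.const_mul 2).mul_const (ξ i)).congr_deriv ?_
  ring

lemma parOp_neg {N : ℕ} (a : Fin N → Fin N → (Fin N → ℝ) → ℝ → ℝ)
    (b : Fin N → (Fin N → ℝ) → ℝ → ℝ) (c : (Fin N → ℝ) → ℝ → ℝ)
    (u : (Fin N → ℝ) → ℝ → ℝ) (x : Fin N → ℝ) (t : ℝ) :
    parOp a b c (fun y s => - u y s) x t = - parOp a b c u x t := by
  have h1 : ∀ (v : (Fin N → ℝ) → ℝ) j y, pd j (fun y => - v y) y = - pd j v y := by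
    intro v j y
    unfold pd
    rw [fderiv_fun_neg]; rfl
  have h2 : ∀ i j, pd2 i j (fun y => - u y t) x = - pd2 i j (fun y => u y t) x := by
    intro i j
    unfold pd2
    simp only [h1]
  have h3 : deriv (fun s => - u x s) t = - deriv (fun s => u x s) t := deriv.fun_neg
  unfold parOp
  simp only [h1, h2, h3, mul_neg, Finset.sum_neg_distrib]
  ring

lemma RegSol.neg {N : ℕ} {u : (Fin N → ℝ) → ℝ → ℝ} (h : RegSol u) :
    RegSol (fun y s => - u y s) :=
  ⟨h.1.neg, fun x => (h.2.1 x).neg, fun t => (h.2.2 t).neg⟩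

lemma sum_abs_le {N : ℕ} (p q : Fin N → ℝ) (P Q : ℝ) (hp : ∀ i, |p i| ≤ P) (hq : ∀ i, |q i| ≤ Q) :
    |∑ i, p i * q i| ≤ N * (P * Q) := by
  refine (Finset.abs_sum_le_sum_abs _ _).trans ?_
  calc ∑ i, |p i * q i| ≤ ∑ _i : Fin N, P * Q := by
        refine Finset.sum_le_sum fun i _ => ?_
        rw [abs_mul]
        exact mul_le_mul (hp i) (hq i) (abs_nonneg _) ((abs_nonneg _).trans (hp i))
    _ = N * (P * Q) := by simp

lemma tr_le {N : ℕ} (p : Fin N → ℝ) (P : ℝ) (hp : ∀ i, |p i| ≤ P) :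
    |∑ i, p i| ≤ N * P := by
  have := sum_abs_le p (fun _ => 1) P 1 hp (by simp)
  simpa using this

lemma abs_le_of_sq_sum {N : ℕ} (d : Fin N → ℝ) (r : ℝ) (hr : 0 ≤ r) (h : ∑ i, d i ^ 2 ≤ r ^ 2) (i : Fin N) :
    |d i| ≤ r := by
  apply abs_le_of_sq_le_sq _ hr
  exact (Finset.single_le_sum (f := fun i => d i ^ 2) (fun j _ => sq_nonneg _) (Finset.mem_univ i)).trans h

lemma sum_delta {N : ℕ} (A : Fin N → Fin N → ℝ) (C : ℝ) :
    ∑ i, ∑ j, A i j * (if i = j then C else 0) = C * ∑ i, A i i := by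
  simp [Finset.mul_sum, mul_comm]

lemma sum_delta' {N : ℕ} (ξ : Fin N → ℝ) (C : ℝ) :
    ∑ i, ∑ j, (if i = j then C else 0) * ξ i * ξ j = C * ∑ i, ξ i ^ 2 := by
  simp [Finset.mul_sum, ite_mul]
  refine Finset.sum_congr rfl fun i _ => by ring

set_option maxHeartbeats 1000000 in
/-- Quantitative propagation of smallness of nonnegative supersolutions. -/
lemma propagate {N : ℕ} {a : Fin N → Fin N → (Fin N → ℝ) → ℝ → ℝ}
    {b : Fin N → (Fin N → ℝ) → ℝ → ℝ} {c : (Fin N → ℝ) → ℝ → ℝ} {a0 Λ : ℝ}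
    (h : Co a b c a0 Λ) (r η V T : ℝ) (hr : 0 < r) (hr1 : r ≤ 1) (hη : 0 < η) (hV : 0 ≤ V) :
    ∃ κ > 0, ∀ z, RegSol z → ∀ (x0 x1 : Fin N → ℝ) (t0 t1 : ℝ), (∀ i, |x0 i - x1 i| ≤ V) → 1 ≤ t0 - t1 → t0 - t1 ≤ T →
      (∀ x t, (∀ i, |x i - x0 i| ≤ V + 1) → t1 ≤ t → t ≤ t0 →
        0 ≤ z x t ∧ -κ ≤ parOp a b c z x t) → z x0 t0 < κ →
      ∃ y, (∀ i, |y i - x1 i| ≤ r) ∧ z y t1 < η := by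
  have ha0 := h.pos
  have hΛ := h.one
  set C2 : ℝ := 4 * N * V + 8 * N * Λ + 8 * a0 with hC2
  set lam : ℝ := Λ + C2 ^ 2 / (16 * a0 * r ^ 2) with hlam
  have hlam0 : 0 ≤ lam := by positivity
  have hexpT : 0 < Real.exp (-lam * T) := Real.exp_pos _
  refine ⟨η * Real.exp (-lam * T) * (r ^ 4 * min 1 a0), by positivity, ?_⟩
  set κ := η * Real.exp (-lam * T) * (r ^ 4 * min 1 a0) with hκ
  intro z hz x0 x1 t0 t1 hx01 ht1 htT hzb hz0
  by_contra hcon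
  push Not at hcon
  set v : Fin N → ℝ := fun i => (x0 i - x1 i) / (t0 - t1) with hv
  have hvV : ∀ i, |v i| ≤ V := by
    intro i
    rw [hv]; simp only
    rw [abs_div, abs_of_pos (by linarith : (0:ℝ) < t0 - t1)]
    rw [div_le_iff₀ (by linarith)]
    nlinarith [hx01 i]
  -- moving center
  set Y : ℝ → Fin N → ℝ := fun t i => x1 i + (t - t1) * v i with hY
  have hYbox : ∀ t, t1 ≤ t → t ≤ t0 → ∀ i, |Y t i - x0 i| ≤ V := by
    intro t h1 h2 i
    have e : Y t i - x0 i = (t - t0) * v i := by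
      have hne : t0 - t1 ≠ 0 := by linarith
      simp only [hY, hv]; field_simp; ring
    have e2 : (t - t0) * v i = -((t0 - t) / (t0 - t1) * (x0 i - x1 i)) := by
      simp only [hv]; ring
    rw [e, e2, abs_neg, abs_mul]
    have h3 : |(t0 - t) / (t0 - t1)| ≤ 1 := by
      rw [abs_le]; constructor
      · have : 0 ≤ (t0 - t) / (t0 - t1) := div_nonneg (by linarith) (by linarith)
        linarith
      · rw [div_le_one (by linarith)]; linarith
    calc _ ≤ 1 * V := mul_le_mul h3 (hx01 i) (abs_nonneg _) (by norm_num)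
      _ = V := one_mul V
  set D : Set ((Fin N → ℝ) × ℝ) := {p | t1 ≤ p.2 ∧ p.2 ≤ t0 ∧ ∑ i, (p.1 i - Y p.2 i) ^ 2 ≤ r ^ 2} with hD
  have hDbox : ∀ p ∈ D, ∀ i, |p.1 i - x0 i| ≤ V + 1 := by
    intro p hp i
    have h1 := abs_le_of_sq_sum (fun i => p.1 i - Y p.2 i) r hr.le hp.2.2 i
    have h2 := hYbox p.2 hp.1 hp.2.1 i
    calc |p.1 i - x0 i| = |(p.1 i - Y p.2 i) + (Y p.2 i - x0 i)| := by congr 1; ring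
      _ ≤ _ := abs_add_le _ _
      _ ≤ V + 1 := by linarith
  have hYc : Continuous (fun p : (Fin N → ℝ) × ℝ => ∑ i, (p.1 i - Y p.2 i) ^ 2) := by
    simp only [hY]; fun_prop
  have hDc : IsCompact D := by
    have hcl : IsClosed D := by
      have : D = {p : (Fin N → ℝ) × ℝ | t1 ≤ p.2} ∩ ({p | p.2 ≤ t0} ∩ {p | ∑ i, (p.1 i - Y p.2 i) ^ 2 ≤ r ^ 2}) := by
        ext p; simp [hD]
      rw [this]
      exact (isClosed_le continuous_const continuous_snd).inter
        ((isClosed_le continuous_snd continuous_const).inter (isClosed_le hYc continuous_const))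
    have hsub : D ⊆ Set.Icc (fun i => x0 i - (V + 1)) (fun i => x0 i + (V + 1)) ×ˢ Set.Icc t1 t0 := by
      intro p hp
      have h1 := hDbox p hp
      refine ⟨⟨fun i => ?_, fun i => ?_⟩, hp.1, hp.2.1⟩
      · have := abs_le.1 (h1 i); simp only; linarith
      · have := abs_le.1 (h1 i); simp only; linarith
    exact (isCompact_Icc.prod isCompact_Icc).of_isClosed_subset hcl hsub
  set E : ℝ → ℝ := fun t => Real.exp (-lam * (t - t1)) with hE
  have hEc : Continuous E := by simp only [hE]; fun_prop
  set G : (Fin N → ℝ) × ℝ → ℝ := fun p =>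
    z p.1 p.2 - η * E p.2 * (r ^ 2 - ∑ i, (p.1 i - Y p.2 i) ^ 2) ^ 2 with hG
  have hGc : Continuous G := by
    have := hz.1
    simp only [hG]
    have h2 : Continuous fun p : (Fin N → ℝ) × ℝ => E p.2 := hEc.comp continuous_snd
    fun_prop
  have hmem0 : ((x0, t0) : (Fin N → ℝ) × ℝ) ∈ D := by
    have e : ∀ i, Y t0 i = x0 i := by
      intro i
      have hne : t0 - t1 ≠ 0 := by linarith
      simp only [hY, hv]; field_simp; ring
    refine ⟨by simp only; linarith, le_refl _, ?_⟩
    simp only [e, sub_self]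
    simp
    positivity
  obtain ⟨⟨x, t⟩, hpD, hpm⟩ := hDc.exists_isMinOn ⟨_, hmem0⟩ hGc.continuousOn
  have hG0 : G (x, t) < 0 := by
    have h1 := hpm hmem0
    have h2 : G (x0, t0) < 0 := by
      have e : ∀ i, Y t0 i = x0 i := by
        intro i
        have hne : t0 - t1 ≠ 0 := by linarith
        simp only [hY, hv]; field_simp; ring
      simp only [hG, e, sub_self]
      have : Real.exp (-lam * T) ≤ E t0 := by
        simp only [hE]; apply Real.exp_le_exp.2
        have := mul_le_mul_of_nonneg_left htT hlam0
        linarith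
      have h3 : κ ≤ η * E t0 * r ^ 4 := by
        rw [hκ]
        have : min 1 a0 ≤ 1 := min_le_left _ _
        calc η * Real.exp (-lam * T) * (r ^ 4 * min 1 a0) ≤ η * E t0 * (r ^ 4 * 1) := by gcongr
          _ = _ := by ring
      have e4 : (r ^ 2 - ∑ i : Fin N, (0:ℝ) ^ 2) ^ 2 = r ^ 4 := by simp; ring
      rw [e4]
      linarith
    exact lt_of_le_of_lt h1 h2
  obtain ⟨hD1, hD2, hD3⟩ := hpD
  simp only at hD1 hD2 hD3
  have hbox := hDbox (x, t) ⟨hD1, hD2, hD3⟩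
  obtain ⟨hz1, hz2⟩ := hzb x t hbox hD1 hD2
  set d : Fin N → ℝ := fun i => x i - Y t i with hd
  set q : ℝ := r ^ 2 - ∑ i, d i ^ 2 with hq
  have hGq : G (x, t) = z x t - η * E t * q ^ 2 := rfl
  have hEt : 0 < E t := Real.exp_pos _
  have hq0 : 0 < q := by
    have : 0 ≤ q := by rw [hq]; linarith
    rcases this.lt_or_eq with h1 | h1
    · exact h1
    · rw [hGq, ← h1] at hG0; simp at hG0; linarith
  have htt : t1 < t := by
    rcases hD1.lt_or_eq with h1 | h1
    · exact h1
    · exfalso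
      have eY : ∀ i, Y t i = x1 i := by intro i; simp only [hY, ← h1]; ring
      have h2 := hcon x (fun i => by
        have := abs_le_of_sq_sum d r hr.le hD3 i
        simpa only [hd, eY] using this)
      have eE : E t = 1 := by simp only [hE, ← h1]; simp
      rw [hGq, eE, ← h1] at hG0
      have hq1 : q ≤ 1 := by
        have : 0 ≤ ∑ i, d i ^ 2 := Finset.sum_nonneg fun _ _ => sq_nonneg _
        rw [hq]; nlinarith
      have hq2 : q ^ 2 ≤ 1 := by nlinarith
      have := mul_le_mul_of_nonneg_left hq2 hη.le
      linarith
  -- the test function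
  have hnearq : ∀ᶠ p in 𝓝 ((x, t) : (Fin N → ℝ) × ℝ), ∑ i, (p.1 i - Y p.2 i) ^ 2 < r ^ 2 := by
    apply hYc.continuousAt.eventually_lt continuousAt_const
    simp only; rw [hq] at hq0; simp only [hd] at hq0; linarith
  have hT := max_test hz.neg (β := fun x t => - (η * E t * (r ^ 2 - ∑ i, (x i - Y t i) ^ 2) ^ 2)) x t
    (by
      have h1 : Tendsto (fun y => ((y, t) : (Fin N → ℝ) × ℝ)) (𝓝 x) (𝓝 (x, t)) :=
        (Continuous.prodMk_left t).tendsto x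
      filter_upwards [h1.eventually hnearq] with y hy
      have : G (x, t) ≤ G (y, t) := hpm ⟨hD1, hD2, hy.le⟩
      simp only [hG] at this
      linarith)
    (by
      have h1 : Tendsto (fun s => ((x, s) : (Fin N → ℝ) × ℝ)) (𝓝 t) (𝓝 (x, t)) :=
        (Continuous.prodMk_right x).tendsto t
      filter_upwards [nhdsWithin_le_nhds (h1.eventually hnearq), self_mem_nhdsWithin,
        nhdsWithin_le_nhds (lt_mem_nhds htt)] with s hs hs2 hs3
      have hs2' : s < t := hs2
      have : G (x, t) ≤ G (x, s) := hpm ⟨hs3.le, by simp only; linarith, hs.le⟩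
      simp only [hG] at this
      linarith)
    (βt := - (η * (E t * (-lam)) * q ^ 2 + η * E t * (2 * q * (∑ i, 2 * d i * v i))))
    (by
      have hE' : HasDerivAt E (E t * (-lam)) t := by
        have h1 : HasDerivAt (fun s : ℝ => -lam * (s - t1)) (-lam) t := by
          simpa using ((hasDerivAt_id t).sub_const t1).const_mul (-lam)
        exact h1.exp
      have hS : HasDerivAt (fun s => ∑ i, (x i - Y s i) ^ 2) (∑ i, -(2 * d i * v i)) t := by
        apply HasDerivAt.fun_sum
        intro i _
        have h1 : HasDerivAt (fun s : ℝ => x i - Y s i) (- v i) t := by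
          simp only [hY]
          simpa using ((((hasDerivAt_id t).sub_const t1).mul_const (v i)).const_add (x1 i)).const_sub (x i)
        refine (h1.pow 2).congr_deriv ?_
        simp only [hd]; push_cast; ring
      refine ((hE'.const_mul η).mul ((hS.const_sub (r ^ 2)).pow 2)).neg.congr_deriv ?_
      rw [Finset.sum_neg_distrib]
      simp only [Nat.cast_ofNat, neg_neg, Nat.add_one_sub_one, pow_one, Pi.pow_apply]
      rfl)
    (fun i => 4 * η * E t * q * d i)
    (fun i j => - (8 * η * E t) * (d i * d j) + (if i = j then 4 * η * E t * q else 0))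
    (by
      intro ξ
      have hQ1 := qline1 x (Y t) ξ
      have hQ2 := qline2 x (Y t) ξ
      refine ⟨fun s => 2 * η * E t * ((r ^ 2 - ∑ i, ((x + s • ξ) i - Y t i) ^ 2) *
        (∑ i, 2 * ((x + s • ξ) i - Y t i) * ξ i)), ?_, ?_, ?_⟩
      · intro s
        refine ((((hQ1 s).const_sub (r ^ 2)).pow 2).const_mul (η * E t)).neg.congr_deriv ?_
        push_cast; ring
      · simp only [zero_smul, add_zero]
        change 2 * η * E t * (q * ∑ i, 2 * d i * ξ i) = _
        simp only [Finset.mul_sum]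
        refine Finset.sum_congr rfl fun i _ => by ring
      · refine ((((hQ1 0).const_sub (r ^ 2)).mul (hQ2 0)).const_mul (2 * η * E t)).congr_deriv ?_
        simp only [zero_smul, add_zero]
        change 2 * η * E t * (-(∑ i, 2 * d i * ξ i) * (∑ i, 2 * d i * ξ i) + q * ∑ i, 2 * ξ i ^ 2) = _
        simp only [add_mul, Finset.sum_add_distrib, sum_delta']
        have e1 : ∑ i, ∑ j, -(8 * η * E t) * (d i * d j) * ξ i * ξ j
            = -(8 * η * E t) * ((∑ i, d i * ξ i) * (∑ j, d j * ξ j)) := by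
          rw [Finset.sum_mul_sum]
          simp only [Finset.mul_sum]
          refine Finset.sum_congr rfl fun i _ => Finset.sum_congr rfl fun j _ => by ring
        rw [e1]
        have e2 : ∑ i, 2 * d i * ξ i = 2 * ∑ i, d i * ξ i := by
          rw [Finset.mul_sum]; refine Finset.sum_congr rfl fun i _ => by ring
        have e3 : ∑ i, 2 * ξ i ^ 2 = 2 * ∑ i, ξ i ^ 2 := by rw [Finset.mul_sum]
        rw [e2, e3]; ring)
  obtain ⟨hTt, hTg, hTH⟩ := hT
  have hTH' := hTH (fun i j => a i j x t) (fun i j => h.sym i j x t) (h.psd x t)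
  have hneg := parOp_neg a b c z x t
  unfold parOp at hneg
  simp only [hTg] at hneg
  have hparz : parOp a b c z x t ≥ -κ := hz2
  unfold parOp at hparz
  -- evaluate sums
  have s1 : ∑ i, ∑ j, a i j x t * (-(8 * η * E t) * (d i * d j) + if i = j then 4 * η * E t * q else 0)
      = -(8 * η * E t) * (∑ i, ∑ j, a i j x t * d i * d j) + 4 * η * E t * q * ∑ i, a i i x t := by
    simp only [mul_add, Finset.sum_add_distrib]
    rw [sum_delta (fun i j => a i j x t)]
    congr 1
    simp only [Finset.mul_sum]
    refine Finset.sum_congr rfl fun i _ => Finset.sum_congr rfl fun j _ => by ring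
  rw [s1] at hTH'
  have s2 : ∑ i, b i x t * (4 * η * E t * q * d i) = 4 * η * E t * q * ∑ i, b i x t * d i := by
    rw [Finset.mul_sum]; refine Finset.sum_congr rfl fun i _ => by ring
  rw [s2] at hneg
  have s3 : ∑ i, 2 * d i * v i = 2 * ∑ i, d i * v i := by
    rw [Finset.mul_sum]; refine Finset.sum_congr rfl fun i _ => by ring
  rw [s3] at hTt
  have hd1 : ∀ i, |d i| ≤ 1 := fun i => (abs_le_of_sq_sum d r hr.le hD3 i).trans hr1
  have b1 := abs_le.1 (sum_abs_le d v 1 V hd1 hvV)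
  have b2 := abs_le.1 (sum_abs_le (fun i => b i x t) d Λ 1 (fun i => h.bb i x t) hd1)
  have b3 := abs_le.1 (tr_le (fun i => a i i x t) Λ (fun i => h.ab i i x t))
  have b4 := h.ell x t d
  have b5 := abs_le.1 (h.cb x t)
  have b6 : z x t < η * E t * q ^ 2 := by rw [hGq] at hG0; linarith

  set K := η * E t with hK
  have hKpos : 0 < K := by positivity
  set Sdv := ∑ i, d i * v i
  set Sbd := ∑ i, b i x t * d i
  set Str := ∑ i, a i i x t
  set Sad := ∑ i, ∑ j, a i j x t * d i * d j
  have hSd : ∑ i, d i ^ 2 = r ^ 2 - q := by rw [hq]; ring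
  rw [hSd] at b4
  have c1 : c x t * z x t ≥ - (Λ * (K * q ^ 2)) := by
    have i1 : -(Λ * z x t) ≤ c x t * z x t := by
      have := mul_le_mul_of_nonneg_right b5.1 hz1
      linarith
    have i2 : Λ * z x t ≤ Λ * (K * q ^ 2) := mul_le_mul_of_nonneg_left b6.le (by linarith)
    linarith
  -- main inequality
  have main : K * (lam * q ^ 2 - 4 * q * Sdv + 8 * Sad - 4 * q * Str - 4 * q * Sbd - Λ * q ^ 2) ≤ κ := by
    rw [hK] at c1 ⊢
    linarith
  have m2 : lam * q ^ 2 - 4 * q * Sdv + 8 * Sad - 4 * q * Str - 4 * q * Sbd - Λ * q ^ 2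
      ≥ (lam - Λ) * q ^ 2 - C2 * q + 8 * a0 * r ^ 2 := by
    have i1 : q * Sdv ≤ q * (N * (1 * V)) := mul_le_mul_of_nonneg_left b1.2 hq0.le
    have i2 : q * Sbd ≤ q * (N * (Λ * 1)) := mul_le_mul_of_nonneg_left b2.2 hq0.le
    have i3 : q * Str ≤ q * (N * Λ) := mul_le_mul_of_nonneg_left b3.2 hq0.le
    rw [hC2]
    linarith
  have m3 : (lam - Λ) * q ^ 2 - C2 * q + 8 * a0 * r ^ 2 ≥ 4 * a0 * r ^ 2 := by
    have e : (lam - Λ) * q ^ 2 - C2 * q + 4 * a0 * r ^ 2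
        = (C2 * q - 8 * a0 * r ^ 2) ^ 2 / (16 * a0 * r ^ 2) := by
      rw [hlam]; field_simp; ring
    have : 0 ≤ (C2 * q - 8 * a0 * r ^ 2) ^ 2 / (16 * a0 * r ^ 2) := by positivity
    linarith
  have m4 : K * (4 * a0 * r ^ 2) ≤ κ := by
    refine le_trans ?_ main
    exact mul_le_mul_of_nonneg_left (le_trans m3 m2) hKpos.le
  have m5 : κ ≤ K * (a0 * r ^ 2) := by
    have e1 : Real.exp (-lam * T) ≤ E t := by
      simp only [hE]; apply Real.exp_le_exp.2
      have := mul_le_mul_of_nonneg_left (show t - t1 ≤ T by linarith) hlam0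
      linarith
    have e2 : r ^ 4 * min 1 a0 ≤ a0 * r ^ 2 := by
      have : min 1 a0 ≤ a0 := min_le_right _ _
      have : r ^ 4 ≤ r ^ 2 := pow_le_pow_of_le_one hr.le hr1 (by norm_num)
      calc r ^ 4 * min 1 a0 ≤ r ^ 2 * a0 := by gcongr
        _ = _ := by ring
    rw [hκ, hK]
    gcongr
  have : 0 < K * (a0 * r ^ 2) := by positivity
  linarith

/-- Fourth root. -/
def th (r : ℝ) : ℝ := Real.sqrt (Real.sqrt r)

lemma th_pos {r : ℝ} (hr : 0 < r) : 0 < th r := Real.sqrt_pos.2 (Real.sqrt_pos.2 hr)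

lemma th_nonneg (r : ℝ) : 0 ≤ th r := Real.sqrt_nonneg _

lemma th_pow {r : ℝ} (hr : 0 ≤ r) : th r ^ 4 = r := by
  have h1 : th r ^ 2 = Real.sqrt r := Real.sq_sqrt (Real.sqrt_nonneg _)
  calc th r ^ 4 = (th r ^ 2) ^ 2 := by ring
    _ = r := by rw [h1, Real.sq_sqrt hr]

lemma th_cont : Continuous th := by unfold th; fun_prop

lemma th_mono {r s : ℝ} (h : r ≤ s) : th r ≤ th s := Real.sqrt_le_sqrt (Real.sqrt_le_sqrt h)

lemma th_deriv {r : ℝ} (hr : 0 < r) : HasDerivAt th (1 / (4 * th r ^ 3)) r := by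
  have h1 : HasDerivAt (fun r : ℝ => Real.sqrt r) (1 / (2 * Real.sqrt r)) r :=
    Real.hasDerivAt_sqrt hr.ne'
  have h2 := h1.sqrt (Real.sqrt_pos.2 hr).ne'
  refine h2.congr_deriv ?_
  have h3 : th r ^ 2 = Real.sqrt r := Real.sq_sqrt (Real.sqrt_nonneg _)
  change 1 / (2 * Real.sqrt r) / (2 * th r) = _
  rw [← h3]
  have := th_pos hr
  field_simp
  ring

lemma th_deriv2 {r : ℝ} (hr : 0 < r) :
    HasDerivAt (fun r => 1 / (4 * th r ^ 3)) (-3 / (16 * th r ^ 7)) r := by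
  have hp := th_pos hr
  have h1 := (((th_deriv hr).pow 3).const_mul 4).inv (by simp; positivity)
  have h2 : (fun r => 1 / (4 * th r ^ 3)) = (fun r => 4 * (th ^ 3) r)⁻¹ := by
    ext r; simp
  rw [h2]
  refine h1.congr_deriv ?_
  simp only [Pi.pow_apply]
  field_simp
  ring

lemma th_line {N : ℕ} (x y ξ : Fin N → ℝ) (r : ℝ) (hr : r = ∑ i, (x i - y i) ^ 2) (hr0 : 0 < r) :
    ∃ β1 : ℝ → ℝ,
      (∀ᶠ s in 𝓝 (0:ℝ), HasDerivAt (fun s : ℝ => th (∑ i, ((x + s • ξ) i - y i) ^ 2)) (β1 s) s) ∧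
      β1 0 = 1 / (2 * th r ^ 3) * ∑ i, (x i - y i) * ξ i ∧
      HasDerivAt β1 (-3 / (4 * th r ^ 7) * (∑ i, (x i - y i) * ξ i) ^ 2
        + 1 / (2 * th r ^ 3) * ∑ i, ξ i ^ 2) 0 := by
  have hQ1 := qline1 x y ξ
  have hQ2 := qline2 x y ξ
  have h0 : (∑ i, ((x + (0:ℝ) • ξ) i - y i) ^ 2) = r := by simp [hr]
  have e2 : ∑ i, 2 * (x i - y i) * ξ i = 2 * ∑ i, (x i - y i) * ξ i := by
    rw [Finset.mul_sum]; refine Finset.sum_congr rfl fun i _ => by ring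
  refine ⟨fun s => 1 / (4 * th (∑ i, ((x + s • ξ) i - y i) ^ 2) ^ 3) *
    (∑ i, 2 * ((x + s • ξ) i - y i) * ξ i), ?_, ?_, ?_⟩
  · have : ∀ᶠ s in 𝓝 (0:ℝ), 0 < ∑ i, ((x + s • ξ) i - y i) ^ 2 := by
      have := (hQ1 0).continuousAt
      apply continuousAt_const.eventually_lt this
      rw [h0]; exact hr0
    filter_upwards [this] with s hs
    exact HasDerivAt.comp (h₂ := th) s (th_deriv hs) (hQ1 s)
  · simp only [h0]
    simp only [zero_smul, add_zero, e2]
    have := th_pos hr0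
    field_simp
    norm_num
  · have h1 : HasDerivAt (fun s : ℝ => 1 / (4 * th (∑ i, ((x + s • ξ) i - y i) ^ 2) ^ 3))
        (-3 / (16 * th r ^ 7) * (∑ i, 2 * ((x + (0:ℝ) • ξ) i - y i) * ξ i)) 0 := by
      have := (th_deriv2 hr0)
      rw [← h0] at this
      have h3 := this.comp 0 (hQ1 0)
      rw [h0] at h3
      exact h3
    refine (h1.mul (hQ2 0)).congr_deriv ?_
    rw [h0]
    simp only [zero_smul, add_zero, e2]
    have e3 : ∑ i, 2 * ξ i ^ 2 = 2 * ∑ i, ξ i ^ 2 := by rw [Finset.mul_sum]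
    rw [e3]
    ring

/-- Doubling of variables: first and second order conditions. -/
lemma double_test {N : ℕ} {v : (Fin N → ℝ) → ℝ} (hv : ContDiff ℝ 2 v) (x y x0 : Fin N → ℝ) (L A r : ℝ)
    (hr : r = ∑ i, (x i - y i) ^ 2) (hr0 : 0 < r)
    (hm : ∀ᶠ p in 𝓝 ((x, y) : (Fin N → ℝ) × (Fin N → ℝ)),
      v p.1 - v p.2 - L * th (∑ i, (p.1 i - p.2 i) ^ 2) - A * ∑ i, (p.1 i - x0 i) ^ 2
      ≤ v x - v y - L * th (∑ i, (x i - y i) ^ 2) - A * ∑ i, (x i - x0 i) ^ 2)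
    (ξ ζ : Fin N → ℝ) :
    (∑ i, pd i v x * ξ i - ∑ i, pd i v y * ζ i =
      L * (1 / (2 * th r ^ 3) * ∑ i, (x i - y i) * (ξ i - ζ i)) + 2 * A * ∑ i, (x i - x0 i) * ξ i) ∧
    (∑ i, ∑ j, pd2 i j v x * ξ i * ξ j - ∑ i, ∑ j, pd2 i j v y * ζ i * ζ j ≤
      L * (-3 / (4 * th r ^ 7) * (∑ i, (x i - y i) * (ξ i - ζ i)) ^ 2
        + 1 / (2 * th r ^ 3) * ∑ i, (ξ i - ζ i) ^ 2) + 2 * A * ∑ i, ξ i ^ 2) := by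
  obtain ⟨β1, hb, hb0, hb2⟩ := th_line x y (ξ - ζ) r hr hr0
  have hd := hv.differentiable (by norm_num)
  have hcurve : Tendsto (fun s : ℝ => ((x + s • ξ, y + s • ζ) : (Fin N → ℝ) × (Fin N → ℝ))) (𝓝 0) (𝓝 (x, y)) := by
    have : Continuous (fun s : ℝ => ((x + s • ξ, y + s • ζ) : (Fin N → ℝ) × (Fin N → ℝ))) := by fun_prop
    simpa using this.tendsto 0
  have hrew : ∀ s : ℝ, ∑ i, ((x + s • (ξ - ζ)) i - y i) ^ 2 = ∑ i, ((x + s • ξ) i - (y + s • ζ) i) ^ 2 := by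
    intro s
    refine Finset.sum_congr rfl fun i _ => ?_
    simp; ring
  have := second_test
    (g := fun s : ℝ => v (x + s • ξ) - v (y + s • ζ) - L * th (∑ i, ((x + s • (ξ - ζ)) i - y i) ^ 2)
      - A * ∑ i, ((x + s • ξ) i - x0 i) ^ 2)
    (g1 := fun s => (∑ i, pd i v (x + s • ξ) * ξ i) - (∑ i, pd i v (y + s • ζ) * ζ i) - L * β1 s
      - A * ∑ i, 2 * ((x + s • ξ) i - x0 i) * ξ i)
    (by
      filter_upwards [hb] with s hs
      exact (((line_deriv1 hd x ξ s).sub (line_deriv1 hd y ζ s)).sub (hs.const_mul L)).sub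
        ((qline1 x x0 ξ s).const_mul A))
    ((((line_deriv2 hv x ξ).sub (line_deriv2 hv y ζ)).sub (hb2.const_mul L)).sub
        ((qline2 x x0 ξ 0).const_mul A))
    (by
      filter_upwards [hcurve.eventually hm] with s hs
      simp only [hrew]
      simpa using hs)
  obtain ⟨h1, h2⟩ := this
  have e2 : ∑ i, 2 * (x i - x0 i) * ξ i = 2 * ∑ i, (x i - x0 i) * ξ i := by
    rw [Finset.mul_sum]; refine Finset.sum_congr rfl fun i _ => by ring
  have e3 : ∑ i, 2 * ξ i ^ 2 = 2 * ∑ i, ξ i ^ 2 := by rw [Finset.mul_sum]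
  simp only [zero_smul, add_zero, hb0, e2, Pi.sub_apply] at h1
  simp only [e3, Pi.sub_apply] at h2
  constructor
  · linarith
  · linarith

/-- Pure linear algebra part of the doubling argument. -/
lemma double_trace {N : ℕ} (ax ay Hx Hy : Fin N → Fin N → ℝ) (z : Fin N → ℝ) (a0 Λ δ0 r s L A : ℝ)
    (ha0 : 0 < a0) (hL : 0 ≤ L) (hA : 0 ≤ A) (hr : r = ∑ i, z i ^ 2) (hs : 0 < s) (hsr : s ^ 4 = r)
    (hδ : 0 ≤ δ0) (hδ2 : 3 * N * δ0 ≤ a0 / 2) (hδ3 : δ0 ≤ a0 / 2)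
    (hsx : ∀ i j, ax i j = ax j i) (hsy : ∀ i j, ay i j = ay j i)
    (hell : ∀ ξ : Fin N → ℝ, a0 * ∑ i, ξ i ^ 2 ≤ ∑ i, ∑ j, ax i j * ξ i * ξ j)
    (hax : ∀ i j, |ax i j| ≤ Λ)
    (hxy : ∀ i j, |ax i j - ay i j| ≤ δ0 / (N + 1))
    (hH : ∀ ξ ζ : Fin N → ℝ,
      ∑ i, ∑ j, Hx i j * ξ i * ξ j - ∑ i, ∑ j, Hy i j * ζ i * ζ j ≤
      L * (-3 / (4 * s ^ 7) * (∑ i, z i * (ξ i - ζ i)) ^ 2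
        + 1 / (2 * s ^ 3) * ∑ i, (ξ i - ζ i) ^ 2) + 2 * A * ∑ i, ξ i ^ 2) :
    ∑ i, ∑ j, ax i j * Hx i j - ∑ i, ∑ j, ay i j * Hy i j ≤
      - (a0 / 4) * (L / s ^ 3) + 2 * A * (N * Λ + a0 / 2 + N * δ0) := by
  have hr0 : 0 < r := by rw [← hsr]; positivity
  set κ := a0 / 2 with hκ
  -- (i)
  have h1 := trace_le (fun i j => ax i j - (if i = j then δ0 else 0) - κ / r * (z i * z j))
    (fun i j => Hx i j - Hy i j) (fun i j => if i = j then 2 * A else 0)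
    (fun i j => by
      simp only [hsx i j, eq_comm (a := i), mul_comm (z i)])
    (by
      intro ξ
      have e : ∑ i, ∑ j, (ax i j - (if i = j then δ0 else 0) - κ / r * (z i * z j)) * ξ i * ξ j
          = ∑ i, ∑ j, ax i j * ξ i * ξ j - δ0 * ∑ i, ξ i ^ 2 - κ / r * (∑ i, z i * ξ i) ^ 2 := by
        simp only [sub_mul, Finset.sum_sub_distrib, sum_delta']
        congr 1
        rw [sq, Finset.sum_mul_sum]
        simp only [Finset.mul_sum]
        refine Finset.sum_congr rfl fun i _ => Finset.sum_congr rfl fun j _ => by ring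
      rw [e]
      have cs := Finset.sum_mul_sq_le_sq_mul_sq Finset.univ z ξ
      rw [← hr] at cs
      have : κ / r * (∑ i, z i * ξ i) ^ 2 ≤ κ * ∑ i, ξ i ^ 2 := by
        calc κ / r * (∑ i, z i * ξ i) ^ 2 ≤ κ / r * (r * ∑ i, ξ i ^ 2) := by gcongr
          _ = _ := by field_simp
      have hS : 0 ≤ ∑ i, ξ i ^ 2 := Finset.sum_nonneg fun _ _ => sq_nonneg _
      have := hell ξ
      have := mul_le_mul_of_nonneg_right hδ3 hS
      have e5 : a0 * ∑ i, ξ i ^ 2 = κ * ∑ i, ξ i ^ 2 + κ * ∑ i, ξ i ^ 2 := by rw [hκ]; ring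
      linarith)
    (by
      intro ξ
      have := hH ξ ξ
      rw [sum_delta']
      simp only [sub_mul, Finset.sum_sub_distrib]
      simpa using this)
  rw [sum_delta (fun i j => ax i j - (if i = j then δ0 else 0) - κ / r * (z i * z j))] at h1
  have h1e : ∑ i, ∑ j, (ax i j - (if i = j then δ0 else 0) - κ / r * (z i * z j)) * (Hx i j - Hy i j)
      = ∑ i, ∑ j, ax i j * Hx i j - ∑ i, ∑ j, ax i j * Hy i j - δ0 * ∑ i, Hx i i + δ0 * ∑ i, Hy i i
        - κ / r * (∑ i, ∑ j, Hx i j * z i * z j - ∑ i, ∑ j, Hy i j * z i * z j) := by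
    have e1 : ∑ i, ∑ j, (if i = j then δ0 else 0) * (Hx i j - Hy i j) = δ0 * ∑ i, Hx i i - δ0 * ∑ i, Hy i i := by
      have := sum_delta (fun i j => Hx i j - Hy i j) δ0
      simp only [mul_comm (ite _ _ _)]
      rw [this, Finset.sum_sub_distrib]; ring
    have e2 : ∑ i, ∑ j, κ / r * (z i * z j) * (Hx i j - Hy i j)
        = κ / r * (∑ i, ∑ j, Hx i j * z i * z j - ∑ i, ∑ j, Hy i j * z i * z j) := by
      simp only [← Finset.sum_sub_distrib, Finset.mul_sum]
      refine Finset.sum_congr rfl fun i _ => Finset.sum_congr rfl fun j _ => by ring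
    simp only [sub_mul _ _ (Hx _ _ - Hy _ _), Finset.sum_sub_distrib]
    rw [e1, e2]
    simp only [mul_sub, Finset.sum_sub_distrib]
    ring
  have h1b : ∑ i, (ax i i - (if i = i then δ0 else 0) - κ / r * (z i * z i)) ≤ N * Λ := by
    have : ∀ i ∈ Finset.univ, (ax i i - (if i = i then δ0 else 0) - κ / r * (z i * z i)) ≤ Λ := by
      intro i _
      have i1 := (abs_le.1 (hax i i)).2
      have i2 : 0 ≤ κ / r * (z i * z i) := by have := mul_self_nonneg (z i); positivity
      simp only [if_true]
      linarith
    have := Finset.sum_le_sum this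
    simpa using this
  -- (ii)
  have h2 := hH z (-z)
  have h2' : ∑ i, ∑ j, Hx i j * z i * z j - ∑ i, ∑ j, Hy i j * z i * z j ≤ - L * s + 2 * A * r := by
    have e1 : ∑ i, z i * (z i - (-z) i) = 2 * r := by
      rw [hr, Finset.mul_sum]; refine Finset.sum_congr rfl fun i _ => by simp; ring
    have e2 : ∑ i, (z i - (-z) i) ^ 2 = 4 * r := by
      rw [hr, Finset.mul_sum]; refine Finset.sum_congr rfl fun i _ => by simp; ring
    rw [e1, e2, ← hr] at h2
    have e3 : ∑ i, ∑ j, Hy i j * (-z) i * (-z) j = ∑ i, ∑ j, Hy i j * z i * z j := by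
      refine Finset.sum_congr rfl fun i _ => Finset.sum_congr rfl fun j _ => by simp
    rw [e3] at h2
    refine h2.trans (le_of_eq ?_)
    rw [← hsr]
    field_simp
    ring
  have h2'' : κ / r * (∑ i, ∑ j, Hx i j * z i * z j - ∑ i, ∑ j, Hy i j * z i * z j)
      ≤ - κ * (L / s ^ 3) + 2 * A * κ := by
    calc _ ≤ κ / r * (- L * s + 2 * A * r) := by gcongr
      _ = _ := by rw [← hsr]; field_simp
  -- (iii)
  have h3 : ∑ i, Hx i i ≤ N * (L * (1 / (2 * s ^ 3)) + 2 * A) := by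
    have : ∀ i ∈ Finset.univ, Hx i i ≤ L * (1 / (2 * s ^ 3)) + 2 * A := by
      intro i _
      have := hH (Pi.single i 1) 0
      have e1 : ∑ k, ∑ j, Hx k j * (Pi.single i (1:ℝ) : Fin N → ℝ) k * (Pi.single i (1:ℝ) : Fin N → ℝ) j = Hx i i := by
        simp [Pi.single_apply]
      have e2 : ∑ k, ((Pi.single i (1:ℝ) : Fin N → ℝ) k - (0 : Fin N → ℝ) k) ^ 2 = 1 := by
        simp [Pi.single_apply]
      have e3 : ∑ k, ((Pi.single i (1:ℝ) : Fin N → ℝ) k) ^ 2 = 1 := by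
        simp [Pi.single_apply]
      rw [e1, e2, e3] at this
      have e4 : L * (-3 / (4 * s ^ 7) * (∑ k, z k * ((Pi.single i (1:ℝ) : Fin N → ℝ) k - (0 : Fin N → ℝ) k)) ^ 2) ≤ 0 := by
        apply mul_nonpos_of_nonneg_of_nonpos hL
        apply mul_nonpos_of_nonpos_of_nonneg _ (sq_nonneg _)
        apply div_nonpos_of_nonpos_of_nonneg <;> [norm_num; positivity]
      simp only [Pi.zero_apply, mul_zero, Finset.sum_const_zero, sub_zero] at this e4
      linarith
    have := Finset.sum_le_sum this
    rwa [Finset.sum_const, Finset.card_univ, Fintype.card_fin, nsmul_eq_mul] at this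
  -- (iv)
  have h4 := trace_le (fun i j => ay i j - ax i j + (if i = j then δ0 else 0))
    (fun i j => - Hy i j) (fun i j => if i = j then L * (1 / (2 * s ^ 3)) else 0)
    (fun i j => by
      simp only [hsx i j, hsy i j, eq_comm (a := i)])
    (by
      intro ξ
      simp only [add_mul, Finset.sum_add_distrib, sum_delta']
      have i1 : ∀ i j, -(δ0 / (N + 1)) * (|ξ i| * |ξ j|) ≤ (ay i j - ax i j) * ξ i * ξ j := by
        intro i j
        have : |(ay i j - ax i j) * ξ i * ξ j| ≤ δ0 / (N + 1) * (|ξ i| * |ξ j|) := by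
          rw [mul_assoc, abs_mul, abs_mul (ξ i), abs_sub_comm]
          gcongr
          exact hxy i j
        have := (abs_le.1 this).1
        linarith
      have i2 := Finset.sum_le_sum fun i (_ : i ∈ Finset.univ) =>
        Finset.sum_le_sum fun j (_ : j ∈ Finset.univ) => i1 i j
      simp only [← Finset.mul_sum] at i2
      rw [← Finset.sum_mul] at i2
      have cs := sq_sum_le_card_mul_sum_sq (s := Finset.univ) (f := fun i => |ξ i|)
      simp only [Finset.card_univ, Fintype.card_fin, sq_abs] at cs
      have hS : 0 ≤ ∑ i, ξ i ^ 2 := Finset.sum_nonneg fun _ _ => sq_nonneg _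
      have i3 : δ0 / (N + 1) * ((∑ i, |ξ i|) * ∑ i, |ξ i|) ≤ δ0 * ∑ i, ξ i ^ 2 := by
        calc δ0 / (N + 1) * ((∑ i, |ξ i|) * ∑ i, |ξ i|) = δ0 / (N + 1) * (∑ i, |ξ i|) ^ 2 := by ring
          _ ≤ δ0 / (N + 1) * ((N + 1) * ∑ i, ξ i ^ 2) := by
            gcongr
            linarith
          _ = _ := by field_simp
      linarith)
    (by
      intro ξ
      have := hH 0 ξ
      rw [sum_delta']
      simp only [neg_mul, Finset.sum_neg_distrib]
      have e4 : L * (-3 / (4 * s ^ 7) * (∑ i, z i * ((0 : Fin N → ℝ) i - ξ i)) ^ 2) ≤ 0 := by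
        apply mul_nonpos_of_nonneg_of_nonpos hL
        apply mul_nonpos_of_nonpos_of_nonneg _ (sq_nonneg _)
        apply div_nonpos_of_nonpos_of_nonneg <;> [norm_num; positivity]
      have e5 : ∑ i, ((0 : Fin N → ℝ) i - ξ i) ^ 2 = ∑ i, ξ i ^ 2 := by simp
      have e6 : ∑ i, ((0 : Fin N → ℝ) i) ^ 2 = 0 := by simp
      have e7 : ∑ i, ∑ j, Hx i j * (0 : Fin N → ℝ) i * (0 : Fin N → ℝ) j = 0 := by simp
      rw [e5, e6, e7] at this
      linarith)
  rw [sum_delta (fun i j => ay i j - ax i j + (if i = j then δ0 else 0))] at h4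
  have h4e : ∑ i, ∑ j, (ay i j - ax i j + (if i = j then δ0 else 0)) * (- Hy i j)
      = - ∑ i, ∑ j, ay i j * Hy i j + ∑ i, ∑ j, ax i j * Hy i j - δ0 * ∑ i, Hy i i := by
    have e1 : ∑ i, ∑ j, (if i = j then δ0 else 0) * (- Hy i j) = - (δ0 * ∑ i, Hy i i) := by
      have := sum_delta (fun i j => - Hy i j) δ0
      simp only [mul_comm (ite _ _ _)]
      rw [this, Finset.sum_neg_distrib]; ring
    simp only [add_mul, Finset.sum_add_distrib]
    rw [e1]
    simp only [sub_mul, mul_neg, Finset.sum_sub_distrib, Finset.sum_neg_distrib]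
    ring
  have h4b : ∑ i, (ay i i - ax i i + (if i = i then δ0 else 0)) ≤ N * (2 * δ0) := by
    have : ∀ i ∈ Finset.univ, (ay i i - ax i i + (if i = i then δ0 else 0)) ≤ 2 * δ0 := by
      intro i _
      have i1 := (abs_le.1 (hxy i i)).1
      have i2 : δ0 / (N + 1) ≤ δ0 := div_le_self hδ (by linarith [Nat.cast_nonneg (α := ℝ) N])
      simp only [if_true]
      linarith
    have := Finset.sum_le_sum this
    simpa using this
  rw [h1e] at h1
  rw [h4e] at h4
  have k1 := mul_le_mul_of_nonneg_left h1b (show 0 ≤ 2 * A by positivity)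
  have hLs : 0 ≤ L * (1 / (2 * s ^ 3)) := by positivity
  have k4 := mul_le_mul_of_nonneg_left h4b hLs
  have k3 := mul_le_mul_of_nonneg_left h3 hδ
  have eL : L * (1 / (2 * s ^ 3)) = (L / s ^ 3) / 2 := by field_simp
  rw [eL] at k3 k4 h4 
  have hq0 : 0 ≤ L / s ^ 3 := by positivity
  set Q := L / s ^ 3 with hQ
  have k5 : 3 * N * δ0 * Q ≤ κ * Q := mul_le_mul_of_nonneg_right hδ2 hq0
  have k6 : a0 / 4 * Q = κ * Q / 2 := by rw [hκ]; ring
  linarith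

lemma isCompact_sqball {N : ℕ} (x0 : Fin N → ℝ) (r : ℝ) (hr : 0 ≤ r) :
    IsCompact {x : Fin N → ℝ | ∑ i, (x i - x0 i) ^ 2 ≤ r ^ 2} := by
  have hcl : IsClosed {x : Fin N → ℝ | ∑ i, (x i - x0 i) ^ 2 ≤ r ^ 2} :=
    isClosed_le (by fun_prop) continuous_const
  refine (isCompact_Icc (a := fun i => x0 i - r) (b := fun i => x0 i + r)).of_isClosed_subset hcl ?_
  intro x hx
  have := abs_le_of_sq_sum (fun i => x i - x0 i) r hr hx
  exact ⟨fun i => by have := abs_le.1 (this i); simp only; linarith,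
    fun i => by have := abs_le.1 (this i); simp only; linarith⟩

set_option maxHeartbeats 1000000 in
/-- Interior modulus of continuity in space. -/
lemma space_mod {N : ℕ} {a : Fin N → Fin N → (Fin N → ℝ) → ℝ → ℝ}
    {b : Fin N → (Fin N → ℝ) → ℝ → ℝ} {c : (Fin N → ℝ) → ℝ → ℝ} {a0 Λ : ℝ}
    (h : Co a b c a0 Λ) (M K : ℝ) (hM : 0 ≤ M) (hK : 0 ≤ K) (ε : ℝ) (hε : 0 < ε) :
    ∃ δ > 0, ∀ w, RegSol w → ∀ (x0 : Fin N → ℝ) (t0 : ℝ),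
      (∀ x t, Bx x0 t0 1 x t → |w x t| ≤ M ∧ |parOp a b c w x t| ≤ K) →
      ∀ y, (∀ i, |y i - x0 i| ≤ δ) → w x0 t0 - w y t0 ≤ ε := by
  have ha0 := h.pos
  have hΛ := h.one
  have hN : (0:ℝ) ≤ N := Nat.cast_nonneg N
  set κ := a0 / 2 with hκ
  have hκ0 : 0 < κ := by positivity
  set δ0 := κ / (3 * (N + 1)) with hδ0
  have hδ0p : 0 < δ0 := by positivity
  have hδ2 : 3 * N * δ0 ≤ a0 / 2 := by
    rw [hδ0, ← hκ]
    rw [mul_div_assoc', div_le_iff₀ (by positivity)]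
    nlinarith
  have hδ3 : δ0 ≤ a0 / 2 := by
    rw [hδ0, ← hκ]
    apply div_le_self hκ0.le; linarith
  obtain ⟨ρ1, hρ1, huc⟩ := h.uc (δ0 / (N + 1)) (by positivity)
  set ρ := min ρ1 (min (1 / 4) (κ / (4 * (N + 1) * Λ))) with hρ
  have hρ0 : 0 < ρ := by
    rw [hρ]; refine lt_min hρ1 (lt_min (by norm_num) (by positivity))
  have hρa : ρ ≤ ρ1 := min_le_left _ _
  have hρb : ρ ≤ 1 / 4 := (min_le_right _ _).trans (min_le_left _ _)
  have hρc : N * Λ * ρ ≤ κ / 4 := by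
    have : ρ ≤ κ / (4 * (N + 1) * Λ) := (min_le_right _ _).trans (min_le_right _ _)
    rw [le_div_iff₀ (by positivity)] at this
    nlinarith [mul_pos hρ0 (by linarith : (0:ℝ) < Λ)]
  set A := 4 * (2 * M + 1) with hA
  have hA0 : 0 ≤ A := by positivity
  set C := (2 * M + 1) + 2 * A * (N * Λ + a0 / 2 + N * δ0) + 2 * A * (N * Λ) + 2 * Λ * M + 2 * K with hC
  have hC0 : 0 ≤ C := by positivity
  have hthρ : 0 < th (ρ ^ 2) := th_pos (by positivity)
  set L := (2 * M + 1) / th (ρ ^ 2) + 4 * (C + 1) / κ with hL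
  have hL0 : 0 < L := by positivity
  have hL1 : 2 * M < L * th (ρ ^ 2) := by
    have e : (2 * M + 1) / th (ρ ^ 2) * th (ρ ^ 2) = 2 * M + 1 := by field_simp
    have : 0 ≤ 4 * (C + 1) / κ * th (ρ ^ 2) := by positivity
    rw [hL, add_mul]; linarith
  have hL2 : C < κ / 4 * L := by
    have e : κ / 4 * (4 * (C + 1) / κ) = C + 1 := by field_simp
    have : 0 ≤ κ / 4 * ((2 * M + 1) / th (ρ ^ 2)) := by positivity
    rw [hL, mul_add]; linarith
  set μ := min ρ ((ε / L) ^ 2) with hμ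
  have hμ0 : 0 < μ := by rw [hμ]; exact lt_min hρ0 (by positivity)
  refine ⟨μ / (N + 1), by positivity, ?_⟩
  intro w hw x0 t0 hb y hy
  have hsum : ∑ i, (x0 i - y i) ^ 2 ≤ μ ^ 2 := by
    calc ∑ i, (x0 i - y i) ^ 2 ≤ ∑ _i : Fin N, (μ / (N + 1)) ^ 2 := by
          refine Finset.sum_le_sum fun i _ => ?_
          rw [← sq_abs, abs_sub_comm]
          exact pow_le_pow_left₀ (abs_nonneg _) (hy i) 2
      _ = N * (μ / (N + 1)) ^ 2 := by simp
      _ ≤ μ ^ 2 := by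
        rw [div_pow, mul_div_assoc', div_le_iff₀ (by positivity)]
        have hNN : (N:ℝ) ≤ (N+1)^2 := by nlinarith
        nlinarith [mul_le_mul_of_nonneg_left hNN (sq_nonneg μ)]
  -- domain
  set D : Set (((Fin N → ℝ) × (Fin N → ℝ)) × ℝ) :=
    {p | ∑ i, (p.1.1 i - x0 i) ^ 2 ≤ (1/2) ^ 2 ∧ ∑ i, (p.1.1 i - p.1.2 i) ^ 2 ≤ ρ ^ 2 ∧ t0 - 1 ≤ p.2 ∧ p.2 ≤ t0} with hD
  have hDx : ∀ p ∈ D, ∀ i, |p.1.1 i - x0 i| ≤ 1 / 2 := fun p hp =>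
    abs_le_of_sq_sum (fun i => p.1.1 i - x0 i) _ (by norm_num) hp.1
  have hDz : ∀ p ∈ D, ∀ i, |p.1.1 i - p.1.2 i| ≤ ρ := fun p hp =>
    abs_le_of_sq_sum (fun i => p.1.1 i - p.1.2 i) _ hρ0.le hp.2.1
  have hDy : ∀ p ∈ D, ∀ i, |p.1.2 i - x0 i| ≤ 1 := by
    intro p hp i
    have h1 := abs_le.1 (hDx p hp i)
    have h2 := abs_le.1 (hDz p hp i)
    rw [abs_le]; constructor <;> linarith
  have hDc : IsCompact D := by
    have hcl : IsClosed D := by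
      have c1 : Continuous (fun p : ((Fin N → ℝ) × (Fin N → ℝ)) × ℝ => ∑ i, (p.1.1 i - x0 i) ^ 2) := by fun_prop
      have c2 : Continuous (fun p : ((Fin N → ℝ) × (Fin N → ℝ)) × ℝ => ∑ i, (p.1.1 i - p.1.2 i) ^ 2) := by fun_prop
      exact (isClosed_le c1 continuous_const).inter ((isClosed_le c2 continuous_const).inter
        ((isClosed_le continuous_const continuous_snd).inter (isClosed_le continuous_snd continuous_const)))
    refine ((isCompact_Icc (a := fun i => x0 i - 1) (b := fun i => x0 i + 1)).prod
      (isCompact_Icc (a := fun i => x0 i - 1) (b := fun i => x0 i + 1)) |>.prod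
      (isCompact_Icc (a := t0 - 1) (b := t0))).of_isClosed_subset hcl ?_
    intro p hp
    refine ⟨⟨⟨fun i => ?_, fun i => ?_⟩, ⟨fun i => ?_, fun i => ?_⟩⟩, hp.2.2⟩
    · have := abs_le.1 (hDx p hp i); simp only; linarith
    · have := abs_le.1 (hDx p hp i); simp only; linarith
    · have := abs_le.1 (hDy p hp i); simp only; linarith
    · have := abs_le.1 (hDy p hp i); simp only; linarith
  set Φ : ((Fin N → ℝ) × (Fin N → ℝ)) × ℝ → ℝ := fun p =>
    w p.1.1 p.2 - w p.1.2 p.2 - L * th (∑ i, (p.1.1 i - p.1.2 i) ^ 2) - A * ∑ i, (p.1.1 i - x0 i) ^ 2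
      - (2 * M + 1) * (t0 - p.2) with hΦ
  have hΦc : Continuous Φ := by
    have h1 : Continuous (fun p : ((Fin N → ℝ) × (Fin N → ℝ)) × ℝ => w p.1.1 p.2) :=
      hw.1.comp (f := fun p : ((Fin N → ℝ) × (Fin N → ℝ)) × ℝ => (p.1.1, p.2)) (by fun_prop)
    have h2 : Continuous (fun p : ((Fin N → ℝ) × (Fin N → ℝ)) × ℝ => w p.1.2 p.2) :=
      hw.1.comp (f := fun p : ((Fin N → ℝ) × (Fin N → ℝ)) × ℝ => (p.1.2, p.2)) (by fun_prop)
    have h3 : Continuous (fun p : ((Fin N → ℝ) × (Fin N → ℝ)) × ℝ => th (∑ i, (p.1.1 i - p.1.2 i) ^ 2)) :=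
      th_cont.comp (by fun_prop)
    exact (((h1.sub h2).sub (continuous_const.mul h3)).sub (continuous_const.mul (by fun_prop))).sub (by fun_prop)
  have hmem0 : (((x0, y), t0) : ((Fin N → ℝ) × (Fin N → ℝ)) × ℝ) ∈ D := by
    refine ⟨by simp, hsum.trans ?_, by simp, le_refl _⟩
    exact pow_le_pow_left₀ hμ0.le (min_le_left _ _) 2
  obtain ⟨⟨⟨x, y'⟩, t⟩, hpD, hpm⟩ := hDc.exists_isMaxOn ⟨_, hmem0⟩ hΦc.continuousOn
  have hfin : Φ ((x, y'), t) ≤ 0 := by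
    by_contra hpos
    push Not at hpos
    have hx := hDx _ hpD
    have hz := hDz _ hpD
    have hy' := hDy _ hpD
    obtain ⟨hD1, hD2, hD3, hD4⟩ := hpD
    simp only at hx hz hy' hD1 hD2 hD3 hD4
    have htabs : |t - t0| ≤ 1 := by rw [abs_le]; constructor <;> linarith
    obtain ⟨hwx, hPx⟩ := hb x t ⟨fun i => (hx i).trans (by norm_num), htabs⟩
    obtain ⟨hwy, hPy⟩ := hb y' t ⟨hy', htabs⟩
    have hwx' := abs_le.1 hwx
    have hwy' := abs_le.1 hwy
    set r := ∑ i, (x i - y' i) ^ 2 with hr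
    set X := ∑ i, (x i - x0 i) ^ 2 with hX
    have hΦe : Φ ((x, y'), t) = w x t - w y' t - L * th r - A * X - (2 * M + 1) * (t0 - t) := rfl
    rw [hΦe] at hpos
    have hX0 : 0 ≤ X := Finset.sum_nonneg fun _ _ => sq_nonneg _
    have hr00 : 0 ≤ r := Finset.sum_nonneg fun _ _ => sq_nonneg _
    have q1 : 0 ≤ L * th r := mul_nonneg hL0.le (th_nonneg _)
    have q2 : 0 ≤ A * X := by positivity
    have q3 : 0 ≤ (2 * M + 1) * (t0 - t) := mul_nonneg (by linarith) (by linarith)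
    -- interior
    have hr0 : 0 < r := by
      rcases hr00.lt_or_eq with h1 | h1
      · exact h1
      · exfalso
        have : ∀ i ∈ Finset.univ, (x i - y' i) ^ 2 = 0 :=
          (Finset.sum_eq_zero_iff_of_nonneg fun i _ => sq_nonneg _).1 h1.symm
        have e : x = y' := by
          ext i
          have := pow_eq_zero_iff (two_ne_zero) |>.1 (this i (Finset.mem_univ i))
          linarith
        rw [e] at hpos
        linarith
    have hi1 : X < (1/2) ^ 2 := by
      rcases hD1.lt_or_eq with h1 | h1
      · exact h1
      · exfalso
        rw [h1, hA] at hpos; rw [h1, hA] at q2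
        linarith
    have hi2 : r < ρ ^ 2 := by
      rcases hD2.lt_or_eq with h1 | h1
      · exact h1
      · exfalso
        rw [h1] at hpos
        linarith
    have hi3 : t0 - 1 < t := by
      rcases hD3.lt_or_eq with h1 | h1
      · exact h1
      · exfalso
        rw [← h1] at hpos q3
        rw [← h1] at hwx' hwy'
        linarith
    -- local max
    have hm : ∀ᶠ p in 𝓝 ((x, y') : (Fin N → ℝ) × (Fin N → ℝ)),
      w p.1 t - w p.2 t - L * th (∑ i, (p.1 i - p.2 i) ^ 2) - A * ∑ i, (p.1 i - x0 i) ^ 2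
      ≤ w x t - w y' t - L * th (∑ i, (x i - y' i) ^ 2) - A * ∑ i, (x i - x0 i) ^ 2 := by
      have c1 : Continuous (fun p : (Fin N → ℝ) × (Fin N → ℝ) => ∑ i, (p.1 i - x0 i) ^ 2) := by fun_prop
      have c2 : Continuous (fun p : (Fin N → ℝ) × (Fin N → ℝ) => ∑ i, (p.1 i - p.2 i) ^ 2) := by fun_prop
      filter_upwards [c1.continuousAt.eventually_lt continuousAt_const hi1,
        c2.continuousAt.eventually_lt continuousAt_const hi2] with p h1 h2
      have : Φ (p, t) ≤ Φ ((x, y'), t) := hpm ⟨h1.le, h2.le, hD3, hD4⟩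
      simp only [hΦ] at this
      linarith
    have hdt := double_test (hw.2.2 t) x y' x0 L A r hr hr0 hm
    have hs := th_pos hr0
    set s := th r with hsdef
    have hs4 : s ^ 4 = r := th_pow hr0.le
    have hgx : ∀ i, pd i (fun y => w y t) x = L * (1 / (2 * s ^ 3)) * (x i - y' i) + 2 * A * (x i - x0 i) := by
      intro i
      have := (hdt (Pi.single i 1) 0).1
      simp only [Pi.single_apply, Pi.zero_apply, mul_zero, Finset.sum_const_zero, sub_zero, mul_ite, mul_one,
        Finset.sum_ite_eq', Finset.mem_univ, if_true] at this
      rw [this]; ring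
    have hgy : ∀ i, pd i (fun y => w y t) y' = L * (1 / (2 * s ^ 3)) * (x i - y' i) := by
      intro i
      have := (hdt 0 (Pi.single i 1)).1
      simp only [Pi.single_apply, Pi.zero_apply, mul_zero, Finset.sum_const_zero, zero_sub, mul_neg, mul_ite, mul_one,
        Finset.sum_ite_eq', Finset.mem_univ, if_true, Finset.sum_neg_distrib, add_zero] at this
      linarith
    have htr := double_trace (fun i j => a i j x t) (fun i j => a i j y' t)
      (fun i j => pd2 i j (fun y => w y t) x) (fun i j => pd2 i j (fun y => w y t) y')
      (fun i => x i - y' i) a0 Λ δ0 r s L A ha0 hL0.le hA0 hr hs hs4 hδ0p.le hδ2 hδ3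
      (fun i j => h.sym i j x t) (fun i j => h.sym i j y' t) (h.ell x t) (fun i j => h.ab i j x t)
      (fun i j => huc i j x y' t fun k => (hz k).trans hρa)
      (fun ξ ζ => (hdt ξ ζ).2)
    -- time derivative
    have htd : 0 ≤ deriv (fun s => w x s) t - deriv (fun s => w y' s) t + (2 * M + 1) := by
      have hder : HasDerivAt (fun s => w x s - w y' s - (2 * M + 1) * (t0 - s))
          (deriv (fun s => w x s) t - deriv (fun s => w y' s) t + (2 * M + 1)) t := by
        have h1 := (hw.2.1 x t).hasDerivAt
        have h2 := (hw.2.1 y' t).hasDerivAt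
        have h3 : HasDerivAt (fun s : ℝ => (2 * M + 1) * (t0 - s)) (-(2 * M + 1)) t := by
          simpa using ((hasDerivAt_id t).const_sub t0).const_mul (2 * M + 1)
        refine ((h1.sub h2).sub h3).congr_deriv ?_
        ring
      apply left_max_deriv hder
      filter_upwards [nhdsWithin_le_nhds (lt_mem_nhds hi3), self_mem_nhdsWithin] with τ h1 h2
      have h2' : τ < t := h2
      have : Φ ((x, y'), τ) ≤ Φ ((x, y'), t) := hpm ⟨hD1, hD2, h1.le, by simp only; linarith⟩
      simp only [hΦ] at this
      linarith
    have hPx' := abs_le.1 hPx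
    have hPy' := abs_le.1 hPy
    unfold parOp at hPx' hPy'
    simp only [hgx] at hPx'
    simp only [hgy] at hPy'
    have hbx : ∑ i, b i x t * (L * (1 / (2 * s ^ 3)) * (x i - y' i) + 2 * A * (x i - x0 i))
        = L * (1 / (2 * s ^ 3)) * (∑ i, b i x t * (x i - y' i)) + 2 * A * ∑ i, b i x t * (x i - x0 i) := by
      simp only [Finset.mul_sum, ← Finset.sum_add_distrib]
      refine Finset.sum_congr rfl fun i _ => by ring
    have hby : ∑ i, b i y' t * (L * (1 / (2 * s ^ 3)) * (x i - y' i))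
        = L * (1 / (2 * s ^ 3)) * (∑ i, b i y' t * (x i - y' i)) := by
      simp only [Finset.mul_sum]
      refine Finset.sum_congr rfl fun i _ => by ring
    rw [hbx] at hPx'
    rw [hby] at hPy'
    have eL : L * (1 / (2 * s ^ 3)) = (L / s ^ 3) / 2 := by field_simp
    rw [eL] at hPx' hPy'
    have hQ0 : 0 ≤ L / s ^ 3 := by positivity
    have hs1 : s ^ 3 ≤ 1 := by
      have h1 : r ≤ 1 := hi2.le.trans (pow_le_one₀ hρ0.le (by linarith))
      have h2 : s ≤ 1 := by
        by_contra h3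
        push Not at h3
        have : 1 < s ^ 4 := one_lt_pow₀ h3 (by norm_num)
        linarith
      exact pow_le_one₀ hs.le h2
    have hQL : L ≤ L / s ^ 3 := by
      rw [le_div_iff₀ (by positivity)]; exact mul_le_of_le_one_right hL0.le hs1
    set Q := L / s ^ 3 with hQ
    have B1 := (abs_le.1 (sum_abs_le (fun i => b i x t) (fun i => x i - y' i) Λ ρ (fun i => h.bb i x t) hz)).2
    have B2 := (abs_le.1 (sum_abs_le (fun i => b i y' t) (fun i => x i - y' i) Λ ρ (fun i => h.bb i y' t) hz)).1
    have B3 := (abs_le.1 (sum_abs_le (fun i => b i x t) (fun i => x i - x0 i) Λ 1 (fun i => h.bb i x t)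
      (fun i => (hx i).trans (by norm_num)))).2
    have B4 : |c x t * w x t| ≤ Λ * M := by
      rw [abs_mul]; exact mul_le_mul (h.cb x t) hwx (abs_nonneg _) (by linarith)
    have B5 : |c y' t * w y' t| ≤ Λ * M := by
      rw [abs_mul]; exact mul_le_mul (h.cb y' t) hwy (abs_nonneg _) (by linarith)
    have B4' := (abs_le.1 B4).2
    have B5' := (abs_le.1 B5).1
    beta_reduce at B1 B2 B3 htr
    have B1' := mul_le_mul_of_nonneg_left B1 (show 0 ≤ Q / 2 by positivity)
    have B2' := mul_le_mul_of_nonneg_left B2 (show 0 ≤ Q / 2 by positivity)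
    have B3' := mul_le_mul_of_nonneg_left B3 (show 0 ≤ 2 * A by positivity)
    have B6 : N * (Λ * ρ) * Q ≤ κ / 4 * Q := by
      apply mul_le_mul_of_nonneg_right _ hQ0
      linarith
    have B7 : κ / 4 * L ≤ κ / 4 * Q := mul_le_mul_of_nonneg_left hQL (by positivity)
    have B8 : a0 / 4 * Q = κ / 2 * Q := by rw [hκ]; ring
    rw [hC] at hL2
    linarith
  have h1 : Φ ((x0, y), t0) ≤ Φ ((x, y'), t) := hpm hmem0
  have h2 : w x0 t0 - w y t0 ≤ L * th (∑ i, (x0 i - y i) ^ 2) := by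
    have : Φ ((x0, y), t0) = w x0 t0 - w y t0 - L * th (∑ i, (x0 i - y i) ^ 2) := by
      simp [hΦ]
    linarith
  have h3 : th (∑ i, (x0 i - y i) ^ 2) ≤ ε / L := by
    refine (th_mono (hsum.trans (pow_le_pow_left₀ hμ0.le (min_le_right _ _) 2))).trans (le_of_eq ?_)
    unfold th
    rw [Real.sqrt_sq (by positivity), Real.sqrt_sq (by positivity)]
  calc _ ≤ _ := h2
    _ ≤ L * (ε / L) := by gcongr
    _ = ε := by field_simp

lemma RegSol.bound_neg {N : ℕ} {a : Fin N → Fin N → (Fin N → ℝ) → ℝ → ℝ}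
    {b : Fin N → (Fin N → ℝ) → ℝ → ℝ} {c : (Fin N → ℝ) → ℝ → ℝ} {w : (Fin N → ℝ) → ℝ → ℝ} {M K : ℝ}
    {x : Fin N → ℝ} {t : ℝ} (h : |w x t| ≤ M ∧ |parOp a b c w x t| ≤ K) :
    |(fun y s => - w y s) x t| ≤ M ∧ |parOp a b c (fun y s => - w y s) x t| ≤ K := by
  rw [parOp_neg, abs_neg]; simpa using h

set_option maxHeartbeats 1000000 in
lemma time_up {N : ℕ} {a : Fin N → Fin N → (Fin N → ℝ) → ℝ → ℝ}
    {b : Fin N → (Fin N → ℝ) → ℝ → ℝ} {c : (Fin N → ℝ) → ℝ → ℝ} {a0 Λ : ℝ}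
    (h : Co a b c a0 Λ) (M K : ℝ) (hM : 0 ≤ M) (hK : 0 ≤ K) (ε : ℝ) (hε : 0 < ε) :
    ∃ D > 0, ∀ w, RegSol w → ∀ (x0 : Fin N → ℝ) (t0 : ℝ),
      (∀ x t, Bx x0 t0 1 x t → |w x t| ≤ M ∧ |parOp a b c w x t| ≤ K) →
      ∀ t', t0 ≤ t' → t' ≤ t0 + 1 → w x0 t' ≤ w x0 t0 + ε + D * (t' - t0) := by
  have hΛ := h.one
  have hN : (0:ℝ) ≤ N := Nat.cast_nonneg N
  obtain ⟨δ, hδ, hsp⟩ := space_mod h M K hM hK ε hε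
  set C5 := 2 * M / δ ^ 2 + 2 * M with hC5
  have hC50 : 0 ≤ C5 := by positivity
  set D := 4 * C5 * (N * Λ) + Λ * M + K + 1 with hD
  refine ⟨D, by positivity, ?_⟩
  intro w hw x0 t0 hb t' ht' ht'1
  by_contra hcon
  push Not at hcon
  set S : Set ((Fin N → ℝ) × ℝ) := {x : Fin N → ℝ | ∑ i, (x i - x0 i) ^ 2 ≤ 1 ^ 2} ×ˢ Set.Icc t0 t' with hS
  have hSc : IsCompact S := (isCompact_sqball x0 1 (by norm_num)).prod isCompact_Icc
  set G : (Fin N → ℝ) × ℝ → ℝ := fun p =>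
    w p.1 p.2 - (w x0 t0 + ε + C5 * ∑ i, (p.1 i - x0 i) ^ 2 + D * (p.2 - t0)) with hG
  have hGc : Continuous G := by
    exact hw.1.sub (by fun_prop)
  have hmem0 : ((x0, t') : (Fin N → ℝ) × ℝ) ∈ S := ⟨by simp, ht', le_refl _⟩
  obtain ⟨⟨x, t⟩, hpD, hpm⟩ := hSc.exists_isMaxOn ⟨_, hmem0⟩ hGc.continuousOn
  have hG0 : 0 < G (x, t) := by
    refine lt_of_lt_of_le ?_ (hpm hmem0)
    simp only [hG]; simp; linarith
  obtain ⟨hx, ht1, ht2⟩ := hpD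
  simp only at ht1 ht2
  simp only [Set.mem_setOf_eq] at hx
  have hx1 := abs_le_of_sq_sum (fun i => x i - x0 i) 1 (by norm_num) hx
  obtain ⟨hwx, hPx⟩ := hb x t ⟨hx1, by rw [abs_le]; constructor <;> linarith⟩
  have hw0 := (hb x0 t0 ⟨by simp, by simp⟩).1
  have hwx' := abs_le.1 hwx
  have hw0' := abs_le.1 hw0
  simp only [hG] at hG0
  have hX0 : 0 ≤ ∑ i, (x i - x0 i) ^ 2 := Finset.sum_nonneg fun _ _ => sq_nonneg _
  have hDt : 0 ≤ D * (t - t0) := mul_nonneg (by positivity) (by linarith)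
  have hi1 : ∑ i, (x i - x0 i) ^ 2 < 1 ^ 2 := by
    rcases hx.lt_or_eq with h1 | h1
    · exact h1
    · exfalso
      rw [h1] at hG0
      have : 0 ≤ 2 * M / δ ^ 2 := by positivity
      linarith
  have hi2 : t0 < t := by
    rcases ht1.lt_or_eq with h1 | h1
    · exact h1
    · exfalso
      by_cases hcl : ∀ i, |x i - x0 i| ≤ δ
      · have := hsp _ hw.neg x0 t0 (fun y s hy => RegSol.bound_neg (hb y s hy)) x hcl
        rw [← h1] at hG0
        have : 0 ≤ C5 * ∑ i, (x i - x0 i) ^ 2 := by positivity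
        linarith
      · push Not at hcl
        obtain ⟨i, hi⟩ := hcl
        have h2 : δ ^ 2 ≤ ∑ i, (x i - x0 i) ^ 2 := by
          calc δ ^ 2 ≤ |x i - x0 i| ^ 2 := pow_le_pow_left₀ hδ.le hi.le 2
            _ = (x i - x0 i) ^ 2 := sq_abs _
            _ ≤ _ := Finset.single_le_sum (f := fun i => (x i - x0 i) ^ 2) (fun j _ => sq_nonneg _) (Finset.mem_univ i)
        have h3 : 2 * M ≤ C5 * δ ^ 2 := by
          have : 2 * M / δ ^ 2 * δ ^ 2 = 2 * M := by field_simp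
          have : 0 ≤ 2 * M * δ ^ 2 := by positivity
          rw [hC5]; linarith
        have h4 := mul_le_mul_of_nonneg_left h2 hC50
        linarith
  have hT := max_test hw (β := fun y s => w x0 t0 + ε + C5 * ∑ i, (y i - x0 i) ^ 2 + D * (s - t0)) x t
    (by
      have c1 : Continuous (fun p : (Fin N → ℝ) => ∑ i, (p i - x0 i) ^ 2) := by fun_prop
      filter_upwards [c1.continuousAt.eventually_lt continuousAt_const hi1] with y hy
      exact hpm (a := (y, t)) ⟨hy.le, ht1, ht2⟩)
    (by
      filter_upwards [self_mem_nhdsWithin, nhdsWithin_le_nhds (lt_mem_nhds hi2)] with s hs2 hs3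
      have hs2' : s < t := hs2
      exact hpm (a := (x, s)) ⟨hx, hs3.le, by simp only; linarith⟩)
    (βt := D)
    (by simpa using (((hasDerivAt_id t).sub_const t0).const_mul D).const_add (w x0 t0 + ε + C5 * ∑ i, (x i - x0 i) ^ 2))
    (fun i => 2 * C5 * (x i - x0 i))
    (fun i j => (if i = j then 2 * C5 else 0))
    (by
      intro ξ
      have hQ1 := qline1 x x0 ξ
      have hQ2 := qline2 x x0 ξ
      refine ⟨fun s => C5 * (∑ i, 2 * ((x + s • ξ) i - x0 i) * ξ i), ?_, ?_, ?_⟩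
      · intro s
        exact (((hQ1 s).const_mul C5).const_add _).add_const _
      · simp only [zero_smul, add_zero, Finset.mul_sum]
        refine Finset.sum_congr rfl fun i _ => by ring
      · refine ((hQ2 0).const_mul C5).congr_deriv ?_
        rw [sum_delta', Finset.mul_sum, Finset.mul_sum]
        refine Finset.sum_congr rfl fun i _ => by ring)
  obtain ⟨hTt, hTg, hTH⟩ := hT
  have hTH' := hTH (fun i j => a i j x t) (fun i j => h.sym i j x t) (h.psd x t)
  rw [sum_delta (fun i j => a i j x t)] at hTH'
  have hP := (abs_le.1 hPx).2
  unfold parOp at hP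
  simp only [hTg] at hP
  have s2 : ∑ i, b i x t * (2 * C5 * (x i - x0 i)) = 2 * C5 * ∑ i, b i x t * (x i - x0 i) := by
    rw [Finset.mul_sum]; refine Finset.sum_congr rfl fun i _ => by ring
  rw [s2] at hP
  have b2 := (abs_le.1 (sum_abs_le (fun i => b i x t) (fun i => x i - x0 i) Λ 1 (fun i => h.bb i x t) hx1)).2
  have b3 := (abs_le.1 (tr_le (fun i => a i i x t) Λ (fun i => h.ab i i x t))).2
  have b4 : |c x t * w x t| ≤ Λ * M := by
    rw [abs_mul]; exact mul_le_mul (h.cb x t) hwx (abs_nonneg _) (by linarith)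
  have b4' := (abs_le.1 b4).2
  have b2' := mul_le_mul_of_nonneg_left b2 (show 0 ≤ 2 * C5 by positivity)
  have b3' := mul_le_mul_of_nonneg_left b3 (show 0 ≤ 2 * C5 by positivity)
  rw [hD] at hTt
  linarith

/-- Interior equicontinuity. -/
lemma equicont {N : ℕ} {a : Fin N → Fin N → (Fin N → ℝ) → ℝ → ℝ}
    {b : Fin N → (Fin N → ℝ) → ℝ → ℝ} {c : (Fin N → ℝ) → ℝ → ℝ} {a0 Λ : ℝ}
    (h : Co a b c a0 Λ) (M K : ℝ) (hM : 0 ≤ M) (hK : 0 ≤ K) (ε : ℝ) (hε : 0 < ε) :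
    ∃ δ > 0, δ ≤ 1 ∧ ∀ w, RegSol w → ∀ (x0 : Fin N → ℝ) (t0 : ℝ),
      (∀ x t, Bx x0 t0 3 x t → |w x t| ≤ M ∧ |parOp a b c w x t| ≤ K) →
      ∀ x t, Bx x0 t0 δ x t → |w x t - w x0 t0| ≤ ε := by
  obtain ⟨δ, hδ, hsp⟩ := space_mod h M K hM hK (ε / 2) (by positivity)
  obtain ⟨D, hD, htm⟩ := time_up h M K hM hK (ε / 4) (by positivity)
  refine ⟨min 1 (min δ (ε / (4 * D))), by positivity, min_le_left _ _, ?_⟩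
  have key : ∀ w, RegSol w → ∀ (x0 : Fin N → ℝ) (t0 : ℝ),
      (∀ x t, Bx x0 t0 3 x t → |w x t| ≤ M ∧ |parOp a b c w x t| ≤ K) →
      ∀ x t, Bx x0 t0 (min 1 (min δ (ε / (4 * D)))) x t → w x t - w x0 t0 ≤ ε := by
    intro w hw x0 t0 hb x t ⟨hx, ht⟩
    have hx1 : ∀ i, |x i - x0 i| ≤ 1 := fun i => (hx i).trans (min_le_left _ _)
    have hx2 : ∀ i, |x i - x0 i| ≤ δ := fun i => (hx i).trans ((min_le_right _ _).trans (min_le_left _ _))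
    have ht1 : |t - t0| ≤ 1 := ht.trans (min_le_left _ _)
    have ht2 : |t - t0| ≤ ε / (4 * D) := ht.trans ((min_le_right _ _).trans (min_le_right _ _))
    have hDD : D * (ε / (4 * D)) = ε / 4 := by field_simp
    have hsub : ∀ s, |s - t0| ≤ 1 → ∀ y τ, Bx x s 1 y τ → Bx x0 t0 3 y τ := by
      intro s hs y τ ⟨h1, h2⟩
      refine ⟨fun i => ?_, ?_⟩
      · have := abs_le.1 (h1 i); have := abs_le.1 (hx1 i); rw [abs_le]; constructor <;> linarith
      · have := abs_le.1 hs; have := abs_le.1 h2; rw [abs_le]; constructor <;> linarith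
    have hs1 : w x t0 - w x0 t0 ≤ ε / 2 := by
      have := hsp _ hw.neg x0 t0 (fun y s hy => RegSol.bound_neg (hb y s
        ⟨fun i => (hy.1 i).trans (by norm_num), hy.2.trans (by norm_num)⟩)) x hx2
      linarith
    have ht3 := abs_le.1 ht1
    have ht4 := abs_le.1 ht2
    have hs2 : w x t - w x t0 ≤ ε / 2 := by
      rcases le_total t0 t with h1 | h1
      · have := htm w hw x t0 (fun y s hy => hb y s (hsub t0 (by simp) y s hy)) t h1 (by linarith)
        have := mul_le_mul_of_nonneg_left ht4.2 hD.le
        linarith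
      · have := htm _ hw.neg x t (fun y s hy => RegSol.bound_neg (hb y s (hsub t ht1 y s hy))) t0 h1 (by linarith)
        have := mul_le_mul_of_nonneg_left ht4.1 hD.le
        linarith
    linarith
  intro w hw x0 t0 hb x t hxt
  rw [abs_le]
  constructor
  · have := key _ hw.neg x0 t0 (fun y s hy => RegSol.bound_neg (hb y s hy)) x t hxt
    linarith
  · exact key w hw x0 t0 hb x t hxt

lemma pd_sub {N : ℕ} {v w : (Fin N → ℝ) → ℝ} (hv : Differentiable ℝ v) (hw : Differentiable ℝ w) (i : Fin N)
    (x : Fin N → ℝ) : pd i (fun y => v y - w y) x = pd i v x - pd i w x := by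
  unfold pd
  rw [fderiv_fun_sub (hv x) (hw x)]; rfl

lemma pd2_sub {N : ℕ} {v w : (Fin N → ℝ) → ℝ} (hv : ContDiff ℝ 2 v) (hw : ContDiff ℝ 2 w) (i j : Fin N)
    (x : Fin N → ℝ) : pd2 i j (fun y => v y - w y) x = pd2 i j v x - pd2 i j w x := by
  unfold pd2
  have hv1 := hv.differentiable (by norm_num)
  have hw1 := hw.differentiable (by norm_num)
  simp only [pd_sub hv1 hw1]
  exact pd_sub (pd_diff hv j) (pd_diff hw j) i x

lemma pd_shift {N : ℕ} (v : (Fin N → ℝ) → ℝ) (i : Fin N) (z x : Fin N → ℝ) :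
    pd i (fun y => v (y + z)) x = pd i v (x + z) := by
  unfold pd
  rw [fderiv_comp_add_right]

lemma pd2_shift {N : ℕ} (v : (Fin N → ℝ) → ℝ) (i j : Fin N) (z x : Fin N → ℝ) :
    pd2 i j (fun y => v (y + z)) x = pd2 i j v (x + z) := by
  unfold pd2
  simp only [pd_shift]

/-- Space-time solutions in uncurried form. -/
def Sol {N : ℕ} (a : Fin N → Fin N → (Fin N → ℝ) → ℝ → ℝ)
    (b : Fin N → (Fin N → ℝ) → ℝ → ℝ) (c : (Fin N → ℝ) → ℝ → ℝ) (w g : (Fin N → ℝ) × ℝ → ℝ) : Prop :=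
  RegSol (fun x t => w (x, t)) ∧ ∀ x t, parOp a b c (fun x t => w (x, t)) x t = g (x, t)

section
variable {N : ℕ} {a : Fin N → Fin N → (Fin N → ℝ) → ℝ → ℝ}
    {b : Fin N → (Fin N → ℝ) → ℝ → ℝ} {c : (Fin N → ℝ) → ℝ → ℝ}

lemma RegSol.sub {v w : (Fin N → ℝ) → ℝ → ℝ} (hv : RegSol v) (hw : RegSol w) :
    RegSol (fun x t => v x t - w x t) :=
  ⟨hv.1.sub hw.1, fun x => (hv.2.1 x).sub (hw.2.1 x), fun t => (hv.2.2 t).sub (hw.2.2 t)⟩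

lemma parOp_sub {v w : (Fin N → ℝ) → ℝ → ℝ} (hv : RegSol v) (hw : RegSol w) (x : Fin N → ℝ) (t : ℝ) :
    parOp a b c (fun x t => v x t - w x t) x t = parOp a b c v x t - parOp a b c w x t := by
  unfold parOp
  rw [deriv_fun_sub (hv.2.1 x t) (hw.2.1 x t)]
  simp only [pd2_sub (hv.2.2 t) (hw.2.2 t), pd_sub ((hv.2.2 t).differentiable (by norm_num)) ((hw.2.2 t).differentiable (by norm_num)),
    mul_sub, Finset.sum_sub_distrib]
  ring

lemma RegSol.const (C : ℝ) : RegSol (fun (_ : Fin N → ℝ) (_ : ℝ) => C) :=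
  ⟨continuous_const, fun _ => differentiable_const _, fun _ => contDiff_const⟩

lemma parOp_const (C : ℝ) (x : Fin N → ℝ) (t : ℝ) :
    parOp a b c (fun _ _ => C) x t = - (c x t * C) := by
  unfold parOp pd2 pd
  simp

lemma Sol.sub {v w g k : (Fin N → ℝ) × ℝ → ℝ} (hv : Sol a b c v g) (hw : Sol a b c w k) :
    Sol a b c (fun X => v X - w X) (fun X => g X - k X) :=
  ⟨hv.1.sub hw.1, fun x t => by rw [parOp_sub hv.1 hw.1, hv.2, hw.2]⟩

lemma RegSol.shift {v : (Fin N → ℝ) → ℝ → ℝ} (hv : RegSol v) (z : Fin N → ℝ) (τ : ℝ) :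
    RegSol (fun x t => v (x + z) (t + τ)) := by
  refine ⟨?_, fun x => ?_, fun t => ?_⟩
  · exact hv.1.comp (f := fun p : (Fin N → ℝ) × ℝ => (p.1 + z, p.2 + τ)) (by fun_prop)
  · exact (hv.2.1 (x + z)).comp (f := fun s : ℝ => s + τ) (by fun_prop)
  · exact (hv.2.2 (t + τ)).comp (f := fun y : Fin N → ℝ => y + z) (by fun_prop)

lemma parOp_shift {v : (Fin N → ℝ) → ℝ → ℝ} (z : Fin N → ℝ) (τ : ℝ)
    (ha : ∀ i j x t, a i j (x + z) (t + τ) = a i j x t) (hb : ∀ i x t, b i (x + z) (t + τ) = b i x t)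
    (hc : ∀ x t, c (x + z) (t + τ) = c x t) (x : Fin N → ℝ) (t : ℝ) :
    parOp a b c (fun x t => v (x + z) (t + τ)) x t = parOp a b c v (x + z) (t + τ) := by
  unfold parOp
  rw [deriv_comp_add_const (fun s => v (x + z) s) τ t]
  simp only [ha, hb, hc]
  congr 2
  · congr 1
    refine Finset.sum_congr rfl fun i _ => Finset.sum_congr rfl fun j _ => ?_
    rw [pd2_shift (fun y => v y (t + τ))]
  · refine Finset.sum_congr rfl fun i _ => ?_
    rw [pd_shift (fun y => v y (t + τ))]

/-- Invariance under a translation. -/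
def TInv (e : (Fin N → ℝ) × ℝ) (φ : (Fin N → ℝ) → ℝ → ℝ) : Prop :=
  ∀ x t, φ (x + e.1) (t + e.2) = φ x t

lemma per_zsmul {E : Type*} [AddCommGroup E] {φ : E → ℝ} {e : E} (h : ∀ X, φ (X + e) = φ X) (k : ℤ) :
    ∀ X, φ (X + k • e) = φ X := by
  induction k using Int.induction_on with
  | zero => simp
  | succ n ih => intro X; rw [add_smul, one_smul, ← add_assoc, h, ih]
  | pred n ih =>
    intro X
    rw [← h, sub_smul, one_smul]
    have : X + (-(n:ℤ) • e - e) + e = X + -(n:ℤ) • e := by abel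
    rw [this, ih]

lemma TInv.zsmul {e : (Fin N → ℝ) × ℝ} {φ : (Fin N → ℝ) → ℝ → ℝ} (h : TInv e φ) (k : ℤ) : TInv (k • e) φ := by
  intro x t
  exact per_zsmul (φ := fun X : (Fin N → ℝ) × ℝ => φ X.1 X.2) (e := e) (fun X => h X.1 X.2) k (x, t)

lemma Sol.shift {w g : (Fin N → ℝ) × ℝ → ℝ} (hw : Sol a b c w g) {e : (Fin N → ℝ) × ℝ}
    (ha : ∀ i j, TInv e (a i j)) (hb : ∀ i, TInv e (b i)) (hc : TInv e c) (k : ℤ) :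
    Sol a b c (fun X => w (X + k • e)) (fun X => g (X + k • e)) := by
  refine ⟨hw.1.shift (k • e).1 (k • e).2, fun x t => ?_⟩
  exact (parOp_shift (v := fun x t => w (x, t)) (k • e).1 (k • e).2 (fun i j => (ha i j).zsmul k)
    (fun i => (hb i).zsmul k) (hc.zsmul k) x t).trans (hw.2 _ _)

/-- Locally uniform limits of almost-solutions. -/
def Good {E : Type*} [Norm E] (S : (E → ℝ) → (E → ℝ) → Prop) (M : ℝ) (W : E → ℝ) : Prop :=
  ∀ R ε : ℝ, 0 < ε → ∃ w g, S w g ∧ (∀ X, |w X| ≤ M) ∧ ∀ X, ‖X‖ ≤ R → |W X - w X| ≤ ε ∧ |g X| ≤ ε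

lemma Good.bound {E : Type*} [Norm E] {S : (E → ℝ) → (E → ℝ) → Prop} {M : ℝ} {W : E → ℝ}
    (h : Good S M W) (X : E) : |W X| ≤ M := by
  apply le_of_forall_pos_le_add
  intro ε hε
  obtain ⟨w, g, -, h1, h2⟩ := h ‖X‖ ε hε
  have h3 := (h2 X le_rfl).1
  calc |W X| = |(W X - w X) + w X| := by ring_nf
    _ ≤ _ := abs_add_le _ _
    _ ≤ M + ε := by linarith [h1 X]

lemma st_norm_le {x : Fin N → ℝ} {t R : ℝ} (hR : 0 ≤ R) (h1 : ∀ i, |x i| ≤ R) (h2 : |t| ≤ R) :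
    ‖((x, t) : (Fin N → ℝ) × ℝ)‖ ≤ R := by
  rw [norm_prod_le_iff]
  exact ⟨(pi_norm_le_iff_of_nonneg hR).2 h1, h2⟩

lemma st_le_norm (X : (Fin N → ℝ) × ℝ) : (∀ i, |X.1 i| ≤ ‖X‖) ∧ |X.2| ≤ ‖X‖ :=
  ⟨fun i => (norm_le_pi_norm X.1 i).trans (norm_fst_le X), norm_snd_le X⟩

set_option maxHeartbeats 1000000 in
/-- One-sided Liouville property. -/
lemma liouville_up {a0 Λ : ℝ} (h : Co a b c a0 Λ) (hc0 : ∀ x t, c x t ≤ 0) {e : (Fin N → ℝ) × ℝ}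
    {W : (Fin N → ℝ) × ℝ → ℝ} {M M2 : ℝ} (hW : ∀ X, |W X| ≤ M)
    (hD : Good (Sol a b c) M2 (fun X => W (X + e) - W X)) (X : (Fin N → ℝ) × ℝ) : W (X + e) - W X ≤ 0 := by
  by_contra hcon
  push Not at hcon
  set D : (Fin N → ℝ) × ℝ → ℝ := fun X => W (X + e) - W X with hDdef
  have hDb : BddAbove (Set.range D) := ⟨M2, by rintro _ ⟨Y, rfl⟩; exact (abs_le.1 (hD.bound Y)).2⟩
  set s := sSup (Set.range D) with hs
  have hsD : ∀ Y, D Y ≤ s := fun Y => le_csSup hDb ⟨Y, rfl⟩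
  have hs0 : 0 < s := lt_of_lt_of_le hcon (hsD X)
  have hM2 : 0 ≤ M2 := (abs_nonneg _).trans (hD.bound X)
  obtain ⟨K, hK⟩ := exists_nat_gt (4 * M / s)
  have hK' : 2 * M < K * (s / 2) := by
    rw [div_lt_iff₀ hs0] at hK; linarith
  obtain ⟨r, hr, hr1, heq⟩ := equicont h M2 1 hM2 (by norm_num) (s / 8) (by positivity)
  set V := K * ‖e‖ with hV
  have hV0 : 0 ≤ V := by positivity
  set T := 1 + 2 * V with hT
  obtain ⟨κ, hκ, hpr⟩ := propagate h r (s / 8) V T hr hr1 (by positivity) hV0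
  set ε := min (κ / 4) (min (s / 16) 1) with hε
  have hε0 : 0 < ε := by positivity
  have hε1 : ε ≤ κ / 4 := min_le_left _ _
  have hε2 : ε ≤ s / 16 := (min_le_right _ _).trans (min_le_left _ _)
  have hε3 : ε ≤ 1 := (min_le_right _ _).trans (min_le_right _ _)
  obtain ⟨_, ⟨⟨x0, t0⟩, rfl⟩, hX0⟩ := exists_lt_of_lt_csSup (s := Set.range D) ⟨D X, X, rfl⟩ (show s - ε < s by linarith)
  set R := ‖((x0, t0) : (Fin N → ℝ) × ℝ)‖ + 2 * V + T + 5 with hR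
  obtain ⟨w, g, hw, hwM, hwR⟩ := hD R ε hε0
  have hn0 := st_le_norm ((x0, t0) : (Fin N → ℝ) × ℝ)
  simp only at hn0
  have hRn : 0 ≤ R := by positivity
  have hbox : ∀ x t, (∀ i, |x i - x0 i| ≤ 2 * V + 4) → |t - t0| ≤ T + 4 → ‖((x, t) : (Fin N → ℝ) × ℝ)‖ ≤ R := by
    intro x t h1 h2
    refine st_norm_le hRn (fun i => ?_) ?_
    · have := abs_le.1 (h1 i); have := abs_le.1 (hn0.1 i); rw [abs_le]; constructor <;> linarith
    · have := abs_le.1 h2; have := abs_le.1 (hn0.2); rw [abs_le]; constructor <;> linarith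
  set ts := t0 - (1 + V) with hts
  have hz : RegSol (fun x t => (s + ε) - w (x, t)) := (RegSol.const (s + ε)).sub hw.1
  have hkey : ∀ k : ℕ, k < K → s / 2 ≤ D ((x0, ts) + k • e) := by
    intro k hk
    have hne := st_le_norm e
    have hke : (k:ℝ) * ‖e‖ ≤ V := by
      rw [hV]; apply mul_le_mul_of_nonneg_right _ (norm_nonneg _); exact_mod_cast hk.le
    have hk0 : (0:ℝ) ≤ k := Nat.cast_nonneg k
    set x1 := x0 + k • e.1 with hx1
    set t1 := ts + k • e.2 with ht1
    have hX1 : ((x0, ts) : (Fin N → ℝ) × ℝ) + k • e = (x1, t1) := rfl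
    have d1 : ∀ i, |x0 i - x1 i| ≤ V := by
      intro i
      have : x0 i - x1 i = - (k * e.1 i) := by simp [hx1]
      rw [this, abs_neg, abs_mul, abs_of_nonneg hk0]
      exact (mul_le_mul_of_nonneg_left (hne.1 i) hk0).trans hke
    have d2 : |(k:ℝ) * e.2| ≤ V := by
      rw [abs_mul, abs_of_nonneg hk0]
      exact (mul_le_mul_of_nonneg_left hne.2 hk0).trans hke
    have d2' := abs_le.1 d2
    have d3 : t0 - t1 = 1 + V - k * e.2 := by rw [ht1, hts, nsmul_eq_mul]; ring
    obtain ⟨y, hy, hyz⟩ := hpr _ hz x0 x1 t0 t1 d1 (by linarith) (by linarith) (by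
      intro x t hx h1 h2
      have hin := hwR (x, t) (hbox x t (fun i => (hx i).trans (by linarith)) (by rw [abs_le]; constructor <;> linarith))
      constructor
      · have := abs_le.1 hin.1; have := hsD (x, t); linarith
      · rw [parOp_sub (RegSol.const (s + ε)) hw.1, parOp_const, hw.2]
        have := abs_le.1 hin.2
        have : c x t * (s + ε) ≤ 0 := mul_nonpos_of_nonpos_of_nonneg (hc0 x t) (by linarith)
        linarith) (by
      have hin := abs_le.1 (hwR (x0, t0) (hbox x0 t0 (fun i => by simp; linarith) (by simp; linarith))).1
      linarith)
    have heq1 := heq _ hw.1 x1 t1 (by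
      intro x t ⟨hx, ht⟩
      refine ⟨hwM _, ?_⟩
      rw [hw.2]
      have ht' := abs_le.1 ht
      refine (hwR (x, t) (hbox x t (fun i => ?_) (by rw [abs_le]; constructor <;> linarith))).2.trans hε3
      have := abs_le.1 (hx i); have := abs_le.1 (d1 i); rw [abs_le]; constructor <;> linarith) y t1
      ⟨hy, by simp; exact hr.le⟩
    have heq2 := abs_le.1 heq1
    have hin := abs_le.1 (hwR (x1, t1) (hbox x1 t1 (fun i => by
      have := abs_le.1 (d1 i); rw [abs_le]; constructor <;> linarith) (by rw [abs_le]; constructor <;> linarith))).1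
    rw [hX1]
    linarith
  have htel : ∀ k : ℕ, k ≤ K → k * (s / 2) ≤ W ((x0, ts) + k • e) - W (x0, ts) := by
    intro k
    induction k with
    | zero => intro _; simp
    | succ k ih =>
      intro hk
      have h1 := ih (by omega)
      have h2 := hkey k (by omega)
      simp only [hDdef] at h2
      rw [add_assoc, ← succ_nsmul] at h2
      push_cast
      linarith
  have h1 := htel K le_rfl
  have h2 := abs_le.1 (hW ((x0, ts) + K • e))
  have h3 := abs_le.1 (hW (x0, ts))
  linarith

lemma Sol.neg {w g : (Fin N → ℝ) × ℝ → ℝ} (hw : Sol a b c w g) :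
    Sol a b c (fun X => - w X) (fun X => - g X) :=
  ⟨hw.1.neg, fun x t => by rw [parOp_neg a b c (fun x t => w (x, t)), hw.2]⟩

lemma liouville {a0 Λ : ℝ} (h : Co a b c a0 Λ) (hc0 : ∀ x t, c x t ≤ 0) {e : (Fin N → ℝ) × ℝ}
    (ha : ∀ i j, TInv e (a i j)) (hb : ∀ i, TInv e (b i)) (hc : TInv e c)
    {W : (Fin N → ℝ) × ℝ → ℝ} {M : ℝ}
    (hD : Good (Sol a b c) M W) (X : (Fin N → ℝ) × ℝ) : W (X + e) = W X := by
  have key : ∀ W : (Fin N → ℝ) × ℝ → ℝ, Good (Sol a b c) M W → ∀ X, W (X + e) - W X ≤ 0 := by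
    intro W hW X
    refine liouville_up h hc0 (M := M) (M2 := 2 * M) hW.bound ?_ X
    intro R ε hε
    obtain ⟨w, g, hw, hM, hR⟩ := hW (R + ‖e‖) (ε / 2) (by positivity)
    have hs := hw.shift ha hb hc 1
    simp only [one_smul] at hs
    refine ⟨_, _, hs.sub hw, fun X => ?_, fun X hX => ?_⟩
    · have h1 := abs_le.1 (hM X); have h2 := abs_le.1 (hM (X + e)); rw [abs_le]; constructor <;> linarith
    · have h1 := hR X (by linarith [norm_nonneg e])
      have h2 := hR (X + e) ((norm_add_le _ _).trans (by linarith))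
      have h3 := abs_le.1 h1.1; have h4 := abs_le.1 h1.2; have h5 := abs_le.1 h2.1; have h6 := abs_le.1 h2.2
      constructor <;> rw [abs_le] <;> constructor <;> linarith
  have h1 := key W hD X
  have h2 := key (fun X => - W X) (by
    intro R ε hε
    obtain ⟨w, g, hw, hM, hR⟩ := hD R ε hε
    refine ⟨_, _, hw.neg, fun X => by rw [abs_neg]; exact hM X, fun X hX => ?_⟩
    have h1 := hR X hX
    refine ⟨?_, by rw [abs_neg]; exact h1.2⟩
    rw [← abs_neg]; convert h1.1 using 2; ring) X
  linarith
end

/-- A fixed free ultrafilter on the naturals. -/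
def UF : Filter ℕ := (hyperfilter ℕ : Ultrafilter ℕ)

instance UF_neBot : UF.NeBot := inferInstanceAs ((hyperfilter ℕ : Ultrafilter ℕ) : Filter ℕ).NeBot

lemma UF_le : UF ≤ atTop := Nat.hyperfilter_le_atTop

lemma UF_compact {Z : Type*} [TopologicalSpace Z] {K : Set Z} (hK : IsCompact K) (g : ℕ → Z) (hg : ∀ n, g n ∈ K) :
    ∃ L ∈ K, Tendsto g UF (𝓝 L) := by
  have := isCompact_iff_ultrafilter_le_nhds.1 hK ((hyperfilter ℕ).map g) (by
    rw [le_principal_iff]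
    exact Filter.Eventually.of_forall (f := UF) (p := fun n => g n ∈ K) hg)
  exact this

lemma UF_real (g : ℕ → ℝ) (M : ℝ) (hg : ∀ n, |g n| ≤ M) : ∃ L, Tendsto g UF (𝓝 L) := by
  obtain ⟨L, -, h⟩ := UF_compact (isCompact_Icc (a := -M) (b := M)) g (fun n => abs_le.1 (hg n))
  exact ⟨L, h⟩

lemma loc_unif {E : Type*} [PseudoMetricSpace E] {K : Set E} (hK : IsCompact K) (g : ℕ → E → ℝ) (L : E → ℝ)
    (hp : ∀ X ∈ K, Tendsto (fun n => g n X) UF (𝓝 (L X)))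
    (he : ∀ ε > 0, ∃ δ > 0, ∀ n, ∀ X ∈ K, ∀ Y ∈ K, dist X Y ≤ δ → |g n X - g n Y| ≤ ε)
    (ε : ℝ) (hε : 0 < ε) : ∀ᶠ n in UF, ∀ X ∈ K, |g n X - L X| ≤ ε := by
  obtain ⟨δ, hδ, hd⟩ := he (ε / 3) (by positivity)
  have hL : ∀ X ∈ K, ∀ Y ∈ K, dist X Y ≤ δ → |L X - L Y| ≤ ε / 3 := by
    intro X hX Y hY hXY
    exact le_of_tendsto ((hp X hX).sub (hp Y hY)).abs (Eventually.of_forall fun n => hd n X hX Y hY hXY)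
  obtain ⟨t, ht, htf, htc⟩ := hK.finite_cover_balls hδ
  have h1 : ∀ᶠ n in UF, ∀ Y ∈ t, |g n Y - L Y| ≤ ε / 3 := by
    rw [Filter.eventually_all_finite htf]
    intro Y hY
    have := (Metric.tendsto_nhds.1 (hp Y (ht hY))) (ε / 3) (by positivity)
    filter_upwards [this] with n hn
    rw [Real.dist_eq] at hn; exact hn.le
  filter_upwards [h1] with n hn X hX
  obtain ⟨Y, hY, hXY⟩ := Set.mem_iUnion₂.1 (htc hX)
  have hXY' : dist X Y ≤ δ := (Metric.mem_ball.1 hXY).le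
  have q1 := abs_le.1 (hd n X hX Y (ht hY) hXY')
  have q2 := abs_le.1 (hL X hX Y (ht hY) hXY')
  have q3 := abs_le.1 (hn Y hY)
  rw [abs_le]; constructor <;> linarith

/-- Comparison of suprema on an orbit. -/
lemma shift_le (g h : ℤ → ℝ) (M p : ℝ) (hg : ∀ k, g k ≤ M) (hh : ∀ k, h k = g k + p)
    (hB : ∀ B, (∀ k, g k ≤ B) → ∀ k, h k ≤ B) : p ≤ 0 := by
  have hb : BddAbove (Set.range g) := ⟨M, by rintro _ ⟨k, rfl⟩; exact hg k⟩
  have h1 := hB (⨆ k, g k) (fun k => le_ciSup hb k)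
  have h2 : (⨆ k, g k) ≤ (⨆ k, g k) - p := ciSup_le fun k => by have := h1 k; rw [hh] at this; linarith
  linarith

/-- Total boundedness of the integer translates, expressed through the ultrafilter. -/
def TB {E : Type*} [NormedAddCommGroup E] (e : E) (f : E → ℝ) : Prop :=
  ∀ (j : ℕ → ℤ) (R ε : ℝ), 0 < ε → ∃ A ∈ UF, ∀ n ∈ A, ∀ n' ∈ A, ∀ X : E, ‖X‖ ≤ R → ∀ i : ℤ,
    |f (X + (i + j n) • e) - f (X + (i + j n') • e)| ≤ ε

/-- Uniform continuity along orbits. -/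
def EC {E : Type*} [NormedAddCommGroup E] (e : E) (u : E → ℝ) : Prop :=
  ∀ R ε : ℝ, 0 < ε → ∃ δ > 0, ∀ X Y : E, ‖X‖ ≤ R → ‖Y‖ ≤ R → dist X Y ≤ δ → ∀ i : ℤ,
    |u (X + i • e) - u (Y + i • e)| ≤ ε

section
variable {E : Type*} [NormedAddCommGroup E] {e : E} {S : (E → ℝ) → (E → ℝ) → Prop}

lemma EC.lim {u : E → ℝ} (hu : EC e u) (U : E → ℝ) (j : ℕ → ℤ)
    (hU : ∀ X, Tendsto (fun n => u (X + j n • e)) UF (𝓝 (U X))) : EC e U := by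
  intro R ε hε
  obtain ⟨δ, hδ, h⟩ := hu R ε hε
  refine ⟨δ, hδ, fun X Y hX hY hXY i => ?_⟩
  refine le_of_tendsto ((hU (X + i • e)).sub (hU (Y + i • e))).abs (Eventually.of_forall fun n => ?_)
  have := h X Y hX hY hXY (i + j n)
  rwa [add_smul, ← add_assoc, ← add_assoc] at this

variable [ProperSpace E]

lemma EC.unif {u : E → ℝ} (hu : EC e u) (U : E → ℝ) (j : ℕ → ℤ)
    (hU : ∀ X, Tendsto (fun n => u (X + j n • e)) UF (𝓝 (U X))) (R ε : ℝ) (hε : 0 < ε) :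
    ∀ᶠ n in UF, ∀ X, ‖X‖ ≤ R → |u (X + j n • e) - U X| ≤ ε := by
  have := loc_unif (isCompact_closedBall (0:E) R) (fun n X => u (X + j n • e)) U (fun X _ => hU X)
    (by
      intro ε hε
      obtain ⟨δ, hδ, h⟩ := hu R ε hε
      refine ⟨δ, hδ, fun n X hX Y hY hXY => h X Y (by simpa using hX) (by simpa using hY) hXY _⟩) ε hε
  filter_upwards [this] with n hn X hX
  exact hn X (by simpa using hX)

set_option maxHeartbeats 1000000 in
lemma core_Q (hsub : ∀ v g w k, S v g → S w k → S (fun X => v X - w X) (fun X => g X - k X))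
    (hsh : ∀ w g (k : ℤ), S w g → S (fun X => w (X + k • e)) (fun X => g (X + k • e)))
    (hL : ∀ W M, Good S M W → ∀ X, W (X + e) = W X)
    {u f : E → ℝ} {M : ℝ} (huf : S u f) (huM : ∀ X, |u X| ≤ M) (hu : EC e u) (hf : TB e f)
    (R ε : ℝ) (hε : 0 < ε) :
    ∃ δ R', 0 < δ ∧ ∀ k : ℤ, (∀ X : E, ‖X‖ ≤ R' → ∀ i : ℤ, |f (X + (i + k) • e) - f (X + i • e)| ≤ δ) →
      ∀ X : E, ‖X‖ ≤ R → ∀ i : ℤ, |u (X + (i + k) • e) - u (X + i • e)| ≤ ε := by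
  by_contra hcon
  push Not at hcon
  have h0 : ∀ n : ℕ, (0:ℝ) < 1 / (n + 1) := fun n => by positivity
  choose k hk Xn hXn j hj using fun n : ℕ => hcon (1 / (n + 1)) n (h0 n)
  have hU2 : ∀ X, ∃ L, Tendsto (fun n => u (X + j n • e)) UF (𝓝 L) := fun X => UF_real _ M fun n => huM _
  choose U2 hU2 using hU2
  have hU1 : ∀ X, ∃ L, Tendsto (fun n => u (X + (j n + k n) • e)) UF (𝓝 L) := fun X => UF_real _ M fun n => huM _
  choose U1 hU1 using hU1
  have hU2M : ∀ X, |U2 X| ≤ M := fun X => le_of_tendsto (hU2 X).abs (Eventually.of_forall fun n => huM _)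
  have hu' : ∀ X, ∃ L, Tendsto (fun n => U2 (X + (- j n) • e)) UF (𝓝 L) := fun X => UF_real _ M fun n => hU2M _
  choose u' hu' using hu'
  have hECU2 := hu.lim U2 j hU2
  -- V is periodic
  have hV : ∀ X, (fun X => U1 X - U2 X) (X + e) = (fun X => U1 X - U2 X) X := by
    apply hL (fun X => U1 X - U2 X) (2 * M)
    intro R ε hε
    have e1 := hu.unif U1 _ hU1 R (ε / 2) (by positivity)
    have e2 := hu.unif U2 _ hU2 R (ε / 2) (by positivity)
    have e3 : ∀ᶠ n : ℕ in UF, 1 / ((n:ℝ) + 1) < ε :=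
      (tendsto_one_div_add_atTop_nhds_zero_nat.mono_left UF_le).eventually_lt_const hε
    have e4 : ∀ᶠ n : ℕ in UF, R ≤ (n:ℝ) :=
      (tendsto_natCast_atTop_atTop.mono_left UF_le).eventually_ge_atTop R
    obtain ⟨n, h1, h2, h3, h4⟩ := (e1.and (e2.and (e3.and e4))).exists
    refine ⟨_, _, hsub _ _ _ _ (hsh _ _ (j n + k n) huf) (hsh _ _ (j n) huf), fun X => ?_, fun X hX => ⟨?_, ?_⟩⟩
    · have h1 := abs_le.1 (huM (X + (j n + k n) • e)); have h2 := abs_le.1 (huM (X + j n • e))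
      rw [abs_le]; constructor <;> linarith
    · have h1 := abs_le.1 (h1 X hX); have h2 := abs_le.1 (h2 X hX)
      rw [abs_le]; constructor <;> linarith
    · exact (hk n X (hX.trans h4) (j n)).trans h3.le
  -- the difference is periodic
  have hP : ∀ X, (fun X => u' X - u X) (X + e) = (fun X => u' X - u X) X := by
    apply hL (fun X => u' X - u X) (2 * M)
    intro R ε hε
    obtain ⟨A, hA, hAf⟩ := hf j R ε hε
    have e1 := hECU2.unif u' (fun n => - j n) hu' R (ε / 2) (by positivity)
    obtain ⟨n, hnA, h1⟩ := ((Filter.eventually_mem_set.2 hA).and e1).exists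
    have e2 := hu.unif U2 _ hU2 (R + ‖(- j n) • e‖) (ε / 2) (by positivity)
    obtain ⟨n', hnA', h2⟩ := ((Filter.eventually_mem_set.2 hA).and e2).exists
    refine ⟨_, _, hsub _ _ _ _ (hsh _ _ (- j n + j n') huf) huf, fun X => ?_, fun X hX => ⟨?_, ?_⟩⟩
    · have h1 := abs_le.1 (huM (X + (- j n + j n') • e)); have h2 := abs_le.1 (huM X)
      rw [abs_le]; constructor <;> linarith
    · have h1 := abs_le.1 (h1 X hX)
      have h2 := abs_le.1 (h2 (X + (- j n) • e) ((norm_add_le _ _).trans (by linarith)))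
      rw [add_assoc, ← add_smul] at h2
      rw [abs_le]; constructor <;> linarith
    · have := hAf n hnA n' hnA' X hX (- j n)
      rw [neg_add_cancel, zero_smul, add_zero, abs_sub_comm] at this
      exact this
  have hV' : ∀ (k : ℤ) X, U1 (X + k • e) = U2 (X + k • e) + (U1 X - U2 X) := fun k X => by
    have := per_zsmul (φ := fun X => U1 X - U2 X) hV k X; linarith
  have hP' : ∀ (k : ℤ) X, u' (X + k • e) = u (X + k • e) + (u' X - u X) := fun k X => by
    have := per_zsmul (φ := fun X => u' X - u X) hP k X; linarith
  have a1 : ∀ X (i m : ℤ), X + i • e + m • e = X + (i + m) • e := fun X i m => by rw [add_smul, add_assoc]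
  have huu : ∀ X, u' X = u X := by
    intro X
    have q1 := shift_le (fun k => u (X + k • e)) (fun k => u' (X + k • e)) M (u' X - u X)
      (fun k => (abs_le.1 (huM _)).2) (fun k => hP' k X) (by
        intro B hB k
        refine le_of_tendsto (hu' (X + k • e)) (Eventually.of_forall fun n => ?_)
        refine le_of_tendsto (hU2 _) (Eventually.of_forall fun n' => ?_)
        rw [a1, a1]; exact hB _)
    have q2 := shift_le (fun k => - u (X + k • e)) (fun k => - u' (X + k • e)) M (u X - u' X)
      (fun k => by have := (abs_le.1 (huM (X + k • e))).1; linarith) (fun k => by rw [hP' k X]; ring) (by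
        intro B hB k
        refine le_of_tendsto (hu' (X + k • e)).neg (Eventually.of_forall fun n => ?_)
        refine le_of_tendsto (hU2 _).neg (Eventually.of_forall fun n' => ?_)
        rw [a1, a1]; exact hB _)
    linarith
  have hV0 : ∀ X, U1 X = U2 X := by
    intro X
    have q1 := shift_le (fun k => U2 (X + k • e)) (fun k => U1 (X + k • e)) M (U1 X - U2 X)
      (fun k => (abs_le.1 (hU2M _)).2) (fun k => hV' k X) (by
        intro B hB k
        refine le_of_tendsto (hU1 (X + k • e)) (Eventually.of_forall fun n => ?_)
        rw [a1, ← huu]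
        refine le_of_tendsto (hu' _) (Eventually.of_forall fun n' => ?_)
        rw [a1]; exact hB _)
    have q2 := shift_le (fun k => - U2 (X + k • e)) (fun k => - U1 (X + k • e)) M (U2 X - U1 X)
      (fun k => by have := (abs_le.1 (hU2M (X + k • e))).1; linarith) (fun k => by rw [hV' k X]; ring) (by
        intro B hB k
        refine le_of_tendsto (hU1 (X + k • e)).neg (Eventually.of_forall fun n => ?_)
        rw [a1, ← huu]
        refine le_of_tendsto (hu' _).neg (Eventually.of_forall fun n' => ?_)
        rw [a1]; exact hB _)
    linarith
  have e1 := hu.unif U1 _ hU1 R (ε / 2) (by positivity)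
  have e2 := hu.unif U2 _ hU2 R (ε / 2) (by positivity)
  obtain ⟨n, h1, h2⟩ := (e1.and e2).exists
  have h1 := abs_le.1 (h1 (Xn n) (hXn n))
  have h2 := abs_le.1 (h2 (Xn n) (hXn n))
  have h3 := hj n
  rw [hV0] at h1
  refine absurd h3 (not_lt.2 ?_)
  rw [abs_le]; constructor <;> linarith

lemma core_TB (hsub : ∀ v g w k, S v g → S w k → S (fun X => v X - w X) (fun X => g X - k X))
    (hsh : ∀ w g (k : ℤ), S w g → S (fun X => w (X + k • e)) (fun X => g (X + k • e)))
    (hL : ∀ W M, Good S M W → ∀ X, W (X + e) = W X)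
    {u f : E → ℝ} {M : ℝ} (huf : S u f) (huM : ∀ X, |u X| ≤ M) (hu : EC e u) (hf : TB e f) : TB e u := by
  intro j R ε hε
  obtain ⟨δ, R', hδ, hQ⟩ := core_Q hsub hsh hL huf huM hu hf R ε hε
  obtain ⟨A, hA, hAf⟩ := hf j R' δ hδ
  refine ⟨A, hA, fun n hn n' hn' X hX i => ?_⟩
  have := hQ (j n - j n') (fun X hX i => by
    have := hAf n hn n' hn' X hX (i - j n')
    rw [sub_add_cancel] at this
    rwa [show i + (j n - j n') = i - j n' + j n by ring]) X hX (i + j n')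
  rwa [show i + j n' + (j n - j n') = i + j n by ring] at this
end

section
variable {E : Type*} [NormedAddCommGroup E] [NormedSpace ℝ E]

/-- Bounded along orbits of a translation. -/
def OB (e : E) (f : E → ℝ) : Prop :=
  ∀ R : ℝ, ∃ K, 0 ≤ K ∧ ∀ X : E, ‖X‖ ≤ R → ∀ i : ℤ, |f (X + i • e)| ≤ K

lemma AP1_bdd {ψ : ℝ → ℝ} (h : AlmostPeriodic1 ψ) : ∃ K, 0 ≤ K ∧ ∀ s, |ψ s| ≤ K := by
  by_contra hcon
  push Not at hcon
  choose s hs using fun n : ℕ => hcon n (Nat.cast_nonneg n)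
  obtain ⟨k, hk, φ, hφ⟩ := h.2 s
  have h1 := (hφ.tendsto_at 0).abs
  simp only [zero_add] at h1
  have h2 : Tendsto (fun n => |ψ (s (k n))|) atTop atTop :=
    tendsto_atTop_mono (fun n => (hs (k n)).le) (tendsto_natCast_atTop_atTop.comp hk.tendsto_atTop)
  exact not_tendsto_nhds_of_tendsto_atTop h2 _ h1

lemma AP1_TB {ψ : ℝ → ℝ} (h : AlmostPeriodic1 ψ) (s : ℕ → ℝ) (ε : ℝ) (hε : 0 < ε) :
    ∃ A ∈ UF, ∀ n ∈ A, ∀ n' ∈ A, ∀ x, |ψ (x + s n) - ψ (x + s n')| ≤ ε := by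
  by_contra hcon
  push Not at hcon
  set B : ℕ → Set ℕ := fun n => {n' | ∀ x, |ψ (x + s n) - ψ (x + s n')| ≤ ε / 2} with hB
  have hBn : ∀ n, (B n)ᶜ ∈ UF := by
    intro n
    have : B n ∉ UF := by
      intro hn
      obtain ⟨n1, h1, n2, h2, x, hx⟩ := hcon (B n) hn
      have h1 := abs_le.1 (h1 x)
      have h2 := abs_le.1 (h2 x)
      refine absurd hx (not_lt.2 ?_)
      rw [abs_le]; constructor <;> linarith
    exact Ultrafilter.compl_mem_iff_notMem.2 this
  obtain ⟨g, -, hg⟩ := exists_seq_of_forall_finset_exists (fun _ : ℕ => True) (fun n n' => n' ∈ (B n)ᶜ) (by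
    intro F _
    have : (⋂ n ∈ F, (B n)ᶜ) ∈ UF := (Filter.biInter_finset_mem F).2 fun n _ => hBn n
    obtain ⟨y, hy⟩ := Filter.nonempty_of_mem this
    exact ⟨y, trivial, fun x hx => Set.mem_iInter₂.1 hy x hx⟩)
  obtain ⟨k, hk, φ, hφ⟩ := h.2 (fun n => s (g n))
  obtain ⟨n0, hn0⟩ := Filter.eventually_atTop.1 ((Metric.tendstoUniformly_iff.1 hφ) (ε / 4) (by positivity))
  apply hg (k n0) (k (n0 + 1)) (hk (Nat.lt_succ_self n0))
  intro x
  have h1 := hn0 n0 le_rfl x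
  have h2 := hn0 (n0 + 1) (Nat.le_succ _) x
  rw [Real.dist_eq] at h1 h2
  have h1 := abs_le.1 h1.le
  have h2 := abs_le.1 h2.le
  rw [abs_le]; constructor <;> linarith

variable [ProperSpace E]

lemma AP_OB {f : E → ℝ} {d : E} (l : ℝ) (hf : UniformContinuous f)
    (hap : ∀ Y, AlmostPeriodic1 (fun s : ℝ => f (Y + s • d))) : OB (l • d) f := by
  intro R
  obtain ⟨δ, hδ, hd⟩ := Metric.uniformContinuous_iff.1 hf 1 one_pos
  obtain ⟨t, ht, htf, htc⟩ := (isCompact_closedBall (0:E) R).finite_cover_balls hδ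
  choose K hK0 hK using fun Y => AP1_bdd (hap Y)
  refine ⟨(∑ Y ∈ htf.toFinset, K Y) + 1, add_nonneg (Finset.sum_nonneg fun Y _ => hK0 Y) zero_le_one, ?_⟩
  intro X hX i
  obtain ⟨Y, hY, hXY⟩ := Set.mem_iUnion₂.1 (htc (by simpa using hX))
  have h1 : dist (f (X + i • l • d)) (f (Y + i • l • d)) < 1 := hd (by simpa using hXY)
  have h2 := hK Y (i * l)
  have h3 : K Y ≤ ∑ Y ∈ htf.toFinset, K Y := Finset.single_le_sum (f := K) (fun Y _ => hK0 Y) (htf.mem_toFinset.2 hY)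
  rw [mul_smul, Int.cast_smul_eq_zsmul] at h2
  rw [Real.dist_eq] at h1
  have h1 := abs_le.1 h1.le; have h2 := abs_le.1 h2
  rw [abs_le]; constructor <;> linarith

lemma AP_TB {f : E → ℝ} {d : E} (l : ℝ) (hf : UniformContinuous f)
    (hap : ∀ Y, AlmostPeriodic1 (fun s : ℝ => f (Y + s • d))) : TB (l • d) f := by
  intro j R ε hε
  obtain ⟨δ, hδ, hd⟩ := Metric.uniformContinuous_iff.1 hf (ε / 3) (by positivity)
  obtain ⟨t, ht, htf, htc⟩ := (isCompact_closedBall (0:E) R).finite_cover_balls hδ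
  choose A hA hAf using fun Y => AP1_TB (hap Y) (fun n => j n * l) (ε / 3) (by positivity)
  refine ⟨⋂ Y ∈ t, A Y, (Filter.biInter_mem htf).2 fun Y _ => hA Y, ?_⟩
  intro n hn n' hn' X hX i
  obtain ⟨Y, hY, hXY⟩ := Set.mem_iUnion₂.1 (htc (by simpa using hX))
  have h1 : dist (f (X + (i + j n) • l • d)) (f (Y + (i + j n) • l • d)) < ε / 3 := hd (by simpa using hXY)
  have h2 : dist (f (X + (i + j n') • l • d)) (f (Y + (i + j n') • l • d)) < ε / 3 := hd (by simpa using hXY)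
  have h3 := hAf Y n (Set.mem_iInter₂.1 hn Y hY) n' (Set.mem_iInter₂.1 hn' Y hY) (i * l)
  have e1 : ∀ m : ℤ, ((i:ℝ) * l + m * l) • d = (i + m) • l • d := by
    intro m
    rw [← add_mul, mul_smul, ← Int.cast_add, Int.cast_smul_eq_zsmul]
  simp only [e1] at h3
  rw [Real.dist_eq] at h1 h2
  have h1 := abs_le.1 h1.le; have h2 := abs_le.1 h2.le; have h3 := abs_le.1 h3
  rw [abs_le]; constructor <;> linarith


lemma final_AP {u : E → ℝ} {d : E} {l : ℝ} (hl : 0 < l) (huc : Continuous u) (hEC : EC (l • d) u)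
    (hTB : TB (l • d) u) (Y : E) : AlmostPeriodic1 (fun s : ℝ => u (Y + s • d)) := by
  refine ⟨by fun_prop, fun s => ?_⟩
  set j : ℕ → ℤ := fun n => ⌊s n / l⌋ with hj
  set σ : ℕ → ℝ := fun n => s n - j n * l with hσ
  have hfl : ∀ x : ℝ, 0 ≤ x - ⌊x / l⌋ * l ∧ x - ⌊x / l⌋ * l ≤ l := by
    intro x
    have h1 := Int.floor_le (x / l)
    have h2 := (Int.lt_floor_add_one (x / l)).le
    rw [le_div_iff₀ hl] at h1
    rw [div_le_iff₀ hl] at h2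
    constructor <;> linarith
  obtain ⟨σ0, -, hσ0⟩ := UF_compact (isCompact_Icc (a := 0) (b := l)) σ (fun n => hfl (s n))
  have hC : ∀ ε > 0, ∃ A ∈ UF, ∀ n ∈ A, ∀ n' ∈ A, ∀ x : ℝ, |u (Y + (x + s n) • d) - u (Y + (x + s n') • d)| ≤ ε := by
    intro ε hε
    set R := ‖Y‖ + 2 * l * ‖d‖ with hR
    obtain ⟨δ, hδ, h1⟩ := hEC R (ε / 2) (by positivity)
    obtain ⟨A, hA, h2⟩ := hTB j R (ε / 2) (by positivity)
    have h3 : {n | |σ n - σ0| < δ / (2 * (‖d‖ + 1))} ∈ UF := by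
      have := (Metric.tendsto_nhds.1 hσ0) (δ / (2 * (‖d‖ + 1))) (by positivity)
      simp only [Real.dist_eq] at this
      exact this
    refine ⟨A ∩ _, Filter.inter_mem hA h3, ?_⟩
    rintro n ⟨hnA, hn⟩ n' ⟨hnA', hn'⟩ x
    have hn1 : |σ n - σ0| < δ / (2 * (‖d‖ + 1)) := hn
    have hn2 : |σ n' - σ0| < δ / (2 * (‖d‖ + 1)) := hn'
    set i := ⌊x / l⌋ with hi
    set τ := x - i * l with hτ
    have hτl : 0 ≤ τ ∧ τ ≤ l := hfl x
    have hXn : ∀ m, ‖Y + (τ + σ m) • d‖ ≤ R := by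
      intro m
      refine (norm_add_le _ _).trans ?_
      have hσm : 0 ≤ σ m ∧ σ m ≤ l := hfl (s m)
      rw [norm_smul, Real.norm_eq_abs, abs_of_nonneg (by linarith)]
      have : (τ + σ m) * ‖d‖ ≤ (2 * l) * ‖d‖ := mul_le_mul_of_nonneg_right (by linarith) (norm_nonneg _)
      linarith
    have hdec : ∀ m, Y + (x + s m) • d = Y + (τ + σ m) • d + (i + j m) • l • d := by
      intro m
      rw [← Int.cast_smul_eq_zsmul ℝ, smul_smul, add_assoc, ← add_smul]
      congr 2
      simp only [hτ, hσ]; push_cast; ring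
    have hdist : dist (Y + (τ + σ n) • d) (Y + (τ + σ n') • d) ≤ δ := by
      rw [dist_add_left, dist_eq_norm, ← sub_smul, norm_smul, Real.norm_eq_abs]
      have q : |τ + σ n - (τ + σ n')| ≤ δ / (‖d‖ + 1) := by
        have e1 : δ / (‖d‖ + 1) = δ / (2 * (‖d‖ + 1)) + δ / (2 * (‖d‖ + 1)) := by field_simp; ring
        have := abs_le.1 hn1.le; have := abs_le.1 hn2.le
        rw [e1, abs_le]; constructor <;> linarith
      calc _ ≤ δ / (‖d‖ + 1) * (‖d‖ + 1) := by
            apply mul_le_mul q (by linarith) (norm_nonneg _) (by positivity)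
        _ = δ := by field_simp
    have q1 := abs_le.1 (h1 _ _ (hXn n) (hXn n') hdist (i + j n))
    have q2 := abs_le.1 (h2 n hnA n' hnA' _ (hXn n') i)
    rw [hdec n, hdec n', abs_le]
    constructor <;> linarith
  choose A hA hAf using fun p : ℕ => hC (1 / (p + 1)) (by positivity)
  obtain ⟨k, hk, hkA⟩ := extraction_forall_of_frequently (P := fun p n => ∀ q ≤ p, n ∈ A q) (by
    intro p
    have h1 : ∀ᶠ n in UF, ∀ q ≤ p, n ∈ A q :=
      (Filter.eventually_all_finite (Set.finite_Iic p)).2 fun q _ => hA q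
    exact h1.frequently.filter_mono UF_le)
  refine ⟨k, hk, ?_⟩
  have hcau : ∀ p n n', p ≤ n → p ≤ n' → ∀ x : ℝ, |u (Y + (x + s (k n)) • d) - u (Y + (x + s (k n')) • d)| ≤ 1 / (p + 1) :=
    fun p n n' hn hn' x => hAf p _ (hkA n p hn) _ (hkA n' p hn') x
  have hlim : ∀ x : ℝ, ∃ L, Tendsto (fun n => u (Y + (x + s (k n)) • d)) atTop (𝓝 L) := by
    intro x
    apply cauchySeq_tendsto_of_complete
    rw [Metric.cauchySeq_iff']
    intro ε hε
    obtain ⟨p, hp⟩ := exists_nat_one_div_lt hε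
    refine ⟨p, fun n hn => ?_⟩
    rw [Real.dist_eq]
    exact (hcau p n p hn le_rfl x).trans_lt hp
  choose ψ hψ using hlim
  refine ⟨ψ, ?_⟩
  rw [Metric.tendstoUniformly_iff]
  intro ε hε
  obtain ⟨p, hp⟩ := exists_nat_one_div_lt hε
  filter_upwards [eventually_ge_atTop p] with n hn x
  refine lt_of_le_of_lt ?_ hp
  rw [Real.dist_eq]
  refine le_of_tendsto ((hψ x).sub_const _).abs ?_
  filter_upwards [eventually_ge_atTop p] with n' hn'
  exact hcau p n' n hn' hn x
end

section
variable {N : ℕ} {a : Fin N → Fin N → (Fin N → ℝ) → ℝ → ℝ}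
    {b : Fin N → (Fin N → ℝ) → ℝ → ℝ} {c : (Fin N → ℝ) → ℝ → ℝ}

lemma EC_of_sol {a0 Λ : ℝ} (h : Co a b c a0 Λ) {u g : (Fin N → ℝ) × ℝ → ℝ} {M : ℝ} {e : (Fin N → ℝ) × ℝ}
    (hu : Sol a b c u g) (huM : ∀ X, |u X| ≤ M) (hg : OB e g) : EC e u := by
  intro R ε hε
  obtain ⟨K, hK0, hK⟩ := hg (R + 3)
  obtain ⟨δ, hδ, -, heq⟩ := equicont h M K ((abs_nonneg _).trans (huM 0)) hK0 ε hε
  refine ⟨δ, hδ, fun X Y hX _ hXY i => ?_⟩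
  have := heq _ hu.1 (X + i • e).1 (X + i • e).2 (by
    intro x t ⟨hx, ht⟩
    refine ⟨huM _, ?_⟩
    rw [hu.2]
    have h1 : ‖((x, t) : (Fin N → ℝ) × ℝ) - (X + i • e)‖ ≤ 3 := st_norm_le (by norm_num) hx ht
    have h2 := hK ((x, t) - i • e) (by
      calc ‖((x, t) : (Fin N → ℝ) × ℝ) - i • e‖ = ‖X + (((x, t) : (Fin N → ℝ) × ℝ) - (X + i • e))‖ := by
            congr 1; abel
        _ ≤ _ := norm_add_le _ _
        _ ≤ R + 3 := by linarith) i
    rwa [sub_add_cancel] at h2) (Y + i • e).1 (Y + i • e).2 (by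
    have h1 : ‖(Y + i • e) - (X + i • e)‖ ≤ δ := by
      rw [add_sub_add_right_eq_sub, ← dist_eq_norm, dist_comm]; exact hXY
    have h2 := st_le_norm ((Y + i • e) - (X + i • e))
    exact ⟨fun k => (h2.1 k).trans h1, h2.2.trans h1⟩)
  rw [abs_sub_comm]
  exact this

lemma TB_of_sol {a0 Λ : ℝ} (h : Co a b c a0 Λ) (hc0 : ∀ x t, c x t ≤ 0) {e : (Fin N → ℝ) × ℝ}
    (ha : ∀ i j, TInv e (a i j)) (hb : ∀ i, TInv e (b i)) (hc : TInv e c)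
    {u g : (Fin N → ℝ) × ℝ → ℝ} {M : ℝ}
    (hu : Sol a b c u g) (huM : ∀ X, |u X| ≤ M) (hg : OB e g) (hg2 : TB e g) : TB e u :=
  core_TB (S := Sol a b c) (fun _ _ _ _ h1 h2 => h1.sub h2) (fun _ _ k h1 => h1.shift ha hb hc k)
    (fun _ _ hW => liouville h hc0 ha hb hc hW) hu huM (EC_of_sol h hu huM hg) hg2

lemma Co_of (h1 : ∀ i j, Bdd2 (a i j)) (h2 : ∀ i j, UC2 (a i j)) (h3 : ∀ i, Bdd2 (b i)) (h4 : Bdd2 c)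
    (h5 : ∀ i j x t, a i j x t = a j i x t) (h6 : ∃ a₀ a₁ : ℝ, 0 < a₀ ∧ a₀ ≤ a₁ ∧ ∀ (x : Fin N → ℝ) (t : ℝ) (ξ : Fin N → ℝ),
    a₀ * ∑ i, ξ i ^ 2 ≤ ∑ i, ∑ j, a i j x t * ξ i * ξ j ∧
    ∑ i, ∑ j, a i j x t * ξ i * ξ j ≤ a₁ * ∑ i, ξ i ^ 2) : ∃ a0 Λ, Co a b c a0 Λ := by
  obtain ⟨a0, a1, ha0, -, hell⟩ := h6
  choose A hA using h1
  choose B hB using h3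
  obtain ⟨C, hC⟩ := h4
  have hA0 : ∀ i j, 0 ≤ A i j := fun i j => (abs_nonneg _).trans (hA i j 0 0)
  have hB0 : ∀ i, 0 ≤ B i := fun i => (abs_nonneg _).trans (hB i 0 0)
  have hC0 : 0 ≤ C := (abs_nonneg _).trans (hC 0 0)
  have sA : 0 ≤ ∑ i, ∑ j, A i j := Finset.sum_nonneg fun i _ => Finset.sum_nonneg fun j _ => hA0 i j
  have sB : 0 ≤ ∑ i, B i := Finset.sum_nonneg fun i _ => hB0 i
  refine ⟨a0, 1 + ∑ i, ∑ j, A i j + ∑ i, B i + C, ha0, by linarith, h5, fun x t ξ => (hell x t ξ).1, ?_, ?_, ?_, ?_⟩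
  · intro i j x t
    have q1 : A i j ≤ ∑ j, A i j := Finset.single_le_sum (f := fun j => A i j) (fun j _ => hA0 i j) (Finset.mem_univ j)
    have q2 : ∑ j, A i j ≤ ∑ i, ∑ j, A i j := Finset.single_le_sum (f := fun i => ∑ j, A i j)
      (fun i _ => Finset.sum_nonneg fun j _ => hA0 i j) (Finset.mem_univ i)
    linarith [hA i j x t]
  · intro i x t
    have q1 : B i ≤ ∑ i, B i := Finset.single_le_sum (f := B) (fun j _ => hB0 j) (Finset.mem_univ i)
    linarith [hB i x t]
  · intro x t
    linarith [hC x t]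
  · intro ε hε
    choose δ hδ hd using fun i j => Metric.uniformContinuous_iff.1 (h2 i j) ε hε
    obtain ⟨δ0, hδ0, hle⟩ : ∃ δ0 > 0, ∀ i j, δ0 < δ i j := by
      have : ∀ᶠ η in 𝓝[>] (0:ℝ), ∀ p : Fin N × Fin N, η < δ p.1 p.2 := by
        rw [Filter.eventually_all]
        intro p
        exact nhdsWithin_le_nhds (gt_mem_nhds (hδ p.1 p.2))
      obtain ⟨η, h1, h2⟩ := (this.and self_mem_nhdsWithin).exists
      exact ⟨η, h2, fun i j => h1 (i, j)⟩
    refine ⟨δ0, hδ0, fun i j x y t hxy => ?_⟩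
    have := hd i j (a := (x, t)) (b := (y, t)) (lt_of_le_of_lt (by
      rw [dist_prod_same_right, dist_pi_le_iff hδ0.le]
      intro k; rw [Real.dist_eq]; exact hxy k) (hle i j))
    rw [Real.dist_eq] at this
    exact this.le

/-- The direction associated with a variable. -/
lemma direction (m : Fin (N + 1)) : ∃ d : (Fin N → ℝ) × ℝ,
    (∀ φ, APinVar m φ ↔ ∀ Y : (Fin N → ℝ) × ℝ, AlmostPeriodic1 (fun s : ℝ => φ (Y + s • d).1 (Y + s • d).2)) ∧
    (∀ l φ, PerInVar m l φ → TInv (l • d) φ) ∧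
    (∀ l : Fin N → ℝ, (∀ i, 0 < l i) → ∃ l' : ℝ, 0 < l' ∧ ∀ ψ, PerSpaceFun l ψ → TInv (l' • d) (fun x _ => ψ x)) := by
  have sh : ∀ (ψ : ℝ → ℝ) (r : ℝ), AlmostPeriodic1 ψ → AlmostPeriodic1 (fun s => ψ (s + r)) := by
    intro ψ r h
    refine ⟨h.1.comp (by fun_prop), fun s => ?_⟩
    obtain ⟨k, hk, φ, hφ⟩ := h.2 s
    refine ⟨k, hk, fun x => φ (x + r), ?_⟩
    have h2 : TendstoUniformly (fun n x => ψ ((x + r) + s (k n))) (fun x => φ (x + r)) atTop :=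
      hφ.comp (fun x => x + r)
    simpa only [add_right_comm _ r] using h2
  by_cases hm : (m : ℕ) < N
  · refine ⟨(Pi.single (⟨(m : ℕ), hm⟩ : Fin N) 1, 0), fun φ => ⟨fun h Y => ?_, fun h x t => ?_⟩, ?_, ?_⟩
    · have h1 := sh _ (Y.1 ⟨m, hm⟩) (h Y.1 Y.2)
      convert h1 using 2 with s
      rw [sliceVar, dif_pos hm]
      congr 1
      · ext k
        by_cases hk : k = ⟨m, hm⟩
        · subst hk; simp [add_comm]
        · simp [hk]
      · simp
    · have h1 := h (Function.update x (⟨(m : ℕ), hm⟩ : Fin N) 0, t)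
      convert h1 using 2 with s
      rw [sliceVar, dif_pos hm]
      congr 1
      · ext k
        by_cases hk : k = ⟨m, hm⟩
        · subst hk; simp
        · simp [hk]
      · simp
    · intro l φ h x t
      rw [PerInVar, dif_pos hm] at h
      simpa [← Pi.single_smul] using h x t
    · intro l hl
      refine ⟨l ⟨m, hm⟩, hl _, fun ψ h x t => ?_⟩
      simpa [← Pi.single_smul] using h ⟨m, hm⟩ x
  · refine ⟨(0, 1), fun φ => ⟨fun h Y => ?_, fun h x t => ?_⟩, ?_, ?_⟩
    · have h1 := sh _ Y.2 (h Y.1 Y.2)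
      convert h1 using 2 with s
      rw [sliceVar, dif_neg hm]
      simp [add_comm]
    · have h1 := h (x, 0)
      convert h1 using 2 with s
      rw [sliceVar, dif_neg hm]
      simp
    · intro l φ h x t
      rw [PerInVar, dif_neg hm] at h
      simpa using h x t
    · intro l hl
      refine ⟨1, one_pos, fun ψ h x t => ?_⟩
      simp

lemma case_a {f u : (Fin N → ℝ) → ℝ → ℝ} {m : Fin (N + 1)} {lm : ℝ}
    (hlm : 0 < lm) (hstd : StdCoeffs a b c) (hfuc : UC2 f) (hfap : APinVar m f)
    (ha : ∀ i j, PerInVar m lm (a i j)) (hb : ∀ i, PerInVar m lm (b i))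
    (hc : PerInVar m lm c) (hc0 : ∀ x t, c x t ≤ 0)
    (hsol : IsSol a b c f u) (hbdd : Bdd2 u) : APinVar m u := by
  obtain ⟨d, hd1, hd2, -⟩ := direction m
  obtain ⟨h1, h2, h3, -, h4, -, h5, h6⟩ := hstd
  obtain ⟨a0, Λ, hCo⟩ := Co_of h1 h2 h3 h4 h5 h6
  obtain ⟨M, hM⟩ := hbdd
  rw [hd1] at hfap ⊢
  have hS : Sol a b c (fun X => u X.1 X.2) (fun X => f X.1 X.2) := hsol
  have hOB := AP_OB (f := fun X : (Fin N → ℝ) × ℝ => f X.1 X.2) lm hfuc hfap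
  have hTB := AP_TB (f := fun X : (Fin N → ℝ) × ℝ => f X.1 X.2) lm hfuc hfap
  exact final_AP (u := fun X : (Fin N → ℝ) × ℝ => u X.1 X.2) hlm hsol.1.1
    (EC_of_sol hCo hS (fun X => hM _ _) hOB)
    (TB_of_sol hCo hc0 (fun i j => hd2 _ _ (ha i j)) (fun i => hd2 _ _ (hb i)) (hd2 _ _ hc) hS (fun X => hM _ _) hOB hTB)
end

lemma TB.mul {E : Type*} [NormedAddCommGroup E] {e : E} {q f : E → ℝ} {K : ℝ} (hq : ∀ X, |q X| ≤ K)
    (hp : ∀ X, q (X + e) = q X) (hf : TB e f) : TB e (fun X => q X * f X) := by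
  intro j R ε hε
  have hK : 0 ≤ K := (abs_nonneg _).trans (hq 0)
  obtain ⟨A, hA, h⟩ := hf j R (ε / (K + 1)) (by positivity)
  refine ⟨A, hA, fun n hn n' hn' X hX i => ?_⟩
  have h1 := h n hn n' hn' X hX i
  simp only [per_zsmul hp]
  rw [← mul_sub, abs_mul]
  calc |q X| * _ ≤ (K + 1) * (ε / (K + 1)) :=
        mul_le_mul ((hq X).trans (by linarith)) h1 (abs_nonneg _) (by linarith)
    _ = ε := by field_simp

lemma OB.mul {E : Type*} [NormedAddCommGroup E] [NormedSpace ℝ E] {e : E} {q f : E → ℝ} {K : ℝ} (hq : ∀ X, |q X| ≤ K)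
    (hf : OB e f) : OB e (fun X => q X * f X) := by
  intro R
  obtain ⟨L, hL, h⟩ := hf R
  have hK : 0 ≤ K := (abs_nonneg _).trans (hq 0)
  refine ⟨K * L, by positivity, fun X hX i => ?_⟩
  rw [abs_mul]
  exact mul_le_mul (hq _) (h X hX i) (abs_nonneg _) hK

section
variable {N : ℕ} {a : Fin N → Fin N → (Fin N → ℝ) → ℝ → ℝ}
    {b : Fin N → (Fin N → ℝ) → ℝ → ℝ} {c : (Fin N → ℝ) → ℝ → ℝ}

lemma per_bounded {l : Fin N → ℝ} (hl : ∀ i, 0 < l i) {ψ : (Fin N → ℝ) → ℝ} (hψ : Continuous ψ)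
    (hp : PerSpaceFun l ψ) : ∃ K, ∀ x, |ψ x| ≤ K := by
  have h1 : ∀ (k : Fin N → ℤ) (s : Finset (Fin N)) x, ψ (x + ∑ i ∈ s, k i • Pi.single i (l i)) = ψ x := by
    intro k s
    induction s using Finset.induction_on with
    | empty => simp
    | insert i s hi ih =>
      intro x
      rw [Finset.sum_insert hi, ← add_assoc, ih]
      exact per_zsmul (hp i) (k i) x
  have hc : IsCompact (Set.Icc (0 : Fin N → ℝ) l) := isCompact_Icc
  obtain ⟨K, hK⟩ := hc.exists_bound_of_continuousOn hψ.continuousOn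
  refine ⟨K, fun x => ?_⟩
  rw [← h1 (fun i => - ⌊x i / l i⌋) Finset.univ x]
  have h2 : (x + ∑ i, (- ⌊x i / l i⌋) • (Pi.single i (l i) : Fin N → ℝ)) ∈ Set.Icc (0 : Fin N → ℝ) l := by
    have h3 : ∀ i, (x + ∑ i, (- ⌊x i / l i⌋) • (Pi.single i (l i) : Fin N → ℝ)) i = x i - ⌊x i / l i⌋ * l i := by
      intro i
      rw [Pi.add_apply, Finset.sum_apply, Finset.sum_eq_single i]
      · simp; ring
      · intro j _ hj; simp [hj.symm]
      · simp
    constructor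
    · intro i
      rw [h3, Pi.zero_apply]
      have := Int.floor_le (x i / l i)
      rw [le_div_iff₀ (hl i)] at this
      linarith
    · intro i
      rw [h3]
      have := (Int.lt_floor_add_one (x i / l i)).le
      rw [div_le_iff₀ (hl i)] at this
      linarith
  exact hK _ h2

lemma pd_mul {v w : (Fin N → ℝ) → ℝ} (hv : Differentiable ℝ v) (hw : Differentiable ℝ w) (i : Fin N)
    (x : Fin N → ℝ) : pd i (fun y => v y * w y) x = pd i v x * w x + v x * pd i w x := by
  unfold pd
  rw [fderiv_fun_mul (hv x) (hw x)]
  simp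
  ring

lemma pd_add {v w : (Fin N → ℝ) → ℝ} (hv : Differentiable ℝ v) (hw : Differentiable ℝ w) (i : Fin N)
    (x : Fin N → ℝ) : pd i (fun y => v y + w y) x = pd i v x + pd i w x := by
  unfold pd
  rw [fderiv_fun_add (hv x) (hw x)]; rfl

lemma pd2_mul {v w : (Fin N → ℝ) → ℝ} (hv : ContDiff ℝ 2 v) (hw : ContDiff ℝ 2 w) (i j : Fin N)
    (x : Fin N → ℝ) : pd2 i j (fun y => v y * w y) x =
      pd2 i j v x * w x + pd j v x * pd i w x + pd i v x * pd j w x + v x * pd2 i j w x := by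
  have hv1 := hv.differentiable (by norm_num)
  have hw1 := hw.differentiable (by norm_num)
  unfold pd2
  simp only [pd_mul hv1 hw1]
  rw [pd_add (v := fun y => pd j v y * w y) (w := fun y => v y * pd j w y) ((pd_diff hv j).mul hw1)
    (hv1.mul (pd_diff hw j)), pd_mul (pd_diff hv j) hw1,
    pd_mul hv1 (pd_diff hw j)]
  ring

lemma parOp_mul {φ : (Fin N → ℝ) → ℝ} {v : (Fin N → ℝ) → ℝ → ℝ} (hφ : ContDiff ℝ 2 φ) (hφ0 : ∀ x, 0 < φ x)
    (hv : RegSol v) (hs : ∀ i j x t, a i j x t = a j i x t) {lam : ℝ} (x : Fin N → ℝ) (t : ℝ)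
    (hL : -(ellOp (fun i j y => a i j y t) (fun i y => b i y t) (fun y => c y t) φ x) = lam * φ x) :
    parOp a b c (fun x t => φ x * v x t) x t = φ x * parOp a
      (fun i y s => b i y s + 2 * ∑ j, a i j y s * (pd j φ y / φ y)) (fun _ _ => -lam) v x t := by
  have hφ1 := hφ.differentiable (by norm_num)
  have hv1 := (hv.2.2 t).differentiable (by norm_num)
  have hx := (hφ0 x).ne'
  unfold parOp
  unfold ellOp at hL
  simp only [pd2_mul hφ (hv.2.2 t), pd_mul hφ1 hv1]
  rw [deriv_const_mul_field]
  have e1 : ∑ i, ∑ j, a i j x t * (pd2 i j φ x * v x t + pd j φ x * pd i (fun y => v y t) x +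
      pd i φ x * pd j (fun y => v y t) x + φ x * pd2 i j (fun y => v y t) x)
      = (∑ i, ∑ j, a i j x t * pd2 i j φ x) * v x t
        + 2 * (∑ i, ∑ j, a i j x t * pd j φ x * pd i (fun y => v y t) x)
        + φ x * ∑ i, ∑ j, a i j x t * pd2 i j (fun y => v y t) x := by
    have e2 : ∑ i, ∑ j, a i j x t * pd i φ x * pd j (fun y => v y t) x =
        ∑ i, ∑ j, a i j x t * pd j φ x * pd i (fun y => v y t) x := by
      rw [Finset.sum_comm]
      refine Finset.sum_congr rfl fun i _ => Finset.sum_congr rfl fun j _ => ?_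
      rw [hs]
    rw [two_mul]
    nth_rewrite 2 [← e2]
    simp only [Finset.sum_mul, Finset.mul_sum, ← Finset.sum_add_distrib]
    refine Finset.sum_congr rfl fun i _ => Finset.sum_congr rfl fun j _ => ?_
    ring
  have e3 : ∑ i, b i x t * (pd i φ x * v x t + φ x * pd i (fun y => v y t) x)
      = (∑ i, b i x t * pd i φ x) * v x t + φ x * ∑ i, b i x t * pd i (fun y => v y t) x := by
    simp only [Finset.sum_mul, Finset.mul_sum, ← Finset.sum_add_distrib]
    refine Finset.sum_congr rfl fun i _ => ?_
    ring
  have e4 : φ x * ∑ i, (b i x t + 2 * ∑ j, a i j x t * (pd j φ x / φ x)) * pd i (fun y => v y t) x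
      = φ x * (∑ i, b i x t * pd i (fun y => v y t) x)
        + 2 * (∑ i, ∑ j, a i j x t * pd j φ x * pd i (fun y => v y t) x) := by
    simp only [Finset.mul_sum, ← Finset.sum_add_distrib]
    refine Finset.sum_congr rfl fun i _ => ?_
    rw [add_mul, mul_add, Finset.sum_mul, Finset.mul_sum]
    congr 1
    · refine Finset.sum_congr rfl fun j _ => ?_
      field_simp
  rw [e1, e3]
  simp only [mul_sub]
  rw [e4]
  linear_combination (v x t) * hL

lemma case_b {f u : (Fin N → ℝ) → ℝ → ℝ} {m : Fin (N + 1)}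
    (hstd : StdCoeffs a b c) (hfuc : UC2 f) (hfap : APinVar m f)
    {l : Fin N → ℝ} {lam : ℝ} {φ : (Fin N → ℝ) → ℝ} (hl : ∀ i, 0 < l i)
    (ha : ∀ i j x t, a i j x t = a i j x 0) (hb : ∀ i x t, b i x t = b i x 0) (hc : ∀ x t, c x t = c x 0)
    (hap : ∀ i j, PerSpaceFun l fun x => a i j x 0) (hbp : ∀ i, PerSpaceFun l fun x => b i x 0)
    (hlam : 0 ≤ lam)
    (hφ : IsPerPrincipal (fun i j x => a i j x 0) (fun i x => b i x 0) (fun x => c x 0) l lam φ)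
    (hsol : IsSol a b c f u) (hbdd : Bdd2 u) : APinVar m u := by
  obtain ⟨d, hd1, -, hd3⟩ := direction m
  obtain ⟨l', hl', hper⟩ := hd3 l hl
  obtain ⟨hφ2, hφ0, hφp, hφL⟩ := hφ
  obtain ⟨h1, h2, h3, -, h4, -, h5, h6⟩ := hstd
  obtain ⟨a0, Λ, hCo⟩ := Co_of h1 h2 h3 h4 h5 h6
  have hφc : Continuous φ := hφ2.continuous
  have hφne : ∀ x, φ x ≠ 0 := fun x => (hφ0 x).ne'
  have hic : ContDiff ℝ 2 (fun x => (φ x)⁻¹) := hφ2.inv hφne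
  have hip : PerSpaceFun l (fun x => (φ x)⁻¹) := fun i x => by simp only [hφp i x]
  obtain ⟨K1, hK1⟩ := per_bounded hl hφc hφp
  obtain ⟨K2, hK2⟩ := per_bounded hl hic.continuous hip
  have hpdp : ∀ j, PerSpaceFun l (fun y => pd j φ y / φ y) := by
    intro j i x
    simp only [hφp i x]
    rw [← pd_shift φ j]
    congr 2
    ext y; exact hφp i y
  have hpdc : ∀ j, Continuous (fun y => pd j φ y / φ y) := fun j =>
    ((pd_diff hφ2 j).continuous).div hφc hφne
  choose D hD using fun j => per_bounded hl (hpdc j) (hpdp j)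
  set b' : Fin N → (Fin N → ℝ) → ℝ → ℝ :=
    fun i y s => b i y s + 2 * ∑ j, a i j y s * (pd j φ y / φ y) with hb'
  have hb'b : ∀ i, Bdd2 (b' i) := by
    intro i
    refine ⟨Λ + 2 * ∑ j, Λ * D j, fun x t => ?_⟩
    have hΛ := hCo.one
    have q : |∑ j, a i j x t * (pd j φ x / φ x)| ≤ ∑ j, Λ * D j := by
      refine (Finset.abs_sum_le_sum_abs _ _).trans (Finset.sum_le_sum fun j _ => ?_)
      rw [abs_mul]
      exact mul_le_mul (hCo.ab i j x t) (hD j x) (abs_nonneg _) (by linarith)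
    refine (abs_add_le _ _).trans (add_le_add (hCo.bb i x t) ?_)
    rw [abs_mul, abs_two]
    linarith
  obtain ⟨a0', Λ', hCo'⟩ := Co_of (c := fun (_ : Fin N → ℝ) (_ : ℝ) => -lam) h1 h2 hb'b
    ⟨|lam|, fun _ _ => by rw [abs_neg]⟩ h5 h6
  have hTa : ∀ i j, TInv (l' • d) (a i j) := fun i j x t => by
    have := hper _ (hap i j) x t
    rw [ha, ha i j x t]; exact this
  have hTb : ∀ i, TInv (l' • d) (b i) := fun i x t => by
    have := hper _ (hbp i) x t
    rw [hb, hb i x t]; exact this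
  have hTb' : ∀ i, TInv (l' • d) (b' i) := fun i x t => by
    have h7 := hTb i x t
    have h8 := fun j => hTa i j x t
    have h9 := fun j => hper _ (hpdp j) x t
    simp only at h9
    simp only [hb', h7, h8, h9]
  obtain ⟨M, hM⟩ := hbdd
  rw [hd1] at hfap ⊢
  have hS : Sol a b c (fun X => u X.1 X.2) (fun X => f X.1 X.2) := hsol
  have hOB := AP_OB (f := fun X : (Fin N → ℝ) × ℝ => f X.1 X.2) l' hfuc hfap
  have hTB := AP_TB (f := fun X : (Fin N → ℝ) × ℝ => f X.1 X.2) l' hfuc hfap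
  have hRv : RegSol (fun x t => (φ x)⁻¹ * u x t) :=
    ⟨(hic.continuous.comp continuous_fst).mul hsol.1.1, fun x => (hsol.1.2.1 x).const_mul _,
      fun t => hic.mul (hsol.1.2.2 t)⟩
  have hSv : Sol a b' (fun _ _ => -lam) (fun X => (φ X.1)⁻¹ * u X.1 X.2) (fun X => (φ X.1)⁻¹ * f X.1 X.2) := by
    refine ⟨hRv, fun x t => ?_⟩
    have h7 := parOp_mul (a := a) (b := b) (c := c) (lam := lam) hφ2 hφ0 hRv h5 x t (by
      rw [← hφL x]; simp only [ellOp, ha _ _ x t, hb _ x t, hc x t])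
    have h8 : (fun x t => φ x * ((φ x)⁻¹ * u x t)) = u := by
      ext x t; rw [mul_inv_cancel_left₀ (hφne x)]
    rw [h8, hsol.2] at h7
    simp only
    rw [h7, inv_mul_cancel_left₀ (hφne x)]
  have hKq : ∀ X : (Fin N → ℝ) × ℝ, |(φ X.1)⁻¹| ≤ K2 := fun X => hK2 X.1
  have hvM : ∀ X : (Fin N → ℝ) × ℝ, |(φ X.1)⁻¹ * u X.1 X.2| ≤ K2 * M := fun X => by
    rw [abs_mul]
    exact mul_le_mul (hKq X) (hM _ _) (abs_nonneg _) ((abs_nonneg _).trans (hKq X))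
  have hTv := TB_of_sol hCo' (fun _ _ => by linarith) hTa hTb' (fun _ _ => rfl) hSv hvM (hOB.mul hKq)
    (hTB.mul hKq (fun X => hper _ hip X.1 X.2))
  have hTu := hTv.mul (q := fun X : (Fin N → ℝ) × ℝ => φ X.1) (fun X => hK1 X.1) (fun X => hper _ hφp X.1 X.2)
  simp only [mul_inv_cancel_left₀ (hφne _)] at hTu
  exact final_AP (u := fun X : (Fin N → ℝ) × ℝ => u X.1 X.2) hl' hsol.1.1
    (EC_of_sol hCo hS (fun X => hM _ _) hOB) hTu
end

/-- **Theorem 4.2.**  Let `u` be a bounded solution of `P u = f`, with `f`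
uniformly continuous on `ℝ^{N+1}` and almost periodic in the `m`-th variable, and
with either (a) `P` periodic in the `m`-th variable and `c ≤ 0`, or (b)
`P = ∂ₜ − L`, `L` periodic and `λₚ(−L) ≥ 0`.  Then `u` is almost periodic in the
`m`-th variable. -/
theorem thm_ap_one_variable {N : ℕ}
    (a : Fin N → Fin N → (Fin N → ℝ) → ℝ → ℝ)
    (b : Fin N → (Fin N → ℝ) → ℝ → ℝ) (c : (Fin N → ℝ) → ℝ → ℝ)
    (f u : (Fin N → ℝ) → ℝ → ℝ) (m : Fin (N + 1)) (lm : ℝ)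
    (hlm : 0 < lm)
    (hstd : StdCoeffs a b c)
    (hfuc : UC2 f)
    (hfap : APinVar m f)
    (hcase :
      ((∀ i j, PerInVar m lm (a i j)) ∧ (∀ i, PerInVar m lm (b i)) ∧
        PerInVar m lm c ∧ ∀ x t, c x t ≤ 0) ∨
      (∃ (l : Fin N → ℝ) (lam : ℝ) (φp : (Fin N → ℝ) → ℝ),
        (∀ i, 0 < l i) ∧
        (∀ i j x t, a i j x t = a i j x 0) ∧
        (∀ i x t, b i x t = b i x 0) ∧
        (∀ x t, c x t = c x 0) ∧
        (∀ i j, PerSpaceFun l fun x => a i j x 0) ∧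
        (∀ i, PerSpaceFun l fun x => b i x 0) ∧
        (PerSpaceFun l fun x => c x 0) ∧
        0 ≤ lam ∧
        IsPerPrincipal (fun i j x => a i j x 0) (fun i x => b i x 0)
          (fun x => c x 0) l lam φp))
    (hsol : IsSol a b c f u)
    (hbdd : Bdd2 u) :
    APinVar m u := by
  rcases hcase with ⟨ha, hb, hc, hc0⟩ | ⟨l, lam, φp, hl, ha, hb, hc, hap, hbp, -, hlam, hφ⟩
  · exact case_a hlm hstd hfuc hfap ha hb hc hc0 hsol hbdd
  · exact case_b hstd hfuc hfap hl ha hb hc hap hbp hlam hφ hsol hbdd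
end
end

section
/- Let L be an elliptic operator on ℝ^N (no periodicity assumed) with c ≤ 0, and let u be an almost periodic solution of Lu = 0 in ℝ^N. Then u is constant; moreover, if c ≢ 0 then u ≡ 0. In particular, the space of almost periodic solutions of Lu = 0 with c ≤ 0 has dimension at most one. -/
open Filter Topology

noncomputable section

/-- Standing assumptions on the coefficients of `L`: `A` bounded and uniformly
continuous, `B`, `C` bounded and measurable, `(Aᵢⱼ)` symmetric and uniformly
elliptic. -/
def StdEllCoeffs {N : ℕ} (A : Fin N → Fin N → (Fin N → ℝ) → ℝ)
    (B : Fin N → (Fin N → ℝ) → ℝ) (C : (Fin N → ℝ) → ℝ) : Prop :=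
  (∀ i j, ∃ M : ℝ, ∀ x, |A i j x| ≤ M) ∧ (∀ i j, UniformContinuous (A i j)) ∧
  (∀ i, ∃ M : ℝ, ∀ x, |B i x| ≤ M) ∧ (∀ i, Measurable (B i)) ∧
  (∃ M : ℝ, ∀ x, |C x| ≤ M) ∧ Measurable C ∧
  (∀ i j x, A i j x = A j i x) ∧
  (∃ a₀ a₁ : ℝ, 0 < a₀ ∧ a₀ ≤ a₁ ∧ ∀ (x ξ : Fin N → ℝ),
    a₀ * ∑ i, ξ i ^ 2 ≤ ∑ i, ∑ j, A i j x * ξ i * ξ j ∧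
    ∑ i, ∑ j, A i j x * ξ i * ξ j ≤ a₁ * ∑ i, ξ i ^ 2)

/-- A continuous function on `ℝ^N` is almost periodic (Bochner's
characterization): from every sequence of translations one can extract a
subsequence along which the translates converge uniformly on `ℝ^N`. -/
def APn {N : ℕ} (φ : (Fin N → ℝ) → ℝ) : Prop :=
  Continuous φ ∧ ∀ S : ℕ → (Fin N → ℝ), ∃ k : ℕ → ℕ, StrictMono k ∧
    ∃ ψ : (Fin N → ℝ) → ℝ, TendstoUniformly (fun n x => φ (x + S (k n))) ψ atTop

/-- Squared Euclidean norm. -/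
def qn {N : ℕ} (x : Fin N → ℝ) : ℝ := ∑ i, x i ^ 2

lemma qn_cont {N : ℕ} (p : Fin N → ℝ) : Continuous (fun x : Fin N → ℝ => qn (x - p)) := by
  unfold qn
  simp only [Pi.sub_apply]
  fun_prop

lemma qn_compact {N : ℕ} (p : Fin N → ℝ) (c : ℝ) : IsCompact {x : Fin N → ℝ | qn (x - p) ≤ c} := by
  refine Metric.isCompact_of_isClosed_isBounded
    (isClosed_le (qn_cont p) continuous_const) ?_
  refine (Metric.isBounded_closedBall (x := p) (r := c + 1)).subset ?_
  intro x hx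
  have hx' : ∑ i, (x - p) i ^ 2 ≤ c := hx
  have h0 : 0 ≤ ∑ i, (x - p) i ^ 2 := Finset.sum_nonneg fun i _ => sq_nonneg _
  rw [Metric.mem_closedBall, dist_pi_le_iff (by linarith)]
  intro i
  have h1 : (x - p) i ^ 2 ≤ ∑ i, (x - p) i ^ 2 :=
    Finset.single_le_sum (f := fun i => (x - p) i ^ 2) (fun i _ => sq_nonneg _) (Finset.mem_univ i)
  rw [Real.dist_eq]
  simp only [Pi.sub_apply] at h1 hx'
  rw [abs_le]
  constructor <;> nlinarith [sq_nonneg (x i - p i + 1), sq_nonneg (x i - p i - 1)]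

lemma qn_pos {N : ℕ} (x : Fin N → ℝ) (h : x ≠ 0) : 0 < qn x := by
  obtain ⟨i, hi⟩ := Function.ne_iff.mp h
  have h1 : x i ^ 2 ≤ qn x :=
    Finset.single_le_sum (f := fun i => x i ^ 2) (fun i _ => sq_nonneg _) (Finset.mem_univ i)
  have : 0 < x i ^ 2 := by
    have : x i ≠ 0 := hi
    positivity
  linarith

lemma pd_diff_s15 {N : ℕ} (w : (Fin N → ℝ) → ℝ) (hw : ContDiff ℝ 2 w) (j : Fin N) :
    Differentiable ℝ (pd j w) := by
  have h : ContDiff ℝ 1 (fderiv ℝ w) := hw.fderiv_right (by norm_num)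
  have h2 : ContDiff ℝ 1 (fun x => fderiv ℝ w x (Pi.single j 1)) := h.clm_apply contDiff_const
  exact h2.differentiable (by norm_num)

lemma clm_expand {N : ℕ} (f : (Fin N → ℝ) →L[ℝ] ℝ) (v : Fin N → ℝ) :
    f v = ∑ i, v i * f (Pi.single i 1) := by
  conv_lhs => rw [pi_eq_sum_univ' v]
  rw [map_sum]
  refine Finset.sum_congr rfl fun i _ => ?_
  rw [map_smul, smul_eq_mul]

/-- One dimensional second derivative test. -/
lemma second_deriv_test (g g1 : ℝ → ℝ) (d : ℝ) (h1 : ∀ t, HasDerivAt g (g1 t) t)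
    (h2 : HasDerivAt g1 d 0) (hmax : IsLocalMax g 0) : d ≤ 0 := by
  by_contra hd
  push Not at hd
  have e : deriv g = g1 := funext fun t => (h1 t).deriv
  have hmin : IsLocalMin g 0 := by
    apply isLocalMin_of_deriv_deriv_pos
    · rw [e, h2.deriv]; exact hd
    · exact hmax.deriv_eq_zero
    · exact (h1 0).continuousAt
  have hc : g =ᶠ[𝓝 0] fun _ => g 0 := by
    filter_upwards [hmax, hmin] with t a b using le_antisymm a b
  have h3 : deriv g =ᶠ[𝓝 0] fun _ => 0 := by
    have := hc.deriv
    simpa using this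
  have h4 := h3.deriv_eq
  rw [e, h2.deriv] at h4
  simp at h4
  linarith

lemma hess_nonpos {N : ℕ} (w : (Fin N → ℝ) → ℝ) (hw : ContDiff ℝ 2 w) (z : Fin N → ℝ)
    (hz : IsLocalMax w z) (v : Fin N → ℝ) :
    ∑ i, ∑ j, v i * v j * pd2 i j w z ≤ 0 := by
  have hl : ∀ t : ℝ, HasDerivAt (fun t : ℝ => z + t • v) v t := by
    intro t
    simpa using ((hasDerivAt_id t).smul_const v).const_add z
  have hwd : Differentiable ℝ w := hw.differentiable (by norm_num)
  refine second_deriv_test (fun t => w (z + t • v)) (fun t => ∑ j, v j * pd j w (z + t • v)) _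
    ?_ ?_ ?_
  · intro t
    have := (hwd (z + t • v)).hasFDerivAt.comp_hasDerivAt t (hl t)
    rw [clm_expand] at this
    exact this
  · have : ∀ j ∈ Finset.univ, HasDerivAt (fun t : ℝ => v j * pd j w (z + t • v))
        (v j * ∑ i, v i * pd2 i j w z) 0 := by
      intro j _
      have hh : HasFDerivAt (pd j w) (fderiv ℝ (pd j w) z) (z + (0:ℝ) • v) := by
        simpa using (pd_diff_s15 w hw j z).hasFDerivAt
      have := (hh.comp_hasDerivAt 0 (hl 0)).const_mul (v j)
      rw [clm_expand] at this
      exact this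
    have h := HasDerivAt.fun_sum this
    refine h.congr_deriv ?_
    symm
    rw [Finset.sum_comm]
    refine Finset.sum_congr rfl fun j _ => ?_
    rw [Finset.mul_sum]
    refine Finset.sum_congr rfl fun i _ => ?_
    ring
  · have hc : ContinuousAt (fun t : ℝ => z + t • v) 0 := (hl 0).continuousAt
    have ht : Tendsto (fun t : ℝ => z + t • v) (𝓝 0) (𝓝 z) := by
      have := hc.tendsto
      simpa using this
    have := ht.eventually hz
    filter_upwards [this] with t h
    simpa using h

lemma trace_nonpos {N : ℕ} (A : Matrix (Fin N) (Fin N) ℝ) (hA : A.PosSemidef)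
    (H : Fin N → Fin N → ℝ) (hH : ∀ v : Fin N → ℝ, ∑ i, ∑ j, v i * v j * H i j ≤ 0) :
    ∑ i, ∑ j, A i j * H i j ≤ 0 := by
  open scoped MatrixOrder Matrix.Norms.L2Operator in
  obtain ⟨Q, rfl⟩ := CStarAlgebra.nonneg_iff_eq_star_mul_self.mp hA.nonneg
  have : ∑ i, ∑ j, (star Q * Q) i j * H i j = ∑ k, ∑ i, ∑ j, Q k i * Q k j * H i j := by
    simp only [Matrix.mul_apply, Matrix.star_apply, star_trivial, Finset.sum_mul]
    rw [Finset.sum_comm (s := Finset.univ (α := Fin N)) (f := fun k i => ∑ j, Q k i * Q k j * H i j)]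
    exact Finset.sum_congr rfl fun i _ => Finset.sum_comm
  rw [this]
  exact Finset.sum_nonpos fun k _ => hH (Q k)

lemma max_op_nonpos {N : ℕ} (A : Fin N → Fin N → (Fin N → ℝ) → ℝ)
    (B : Fin N → (Fin N → ℝ) → ℝ) (C : (Fin N → ℝ) → ℝ)
    (hstd : StdEllCoeffs A B C) (hc : ∀ x, C x ≤ 0)
    (w : (Fin N → ℝ) → ℝ) (hw : ContDiff ℝ 2 w) (z : Fin N → ℝ)
    (hz : IsLocalMax w z) (hp : 0 ≤ w z) : ellOp A B C w z ≤ 0 := by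
  obtain ⟨-, -, -, -, -, -, hsym, a0, a1, ha0, -, hell⟩ := hstd
  have h1 : ∑ i, ∑ j, A i j z * pd2 i j w z ≤ 0 := by
    refine trace_nonpos (Matrix.of fun i j => A i j z) ?_ _ (hess_nonpos w hw z hz)
    refine Matrix.PosSemidef.of_dotProduct_mulVec_nonneg ?_ ?_
    · ext i j
      simp [hsym j i z]
    · intro v
      have h := (hell z v).1
      have h0 : 0 ≤ a0 * ∑ i, v i ^ 2 :=
        mul_nonneg ha0.le (Finset.sum_nonneg fun i _ => sq_nonneg _)
      have e : star v ⬝ᵥ (Matrix.of fun i j => A i j z).mulVec v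
          = ∑ i, ∑ j, A i j z * v i * v j := by
        simp only [dotProduct, Matrix.mulVec, Finset.mul_sum, Matrix.of_apply, star_trivial]
        refine Finset.sum_congr rfl fun i _ => Finset.sum_congr rfl fun j _ => ?_
        ring
      rw [e]
      linarith
  have h2 : ∀ i, pd i w z = 0 := by
    intro i
    simp [pd, hz.fderiv_eq_zero]
  unfold ellOp
  simp only [h2, mul_zero, Finset.sum_const_zero]
  nlinarith [hc z]

/-- The barrier. -/
def bar {N : ℕ} (α : ℝ) (p : Fin N → ℝ) (x : Fin N → ℝ) : ℝ := Real.exp (-α * qn (x - p))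

lemma bar_contDiff {N : ℕ} (α : ℝ) (p : Fin N → ℝ) : ContDiff ℝ 2 (bar α p) := by
  unfold bar qn
  simp only [Pi.sub_apply]
  fun_prop

lemma bar_line {N : ℕ} (α : ℝ) (p x : Fin N → ℝ) (i : Fin N) :
    pd i (bar α p) x = -2 * α * (x i - p i) * bar α p x := by
  have hd : HasFDerivAt (bar α p) (bar α p x • (-α • ∑ k, ((2 * (x k - p k)) •
      (ContinuousLinearMap.proj k : (Fin N → ℝ) →L[ℝ] ℝ)))) x := by
    unfold bar
    refine HasFDerivAt.exp ?_
    refine HasFDerivAt.const_mul ?_ _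
    unfold qn
    refine HasFDerivAt.fun_sum fun k _ => ?_
    have h : HasFDerivAt (fun x : Fin N → ℝ => (x - p) k) 
        (ContinuousLinearMap.proj k : (Fin N → ℝ) →L[ℝ] ℝ) x := by
      simpa using ((ContinuousLinearMap.proj k : (Fin N → ℝ) →L[ℝ] ℝ).hasFDerivAt (x := x)).sub_const (p k)
    simpa using h.pow 2
  unfold pd
  rw [hd.fderiv]
  simp [Pi.single_apply]
  ring

lemma bar_pd2 {N : ℕ} (α : ℝ) (p x : Fin N → ℝ) (i j : Fin N) :
    pd2 i j (bar α p) x = (4 * α ^ 2 * (x i - p i) * (x j - p j)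
      - (if i = j then 2 * α else 0)) * bar α p x := by
  unfold pd2
  have e : (fun y => pd j (bar α p) y) = fun y => (-2 * α * (y j - p j)) * bar α p y :=
    funext fun y => bar_line α p y j
  rw [e]
  have hb := ((bar_contDiff α p).differentiable (by norm_num) x).hasFDerivAt
  have h : HasFDerivAt (fun y : Fin N → ℝ => -2 * α * (y j - p j)) 
      ((-2 * α) • (ContinuousLinearMap.proj j : (Fin N → ℝ) →L[ℝ] ℝ)) x := 
    (((ContinuousLinearMap.proj j : (Fin N → ℝ) →L[ℝ] ℝ).hasFDerivAt (x := x)).sub_const (p j)).const_mul _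
  have hm := h.mul hb
  have hl := bar_line α p x i
  unfold pd at hl ⊢
  erw [hm.fderiv]
  simp only [add_apply, smul_apply, hl, smul_eq_mul,
    ContinuousLinearMap.proj_apply, Pi.single_apply]
  by_cases hij : i = j
  · subst hij; simp; ring
  · simp [hij, Ne.symm hij]; ring

lemma ellOp_bar {N : ℕ} (A : Fin N → Fin N → (Fin N → ℝ) → ℝ)
    (B : Fin N → (Fin N → ℝ) → ℝ) (C : (Fin N → ℝ) → ℝ) (α : ℝ) (p x : Fin N → ℝ) :
    ellOp A B C (bar α p) x = (4 * α ^ 2 * (∑ i, ∑ j, A i j x * (x - p) i * (x - p) j)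
      - 2 * α * ∑ i, A i i x - 2 * α * (∑ i, B i x * (x - p) i) + C x) * bar α p x := by
  unfold ellOp
  simp only [bar_line, bar_pd2]
  have e1 : ∑ i, ∑ j, A i j x * ((4 * α ^ 2 * (x i - p i) * (x j - p j)
      - (if i = j then 2 * α else 0)) * bar α p x) =
      (4 * α ^ 2 * (∑ i, ∑ j, A i j x * (x - p) i * (x - p) j)
      - 2 * α * ∑ i, A i i x) * bar α p x := by
    rw [sub_mul, Finset.mul_sum, Finset.mul_sum, Finset.sum_mul, Finset.sum_mul,
      ← Finset.sum_sub_distrib]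
    refine Finset.sum_congr rfl fun i _ => ?_
    have : 2 * α * A i i x * bar α p x
        = ∑ j, if i = j then 2 * α * A i j x * bar α p x else 0 := by simp
    rw [this, Finset.mul_sum, Finset.sum_mul, ← Finset.sum_sub_distrib]
    refine Finset.sum_congr rfl fun j _ => ?_
    simp only [Pi.sub_apply]
    split_ifs <;> ring
  have e2 : ∑ i, B i x * (-2 * α * (x i - p i) * bar α p x)
      = - (2 * α * (∑ i, B i x * (x - p) i)) * bar α p x := by
    rw [Finset.mul_sum, ← Finset.sum_neg_distrib, Finset.sum_mul]
    refine Finset.sum_congr rfl fun i _ => ?_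
    simp only [Pi.sub_apply]
    ring
  rw [e1, e2]
  ring

lemma ellOp_comb {N : ℕ} (A : Fin N → Fin N → (Fin N → ℝ) → ℝ)
    (B : Fin N → (Fin N → ℝ) → ℝ) (C : (Fin N → ℝ) → ℝ) (f g : (Fin N → ℝ) → ℝ)
    (hf : ContDiff ℝ 2 f) (hg : ContDiff ℝ 2 g) (a b d : ℝ) (x : Fin N → ℝ) :
    ellOp A B C (fun y => a * f y + b * g y + d) x
      = a * ellOp A B C f x + b * ellOp A B C g x + C x * d := by
  have h1 : ∀ i y, pd i (fun y => a * f y + b * g y + d) y = a * pd i f y + b * pd i g y := by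
    intro i y
    have hf' := (hf.differentiable (by norm_num) y).hasFDerivAt
    have hg' := (hg.differentiable (by norm_num) y).hasFDerivAt
    unfold pd
    rw [(((hf'.const_mul a).fun_add (hg'.const_mul b)).add_const d).fderiv]
    simp
  have h2 : ∀ i j y, pd2 i j (fun y => a * f y + b * g y + d) y
      = a * pd2 i j f y + b * pd2 i j g y := by
    intro i j y
    unfold pd2
    have e : (fun z => pd j (fun y => a * f y + b * g y + d) z)
      = fun z => a * pd j f z + b * pd j g z := funext fun z => h1 j z
    rw [e]
    have hf' := (pd_diff_s15 f hf j y).hasFDerivAt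
    have hg' := (pd_diff_s15 g hg j y).hasFDerivAt
    conv_lhs => unfold pd
    erw [((hf'.const_mul a).add (hg'.const_mul b)).fderiv]
    simp only [add_apply, smul_apply, smul_eq_mul]
    rfl
  unfold ellOp
  simp only [h1, h2, mul_add, Finset.sum_add_distrib, Finset.mul_sum]
  simp only [mul_left_comm _ a, mul_left_comm _ b]
  ring

lemma key {N : ℕ} (A : Fin N → Fin N → (Fin N → ℝ) → ℝ)
    (B : Fin N → (Fin N → ℝ) → ℝ) (C : (Fin N → ℝ) → ℝ)
    (hstd : StdEllCoeffs A B C) (hc : ∀ x, C x ≤ 0) (s : ℝ) (hs : 0 < s) :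
    ∃ α : ℝ, 0 < α ∧ ∀ p x : Fin N → ℝ, s / 4 ≤ qn (x - p) → qn (x - p) ≤ 4 * s →
      0 < ellOp A B C (bar α p) x := by
  obtain ⟨hA, -, hB, -, ⟨Mc, hC⟩, -, hsym, a0, a1, ha0, -, hell⟩ := hstd
  choose MA hA using hA
  choose MB hB using hB
  set K := |∑ i, MA i i| + |∑ i, MB i * (4 * s + 1)| with hK
  have hK0 : 0 ≤ K := by positivity
  have hMc : 0 ≤ Mc := (abs_nonneg _).trans (hC 0)
  refine ⟨(2 * K + Mc + 1) / (a0 * s) + 1, by positivity, ?_⟩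
  intro p x hx1 hx2
  set α := (2 * K + Mc + 1) / (a0 * s) + 1 with hα
  have hα1 : 1 ≤ α := by
    have : 0 ≤ (2 * K + Mc + 1) / (a0 * s) := by positivity
    linarith
  have hα2 : 2 * K + Mc + 1 ≤ α * (a0 * s) := by
    rw [hα, add_mul, div_mul_cancel₀ _ (by positivity)]
    nlinarith [mul_pos ha0 hs]
  rw [ellOp_bar]
  refine mul_pos ?_ (Real.exp_pos _)
  have h1 : a0 * (s / 4) ≤ ∑ i, ∑ j, A i j x * (x - p) i * (x - p) j :=
    (mul_le_mul_of_nonneg_left hx1 ha0.le).trans (hell x (x - p)).1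
  have h2 : ∑ i, A i i x ≤ |∑ i, MA i i| :=
    (Finset.sum_le_sum fun i _ => (le_abs_self _).trans (hA i i x)).trans (le_abs_self _)
  have h3 : ∑ i, B i x * (x - p) i ≤ |∑ i, MB i * (4 * s + 1)| := by
    refine (Finset.sum_le_sum fun i _ => ?_).trans (le_abs_self _)
    have h4 : (x - p) i ^ 2 ≤ qn (x - p) :=
      Finset.single_le_sum (f := fun i => (x - p) i ^ 2) (fun i _ => sq_nonneg _)
        (Finset.mem_univ i)
    have h5 : |(x - p) i| ≤ 4 * s + 1 := by
      have := sq_abs ((x - p) i)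
      nlinarith [sq_nonneg (|(x - p) i| - 1), abs_nonneg ((x - p) i)]
    calc B i x * (x - p) i ≤ |B i x * (x - p) i| := le_abs_self _
      _ = |B i x| * |(x - p) i| := abs_mul _ _
      _ ≤ MB i * (4 * s + 1) := by
        have := hB i x
        have := abs_nonneg (B i x)
        gcongr
        linarith
  have h6 : -Mc ≤ C x := (abs_le.mp (hC x)).1
  have h7 : 4 * α ^ 2 * (a0 * (s / 4)) ≤
      4 * α ^ 2 * ∑ i, ∑ j, A i j x * (x - p) i * (x - p) j := by gcongr
  have h8 : 2 * α * (∑ i, A i i x) + 2 * α * (∑ i, B i x * (x - p) i) ≤ 2 * α * K := by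
    rw [← mul_add]
    have : 0 ≤ 2 * α := by linarith
    gcongr
    linarith
  have h9 : 4 * α ^ 2 * (a0 * (s / 4)) = α * (α * (a0 * s)) := by ring
  have h10 : α * (2 * K + Mc + 1) ≤ α * (α * (a0 * s)) := by gcongr
  nlinarith

lemma ap_bdd {N : ℕ} (u : (Fin N → ℝ) → ℝ) (hap : APn u) : BddAbove (Set.range u) := by
  by_contra h
  rw [not_bddAbove_iff] at h
  have h' : ∀ n : ℕ, ∃ x, (n : ℝ) < u x := by
    intro n
    obtain ⟨_, ⟨x, rfl⟩, hx⟩ := h n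
    exact ⟨x, hx⟩
  choose S hS using h'
  obtain ⟨k, hk, ψ, hψ⟩ := hap.2 S
  have h1 := hψ.tendsto_at 0
  have h2 : Tendsto (fun n => u (0 + S (k n))) atTop atTop := by
    refine tendsto_atTop_mono (f := fun n => ((k n : ℕ) : ℝ)) (fun n => ?_)
      (tendsto_natCast_atTop_atTop.comp hk.tendsto_atTop)
    rw [zero_add]
    exact (hS _).le
  exact not_tendsto_nhds_of_tendsto_atTop h2 _ h1

lemma main_pos {N : ℕ} (A : Fin N → Fin N → (Fin N → ℝ) → ℝ)
    (B : Fin N → (Fin N → ℝ) → ℝ) (C : (Fin N → ℝ) → ℝ)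
    (u : (Fin N → ℝ) → ℝ)
    (hstd : StdEllCoeffs A B C)
    (hc : ∀ x, C x ≤ 0)
    (hreg : ContDiff ℝ 2 u)
    (hsol : ∀ x, ellOp A B C u x = 0)
    (hap : APn u) (hpos : ∃ x, 0 < u x) : ∃ k : ℝ, ∀ x, u x = k := by
  have hbdd := ap_bdd u hap
  set M := sSup (Set.range u) with hM
  have huM : ∀ x, u x ≤ M := fun x => le_csSup hbdd ⟨x, rfl⟩
  have hM0 : 0 < M := by
    obtain ⟨x, hx⟩ := hpos
    exact hx.trans_le (huM x)
  have hex : ∀ n : ℕ, ∃ x, M - 1 / ((n : ℝ) + 1) < u x := by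
    intro n
    have : 0 < 1 / ((n : ℝ) + 1) := by positivity
    obtain ⟨_, ⟨x, rfl⟩, hx⟩ := exists_lt_of_lt_csSup (Set.range_nonempty u)
      (show M - 1 / ((n : ℝ) + 1) < sSup (Set.range u) by linarith)
    exact ⟨x, hx⟩
  choose S hS using hex
  obtain ⟨k, hk, ψ, hψ⟩ := hap.2 S
  have hψc : Continuous ψ := by
    refine hψ.continuous (Frequently.of_forall fun n => ?_)
    exact hap.1.comp (by fun_prop)
  have hψM : ∀ x, ψ x ≤ M := fun x =>
    le_of_tendsto' (hψ.tendsto_at x) fun n => huM _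
  have hψ0 : ψ 0 = M := by
    refine tendsto_nhds_unique (hψ.tendsto_at 0) ?_
    have ht : Tendsto (fun n => M - 1 / (((k n : ℕ) : ℝ) + 1)) atTop (𝓝 M) := by
      have := (tendsto_one_div_add_atTop_nhds_zero_nat (𝕜 := ℝ)).comp hk.tendsto_atTop
      simpa using this.const_sub M
    refine tendsto_of_tendsto_of_tendsto_of_le_of_le ht tendsto_const_nhds ?_ ?_
    · intro n
      simp only [zero_add]
      exact (hS _).le
    · intro n
      exact huM _
  have happrox : ∀ τ > 0, ∃ T : Fin N → ℝ, ∀ x, |u x - ψ (x - T)| < τ := by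
    intro τ hτ
    obtain ⟨n, hn⟩ := (Metric.tendstoUniformly_iff.mp hψ τ hτ).exists
    refine ⟨S (k n), fun x => ?_⟩
    have := hn (x - S (k n))
    rw [dist_comm, Real.dist_eq, sub_add_cancel] at this
    exact this
  have hall : ∀ y, ψ y = M := by
    by_contra hne
    push Not at hne
    obtain ⟨y, hy⟩ := hne
    -- nearest point of the contact set
    have hFc : IsClosed {x | ψ x = M} := isClosed_eq hψc continuous_const
    obtain ⟨x0, ⟨hx0F, hx0K⟩, hx0⟩ :=
      (((qn_compact y (qn (0 - y))).inter_left hFc)).exists_isMinOn ⟨0, hψ0, le_refl (qn (0 - y))⟩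
        (qn_cont y).continuousOn
    have hx0F' : ψ x0 = M := hx0F
    have hx0K' : qn (x0 - y) ≤ qn (0 - y) := hx0K
    set s := qn (x0 - y) with hsdef
    have hs : 0 < s := by
      refine qn_pos _ ?_
      intro h
      rw [sub_eq_zero] at h
      exact hy (h ▸ hx0F')
    have hnear : ∀ x, qn (x - y) < s → ψ x < M := by
      intro x hx
      refine lt_of_le_of_ne (hψM x) fun h => ?_
      have : s ≤ qn (x - y) := hx0 ⟨h, hx.le.trans hx0K'⟩
      linarith
    obtain ⟨η, hη, hin⟩ : ∃ η > 0, ∀ x, qn (x - y) ≤ s / 4 → ψ x ≤ M - η := by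
      obtain ⟨x1, hx1, hm⟩ := (qn_compact y (s / 4)).exists_isMaxOn
        ⟨y, by simp [qn]; positivity⟩ hψc.continuousOn
      have hx1' : qn (x1 - y) ≤ s / 4 := hx1
      refine ⟨M - ψ x1, by linarith [hnear x1 (by linarith)], fun x hx => ?_⟩
      have : ψ x ≤ ψ x1 := hm hx
      linarith
    obtain ⟨α, hα, hbar⟩ := key A B C hstd hc s hs
    set ε := η / 2 with hε
    have hε0 : 0 < ε := by positivity
    set δ := Real.exp (-α * s) - Real.exp (-α * (4 * s)) with hδ
    have hδ0 : 0 < δ := by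
      rw [hδ, sub_pos]
      apply Real.exp_lt_exp.mpr
      nlinarith [mul_pos hα hs]
    have hτex : ∃ τ > 0, 3 * τ ≤ ε ∧ 3 * τ ≤ ε * δ ∧ 3 * τ ≤ M := by
      refine ⟨min ε (min (ε * δ) M) / 3, by positivity, ?_, ?_, ?_⟩
      · linarith [min_le_left ε (min (ε * δ) M)]
      · linarith [min_le_right ε (min (ε * δ) M), min_le_left (ε * δ) M]
      · linarith [min_le_right ε (min (ε * δ) M), min_le_right (ε * δ) M]
    obtain ⟨τ, hτ, hτ1, hτ2, hτ3⟩ := hτex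
    obtain ⟨T, hT⟩ := happrox τ hτ
    set w : (Fin N → ℝ) → ℝ := fun x => 1 * u x + ε * bar α (y + T) x
      + (- ε * Real.exp (-α * s)) with hw
    have hwC : ContDiff ℝ 2 w := by
      have := bar_contDiff α (y + T)
      rw [hw]
      fun_prop
    have hsub : ∀ x, x - (y + T) = (x - T) - y := fun x => by abel
    obtain ⟨z, hzK, hzmax⟩ := (qn_compact (y + T) (4 * s)).exists_isMaxOn
      ⟨x0 + T, by
        show qn (x0 + T - (y + T)) ≤ 4 * s
        rw [add_sub_add_right_eq_sub]; linarith⟩ hwC.continuous.continuousOn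
    have hzK' : qn (z - (y + T)) ≤ 4 * s := hzK
    have hwz : M - τ < w z := by
      have h1 : w (x0 + T) ≤ w z := hzmax (by
        show qn (x0 + T - (y + T)) ≤ 4 * s
        rw [add_sub_add_right_eq_sub]; linarith)
      have h2 : w (x0 + T) = u (x0 + T) := by
        simp only [hw, bar, add_sub_add_right_eq_sub, ← hsdef]
        ring
      have h3 := abs_lt.mp (hT (x0 + T))
      rw [add_sub_cancel_right, hx0F'] at h3
      linarith [h3.1]
    have huz := (abs_lt.mp (hT z)).2
    have hwz' : w z = u z + ε * (bar α (y + T) z - Real.exp (-α * s)) := by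
      simp only [hw]; ring
    have hlow : s / 4 < qn (z - (y + T)) := by
      by_contra h
      push Not at h
      have h1 := hin (z - T) (by rw [← hsub]; exact h)
      have h2 : bar α (y + T) z ≤ 1 := by
        unfold bar
        rw [Real.exp_le_one_iff]
        have : 0 ≤ qn (z - (y + T)) := Finset.sum_nonneg fun i _ => sq_nonneg _
        nlinarith
      have h3 : ε * (bar α (y + T) z - Real.exp (-α * s)) ≤ ε * 1 := by
        gcongr
        linarith [Real.exp_pos (-α * s)]
      linarith
    have hup : qn (z - (y + T)) < 4 * s := by
      refine lt_of_le_of_ne hzK' fun h => ?_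
      have h1 : ε * (bar α (y + T) z - Real.exp (-α * s)) = - (ε * δ) := by
        unfold bar
        rw [h, hδ]; ring
      linarith [hψM (z - T)]
    have hloc : IsLocalMax w z := by
      refine hzmax.isLocalMax ?_
      refine mem_of_superset ((isOpen_lt (qn_cont (y + T)) continuous_const).mem_nhds hup) ?_
      intro x hx
      exact (show qn (x - (y + T)) < 4 * s from hx).le
    have hle := max_op_nonpos A B C hstd hc w hwC z hloc (by linarith)
    rw [hw, ellOp_comb A B C u _ hreg (bar_contDiff α (y + T)), hsol] at hle
    have hb := mul_pos hε0 (hbar (y + T) z hlow.le hup.le)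
    have hcc : 0 ≤ C z * (-ε * Real.exp (-α * s)) := by
      have : 0 < ε * Real.exp (-α * s) := mul_pos hε0 (Real.exp_pos _)
      nlinarith [hc z]
    linarith
  refine ⟨M, fun x => ?_⟩
  by_contra hne
  obtain ⟨T, hT⟩ := happrox |u x - M| (abs_pos.mpr (sub_ne_zero.mpr hne))
  have := hT x
  rw [hall] at this
  exact lt_irrefl _ this

/-- **Remark 3.6.**  Let `L` be an elliptic operator on `ℝ^N` (no periodicity
assumed) with `c ≤ 0`, and let `u` be a bounded-free almost periodic solution of
`L u = 0` in `ℝ^N`.  Then `u` is constant; moreover, if `c ≢ 0` then `u ≡ 0`. -/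
theorem liouville_almost_periodic_elliptic {N : ℕ}
    (A : Fin N → Fin N → (Fin N → ℝ) → ℝ)
    (B : Fin N → (Fin N → ℝ) → ℝ) (C : (Fin N → ℝ) → ℝ)
    (u : (Fin N → ℝ) → ℝ)
    (hstd : StdEllCoeffs A B C)
    (hc : ∀ x, C x ≤ 0)
    (hreg : ContDiff ℝ 2 u)
    (hsol : ∀ x, ellOp A B C u x = 0)
    (hap : APn u) :
    (∃ k : ℝ, ∀ x, u x = k) ∧ ((¬ ∀ x, C x = 0) → ∀ x, u x = 0) := by
  have hconst : ∃ k : ℝ, ∀ x, u x = k := by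
    by_cases h1 : ∃ x, 0 < u x
    · exact main_pos A B C u hstd hc hreg hsol hap h1
    by_cases h2 : ∃ x, u x < 0
    · have hneg : (fun y => (-1) * u y + 0 * u y + 0) = fun y => -u y := by
        funext y; ring
      obtain ⟨k, hk⟩ := main_pos A B C (fun y => -u y) hstd hc hreg.neg
        (fun x => by
          rw [← hneg, ellOp_comb A B C u u hreg hreg, hsol]; ring)
        (by
          refine ⟨hap.1.neg, fun S => ?_⟩
          obtain ⟨k, hk, ψ, hψ⟩ := hap.2 S
          refine ⟨k, hk, fun x => -ψ x, ?_⟩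
          rw [Metric.tendstoUniformly_iff] at hψ ⊢
          intro ε hε
          filter_upwards [hψ ε hε] with n hn x
          rw [dist_neg_neg]
          exact hn x)
        (by
          obtain ⟨x, hx⟩ := h2
          exact ⟨x, by linarith⟩)
      exact ⟨-k, fun x => by linarith [hk x]⟩
    · push Not at h1 h2
      exact ⟨0, fun x => le_antisymm (h1 x) (h2 x)⟩
  refine ⟨hconst, ?_⟩
  intro hC
  obtain ⟨k, hk⟩ := hconst
  push Not at hC
  obtain ⟨x0, hx0⟩ := hC
  have hu : u = fun y => 0 * u y + 0 * u y + k := by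
    funext y
    rw [hk y]; ring
  have h := hsol x0
  rw [hu, ellOp_comb A B C u u hreg hreg] at h
  have hk0 : k = 0 := by
    have : C x0 * k = 0 := by linarith
    exact (mul_eq_zero.mp this).resolve_left hx0
  intro x
  rw [hk x, hk0]
end
end
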